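/- arXiv:2508.13082 — 6 statements merged into one kernel-verified Lean document; each statement's English description precedes it below -/
import Mathlib

section
/- Let h be a fixed positive integer and let S(x;h) = ∑_{h < n ≤ x} d(n-h) d(n) d(n+h). Then as x → ∞, S(x;h) ≥ c_h x (log x)^3 / 27 + O_h(x (log x)^2); that is, there exists a constant C = C(h) > 0 such that for all sufficiently large x, S(x;h) ≥ c_h x (log x)^3 / 27 − C x (log x)^2. -/
open Real Finset

/-- `numDiv n` is the number of positive divisors of `n`. -/
def numDiv (n : ℕ) : ℕ := n.divisors.card

/-- The value of Browning's multiplicative function `f` at the prime power `p^ν` (for `ν ≥ 1`). -/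
noncomputable def fPrimePow (p ν : ℕ) : ℝ :=
  if p = 2 then 52 / 11 - (41 + 15 * ν) / (11 * 2 ^ ν)
  else (1 + 4 / (p : ℝ) + 1 / (p : ℝ) ^ 2 - (3 * ν + 4) / (p : ℝ) ^ (ν + 1)
      - 4 / (p : ℝ) ^ (ν + 2) + (3 * ν + 2) / (p : ℝ) ^ (ν + 3))
    * (1 + 2 / (p : ℝ))⁻¹ * ((1 - 1 / (p : ℝ)) ^ 2)⁻¹

/-- Browning's multiplicative function `f` with `f 1 = 1` and the prescribed prime power values. -/
noncomputable def fBrowning (h : ℕ) : ℝ :=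
  ∏ p ∈ h.primeFactors, fPrimePow p (h.factorization p)

/-- Browning's constant `c_h = (11/8) f(h) ∏_p (1 - 1/p)^2 (1 + 2/p)`. -/
noncomputable def cBrowning (h : ℕ) : ℝ :=
  11 / 8 * fBrowning h * ∏' p : Nat.Primes, (1 - 1 / ((p : ℕ) : ℝ)) ^ 2 * (1 + 2 / ((p : ℕ) : ℝ))

/-- The triple convolution sum `S(x; h) = ∑_{h < n ≤ x} d(n - h) d(n) d(n + h)`. -/
noncomputable def S (x : ℝ) (h : ℕ) : ℝ :=
  ∑ n ∈ Finset.Ioc h ⌊x⌋₊, (numDiv (n - h) * numDiv n * numDiv (n + h) : ℝ)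

/-- The `n`-th harmonic number. -/
noncomputable def harm (n : ℕ) : ℝ := ∑ k ∈ Icc 1 n, 1 / (k : ℝ)

lemma harm_nonneg (n : ℕ) : 0 ≤ harm n := sum_nonneg fun _ _ => by positivity

lemma log_le_harm (y : ℝ) (hy : 0 ≤ y) : log y ≤ harm ⌊y⌋₊ := by
  have := log_le_harmonic_floor y hy
  rw [harmonic_eq_sum_Icc] at this
  simpa [harm] using this

/-- Sums of multiplicative weights `∏_{p ∣ n} s p` against `1 / n` dominate the harmonic sum times
the expected density. -/
lemma prod_mul_harm_le_sum (T : Finset ℕ) (hT : ∀ p ∈ T, p.Prime) (s : ℕ → ℝ)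
    (h0 : ∀ p ∈ T, 0 ≤ s p) (h1 : ∀ p ∈ T, s p ≤ 1) (N : ℕ) :
    (∏ p ∈ T, (1 - (1 - s p) / p)) * harm N ≤
      ∑ n ∈ Icc 1 N, (∏ p ∈ T, if p ∣ n then s p else 1) / (n : ℝ) := by
  induction T using Finset.induction_on with
  | empty => simp [harm]
  | insert p T hp ih =>
    have ih := ih (fun q hq => hT q (mem_insert_of_mem hq)) (fun q hq => h0 q (mem_insert_of_mem hq))
      (fun q hq => h1 q (mem_insert_of_mem hq))
    have pp := hT p (mem_insert_self _ _)
    have s0 := h0 p (mem_insert_self _ _)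
    have s1 := h1 p (mem_insert_self _ _)
    have p0 : (0 : ℝ) < p := by exact_mod_cast pp.pos
    have p1 : (1 : ℝ) ≤ p := by exact_mod_cast pp.one_le
    set w : ℕ → ℝ := fun n => ∏ q ∈ T, if q ∣ n then s q else 1 with hw
    have w0 (n) : 0 ≤ w n := prod_nonneg fun q hq => by
      split_ifs
      · exact h0 q (mem_insert_of_mem hq)
      · exact zero_le_one
    have wmul (k : ℕ) : w (p * k) = w k := prod_congr rfl fun q hq => by
      have hq' := hT q (mem_insert_of_mem hq)
      have hne : q ≠ p := fun h => hp (h ▸ hq)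
      simp [hq'.dvd_mul, Nat.prime_dvd_prime_iff_eq hq' pp, hne]
    have hmult : ∑ n ∈ (Icc 1 N).filter (p ∣ ·), w n / (n : ℝ) ≤
        1 / p * ∑ n ∈ Icc 1 N, w n / (n : ℝ) := by
      have himg : (Icc 1 N).filter (p ∣ ·) = (Icc 1 (N / p)).image (p * ·) := by
        ext n
        simp only [mem_filter, mem_Icc, mem_image]
        constructor
        · rintro ⟨⟨hn, hN⟩, k, rfl⟩
          exact ⟨k, ⟨Nat.pos_of_mul_pos_left hn, (Nat.le_div_iff_mul_le pp.pos).2 (by linarith)⟩, rfl⟩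
        · rintro ⟨k, ⟨hk, hkN⟩, rfl⟩
          rw [Nat.le_div_iff_mul_le pp.pos] at hkN
          exact ⟨⟨Nat.mul_pos pp.pos hk, by linarith⟩, dvd_mul_right _ _⟩
      rw [himg, sum_image fun a _ b _ hab => Nat.eq_of_mul_eq_mul_left pp.pos hab]
      have : ∑ k ∈ Icc 1 (N / p), w (p * k) / ((p * k : ℕ) : ℝ) =
          1 / p * ∑ k ∈ Icc 1 (N / p), w k / (k : ℝ) := by
        rw [mul_sum]
        refine sum_congr rfl fun k _ => ?_
        rw [wmul]; push_cast; rw [div_mul_div_comm, one_mul]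
      rw [this]
      refine mul_le_mul_of_nonneg_left ?_ (by positivity)
      exact sum_le_sum_of_subset_of_nonneg (Icc_subset_Icc_right (Nat.div_le_self _ _))
        fun n _ _ => div_nonneg (w0 n) (by positivity)
    have hsplit : ∑ n ∈ Icc 1 N, (∏ q ∈ insert p T, if q ∣ n then s q else 1) / (n : ℝ) =
        ∑ n ∈ Icc 1 N, w n / (n : ℝ) -
          (1 - s p) * ∑ n ∈ (Icc 1 N).filter (p ∣ ·), w n / (n : ℝ) := by
      rw [sum_filter, mul_sum, ← sum_sub_distrib]
      refine sum_congr rfl fun n _ => ?_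
      rw [prod_insert hp]
      simp only [hw]
      split_ifs <;> ring
    rw [hsplit, prod_insert hp]
    have hfac : 0 ≤ 1 - (1 - s p) / p := by
      rw [sub_nonneg, div_le_one p0]; linarith
    calc _ = (1 - (1 - s p) / p) * ((∏ p ∈ T, (1 - (1 - s p) / p)) * harm N) := by ring
      _ ≤ (1 - (1 - s p) / p) * ∑ n ∈ Icc 1 N, w n / (n : ℝ) := mul_le_mul_of_nonneg_left ih hfac
      _ = ∑ n ∈ Icc 1 N, w n / (n : ℝ) - (1 - s p) * (1 / p * ∑ n ∈ Icc 1 N, w n / (n : ℝ)) := by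
        ring
      _ ≤ _ := by
        have := mul_le_mul_of_nonneg_left hmult (sub_nonneg.2 s1)
        linarith

lemma prod_ite_dvd_eq_coprime (T : Finset ℕ) (hT : ∀ p ∈ T, p.Prime) (n k : ℕ)
    (hn : ∀ p, p.Prime → p ∣ n → p ∈ T) :
    (∏ p ∈ T, if p ∣ n then (if p ∣ k then (0 : ℝ) else 1) else 1) =
      if n.Coprime k then 1 else 0 := by
  split_ifs with hc
  · refine prod_eq_one fun p hp => ?_
    split_ifs with h1 h2
    · exact absurd (Nat.dvd_gcd h1 h2) (by rw [hc]; exact (hT p hp).not_dvd_one)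
    · rfl
    · rfl
  · obtain ⟨p, pp, h1, h2⟩ := Nat.Prime.not_coprime_iff_dvd.1 hc
    exact prod_eq_zero (hn p pp h1) (by simp [h1, h2])

/-- The local density at `p` of pairwise coprime triples which are moreover coprime to `m`. -/
noncomputable def localFactor (m p : ℕ) : ℝ :=
  if p ∣ m then (1 - 1 / (p : ℝ)) ^ 3 else (1 - 1 / (p : ℝ)) ^ 2 * (1 + 2 / p)

/-- `a, b, c` are pairwise coprime and coprime to `m`. -/
def Indep (m a b c : ℕ) : Prop :=
  a.Coprime m ∧ b.Coprime (a * m) ∧ c.Coprime (a * b * m)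

instance (m a b c : ℕ) : Decidable (Indep m a b c) := by unfold Indep; infer_instance

lemma prod_localFactor_mul_harm_le (T : Finset ℕ) (hT : ∀ p ∈ T, p.Prime) (m A B C : ℕ)
    (hA : ∀ p, p.Prime → p ≤ A → p ∈ T) (hB : ∀ p, p.Prime → p ≤ B → p ∈ T)
    (hC : ∀ p, p.Prime → p ≤ C → p ∈ T) :
    (∏ p ∈ T, localFactor m p) * (harm A * harm B * harm C) ≤
      ∑ a ∈ Icc 1 A, ∑ b ∈ Icc 1 B, ∑ c ∈ Icc 1 C,
        if Indep m a b c then 1 / ((a : ℝ) * b * c) else 0 := by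
  have key {N n : ℕ} (hN : ∀ p, p.Prime → p ≤ N → p ∈ T) (hn : n ∈ Icc 1 N) :
      ∀ p, p.Prime → p ∣ n → p ∈ T := fun p pp hpn =>
    hN p pp ((Nat.le_of_dvd (mem_Icc.1 hn).1 hpn).trans (mem_Icc.1 hn).2)
  have inv1 {p : ℕ} (hp : p ∈ T) : (0 : ℝ) < 1 / p ∧ 1 / (p : ℝ) < 1 := by
    have : (1 : ℝ) < p := by exact_mod_cast (hT p hp).one_lt
    exact ⟨by positivity, by rw [div_lt_one] <;> linarith⟩
  let u : ℕ → ℝ := fun p => 1 / (p : ℝ)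
  -- the sum over `c`
  have stepC (k : ℕ) : harm C * (∏ p ∈ T, if p ∣ k then 1 - u p else 1) ≤
      ∑ c ∈ Icc 1 C, if c.Coprime k then 1 / (c : ℝ) else 0 := by
    have := prod_mul_harm_le_sum T hT (fun p => if p ∣ k then 0 else 1)
      (fun p _ => by split_ifs <;> norm_num) (fun p _ => by split_ifs <;> norm_num) C
    rw [mul_comm]
    refine (le_of_eq ?_).trans (this.trans (le_of_eq (sum_congr rfl fun c hc => ?_)))
    · congr 1
      refine prod_congr rfl fun p _ => ?_
      split_ifs <;> simp [u]
    · rw [prod_ite_dvd_eq_coprime T hT c k (key hC hc)]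
      split_ifs <;> simp
  -- the sum over `b`
  have stepB (k : ℕ) : harm B * (∏ p ∈ T, if p ∣ k then (1 - u p) ^ 2 else 1 - u p ^ 2) ≤
      ∑ b ∈ Icc 1 B, (if b.Coprime k then 1 / (b : ℝ) else 0) *
        ∏ p ∈ T, if p ∣ b * k then 1 - u p else 1 := by
    have := prod_mul_harm_le_sum T hT (fun p => if p ∣ k then 0 else 1 - u p)
      (fun p hp => by split_ifs; exacts [le_rfl, by linarith [(inv1 hp).2]])
      (fun p hp => by split_ifs; exacts [zero_le_one, by linarith [(inv1 hp).1]]) B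
    have h0 : 0 ≤ ∏ p ∈ T, (if p ∣ k then 1 - u p else 1) := prod_nonneg fun p hp => by
      split_ifs; exacts [by linarith [(inv1 hp).2], zero_le_one]
    have := mul_le_mul_of_nonneg_right this h0
    rw [sum_mul] at this
    refine (le_of_eq ?_).trans (this.trans (le_of_eq (sum_congr rfl fun b hb => ?_)))
    · rw [mul_right_comm, ← prod_mul_distrib, mul_comm]
      congr 1
      refine prod_congr rfl fun p _ => ?_
      split_ifs <;> simp only [u] <;> ring
    · have h1 : (if b.Coprime k then 1 / (b : ℝ) else 0) =
          (if b.Coprime k then 1 else 0) * (1 / (b : ℝ)) := by split_ifs <;> simp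
      rw [h1, ← prod_ite_dvd_eq_coprime T hT b k (key hB hb), mul_right_comm, ← prod_mul_distrib,
        div_mul_eq_mul_div, ← prod_mul_distrib, mul_one_div]
      congr 1
      refine prod_congr rfl fun p hp => ?_
      by_cases h1 : p ∣ b <;> by_cases h2 : p ∣ k <;> simp [(hT p hp).dvd_mul, h1, h2]
  -- the sum over `a`
  have stepA : harm A * (∏ p ∈ T, localFactor m p) ≤
      ∑ a ∈ Icc 1 A, (if a.Coprime m then 1 / (a : ℝ) else 0) *
        ∏ p ∈ T, if p ∣ a * m then (1 - u p) ^ 2 else 1 - u p ^ 2 := by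
    have := prod_mul_harm_le_sum T hT (fun p => if p ∣ m then 0 else (1 - u p) / (1 + u p))
      (fun p hp => by
        split_ifs
        exacts [le_rfl, div_nonneg (by linarith [(inv1 hp).2]) (by linarith [(inv1 hp).1])])
      (fun p hp => by
        split_ifs
        exacts [zero_le_one, (div_le_one (by linarith [(inv1 hp).1])).2 (by linarith [(inv1 hp).1])])
      A
    have h0 : 0 ≤ ∏ p ∈ T, (if p ∣ m then (1 - u p) ^ 2 else 1 - u p ^ 2) :=
      prod_nonneg fun p hp => by
        obtain ⟨h1, h2⟩ := inv1 hp
        split_ifs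
        exacts [sq_nonneg _, by simp only [u]; nlinarith]
    have := mul_le_mul_of_nonneg_right this h0
    rw [sum_mul] at this
    refine (le_of_eq ?_).trans (this.trans (le_of_eq (sum_congr rfl fun a ha => ?_)))
    · rw [mul_right_comm, ← prod_mul_distrib, mul_comm]
      congr 1
      refine prod_congr rfl fun p hp => ?_
      have hp0 : (p : ℝ) ≠ 0 := by exact_mod_cast (hT p hp).ne_zero
      have hp1 : (p : ℝ) + 1 ≠ 0 := by positivity
      unfold localFactor
      split_ifs <;> simp only [u] <;> field_simp <;> ring
    · have h1 : (if a.Coprime m then 1 / (a : ℝ) else 0) =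
          (if a.Coprime m then 1 else 0) * (1 / (a : ℝ)) := by split_ifs <;> simp
      rw [h1, ← prod_ite_dvd_eq_coprime T hT a m (key hA ha), mul_right_comm, ← prod_mul_distrib,
        div_mul_eq_mul_div, ← prod_mul_distrib, mul_one_div]
      congr 1
      refine prod_congr rfl fun p hp => ?_
      have : 1 + u p ≠ 0 := by have := (inv1 hp).1; simp only [u]; positivity
      by_cases h1 : p ∣ a <;> by_cases h2 : p ∣ m <;> simp [(hT p hp).dvd_mul, h1, h2]
      field_simp
      ring
  calc _ = (harm A * ∏ p ∈ T, localFactor m p) * harm B * harm C := by ring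
    _ ≤ (∑ a ∈ Icc 1 A, (if a.Coprime m then 1 / (a : ℝ) else 0) *
        ∏ p ∈ T, if p ∣ a * m then (1 - u p) ^ 2 else 1 - u p ^ 2) * harm B * harm C := by
      have := harm_nonneg B
      have := harm_nonneg C
      gcongr
    _ = ∑ a ∈ Icc 1 A, (if a.Coprime m then 1 / (a : ℝ) else 0) * (harm B *
        ∏ p ∈ T, if p ∣ a * m then (1 - u p) ^ 2 else 1 - u p ^ 2) * harm C := by
      rw [sum_mul, sum_mul]
      exact sum_congr rfl fun a _ => by ring
    _ ≤ ∑ a ∈ Icc 1 A, (if a.Coprime m then 1 / (a : ℝ) else 0) *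
        (∑ b ∈ Icc 1 B, (if b.Coprime (a * m) then 1 / (b : ℝ) else 0) *
        ∏ p ∈ T, if p ∣ b * (a * m) then 1 - u p else 1) * harm C := by
      have := harm_nonneg C
      refine sum_le_sum fun a _ => ?_
      refine mul_le_mul_of_nonneg_right (mul_le_mul_of_nonneg_left (stepB _) ?_) this
      split_ifs <;> positivity
    _ = ∑ a ∈ Icc 1 A, ∑ b ∈ Icc 1 B, (if a.Coprime m then 1 / (a : ℝ) else 0) *
        (if b.Coprime (a * m) then 1 / (b : ℝ) else 0) *
        (harm C * ∏ p ∈ T, if p ∣ b * (a * m) then 1 - u p else 1) := by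
      refine sum_congr rfl fun a _ => ?_
      rw [mul_sum, sum_mul]
      exact sum_congr rfl fun b _ => by ring
    _ ≤ ∑ a ∈ Icc 1 A, ∑ b ∈ Icc 1 B, (if a.Coprime m then 1 / (a : ℝ) else 0) *
        (if b.Coprime (a * m) then 1 / (b : ℝ) else 0) *
        ∑ c ∈ Icc 1 C, if c.Coprime (b * (a * m)) then 1 / (c : ℝ) else 0 := by
      refine sum_le_sum fun a _ => sum_le_sum fun b _ => mul_le_mul_of_nonneg_left (stepC _) ?_
      split_ifs <;> positivity
    _ = _ := by
      refine sum_congr rfl fun a _ => sum_congr rfl fun b _ => ?_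
      rw [mul_sum]
      refine sum_congr rfl fun c _ => ?_
      have : b * (a * m) = a * b * m := by ring
      rw [this]
      unfold Indep
      simp only [ite_and]
      split_ifs <;> ring

/-- The number of triples of exponents `(i, j, l)` with maximum `k` for which `p ^ i ∣ n - h`,
`p ^ j ∣ n` and `p ^ l ∣ n + h` have a common solution `n`. -/
def tau (h p k : ℕ) : ℕ :=
  if k ≤ h.factorization p then 3 * k ^ 2 + 3 * k + 1
  else if p = 2 then
    if k = h.factorization p + 1 then 3 * (h.factorization p + 1) ^ 2 + (h.factorization p + 1)
    else 3 * (h.factorization p + 1) ^ 2 + 2 * (h.factorization p + 1)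
  else 3 * (h.factorization p + 1) ^ 2

/-- The simultaneous divisibility conditions `a ∣ n - h`, `b ∣ n`, `c ∣ n + h`. -/
def DvdTriple (h : ℕ) (n : ℤ) (a b c : ℕ) : Prop :=
  (a : ℤ) ∣ n - h ∧ (b : ℤ) ∣ n ∧ (c : ℤ) ∣ n + h

open Classical in
/-- The triples with least common multiple `l` for which the divisibility conditions are
solvable. -/
noncomputable def triples (h l : ℕ) : Finset (ℕ × ℕ × ℕ) :=
  (l.divisors ×ˢ l.divisors ×ˢ l.divisors).filter fun t =>
    t.1.lcm (t.2.1.lcm t.2.2) = l ∧ ∃ n : ℤ, DvdTriple h n t.1 t.2.1 t.2.2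

lemma mem_triples {h l a b c : ℕ} (hl : l ≠ 0) : (a, b, c) ∈ triples h l ↔
    a.lcm (b.lcm c) = l ∧ ∃ n : ℤ, DvdTriple h n a b c := by
  simp only [triples, mem_filter, mem_product, Nat.mem_divisors, and_iff_right_iff_imp]
  rintro ⟨rfl, -⟩
  exact ⟨⟨Nat.dvd_lcm_left _ _, hl⟩, ⟨(Nat.dvd_lcm_left b c).trans (Nat.dvd_lcm_right _ _), hl⟩,
    ⟨(Nat.dvd_lcm_right b c).trans (Nat.dvd_lcm_right _ _), hl⟩⟩

lemma card_le_card_triples {h p k v w : ℕ} (pp : p.Prime) (hv : p ^ v ∣ h)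
    (hw : p ^ w ∣ 2 * h) (E : Finset (ℕ × ℕ × ℕ))
    (hE : ∀ t ∈ E, (t.1 ≤ k ∧ t.2.1 ≤ k ∧ t.2.2 ≤ k) ∧ (t.1 = k ∨ t.2.1 = k ∨ t.2.2 = k) ∧
      ((t.1 ≤ v ∧ t.2.2 ≤ v) ∨ (t.2.1 ≤ v ∧ t.2.2 ≤ w) ∨ (t.2.1 ≤ v ∧ t.1 ≤ w))) :
    E.card ≤ (triples h (p ^ k)).card := by
  refine card_le_card_of_injOn (fun t => (p ^ t.1, p ^ t.2.1, p ^ t.2.2)) ?_ ?_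
  · rintro ⟨i, j, l⟩ ht
    obtain ⟨⟨hi, hj, hl⟩, hk, hc⟩ := hE _ ht
    dsimp only at hi hj hl hk hc
    have hdv {i : ℕ} (hi : i ≤ v) : ((p ^ i : ℕ) : ℤ) ∣ h :=
      Int.natCast_dvd_natCast.2 ((pow_dvd_pow p hi).trans hv)
    have hdw {i : ℕ} (hi : i ≤ w) : ((p ^ i : ℕ) : ℤ) ∣ 2 * h := by
      exact_mod_cast (Int.natCast_dvd_natCast.2 ((pow_dvd_pow p hi).trans hw))
    refine mem_coe.2 ((mem_triples (pow_ne_zero _ pp.ne_zero)).2 ⟨?_, ?_⟩)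
    · apply Nat.dvd_antisymm
      · exact Nat.lcm_dvd (pow_dvd_pow p hi) (Nat.lcm_dvd (pow_dvd_pow p hj) (pow_dvd_pow p hl))
      · rcases hk with rfl | rfl | rfl
        · exact Nat.dvd_lcm_left _ _
        · exact (Nat.dvd_lcm_left _ _).trans (Nat.dvd_lcm_right _ _)
        · exact (Nat.dvd_lcm_right _ _).trans (Nat.dvd_lcm_right _ _)
    · rcases hc with ⟨h1, h2⟩ | ⟨h1, h2⟩ | ⟨h1, h2⟩
      · exact ⟨0, by simpa using hdv h1, dvd_zero _, by simpa using hdv h2⟩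
      · exact ⟨h, by simp, hdv h1, by simpa [two_mul] using hdw h2⟩
      · refine ⟨-h, ?_, (dvd_neg.2 (hdv h1)), by simp⟩
        have := dvd_neg.2 (hdw h2)
        rwa [two_mul, neg_add] at this
  · rintro ⟨i, j, l⟩ - ⟨i', j', l'⟩ - heq
    have inj := Nat.pow_right_injective pp.two_le
    simp only [Prod.mk.injEq] at heq ⊢
    exact ⟨inj heq.1, inj heq.2.1, inj heq.2.2⟩

lemma tau_le_card_triples {h p : ℕ} (pp : p.Prime) (k : ℕ) :
    tau h p k ≤ (triples h (p ^ k)).card := by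
  have hv : p ^ h.factorization p ∣ h := Nat.ordProj_dvd h p
  unfold tau
  set v := h.factorization p
  -- exponent triples for `k` beyond the valuation of `2 * h`
  have big (w : ℕ) (hvw : v ≤ w) (hw : p ^ w ∣ 2 * h) (hk : w < k) :
      (v + 1) ^ 2 + 2 * ((v + 1) * (w + 1)) ≤ (triples h (p ^ k)).card := by
    let E1 := range (v + 1) ×ˢ ({k} : Finset ℕ) ×ˢ range (v + 1)
    let E2 := ({k} : Finset ℕ) ×ˢ range (v + 1) ×ˢ range (w + 1)
    let E3 := range (w + 1) ×ˢ range (v + 1) ×ˢ ({k} : Finset ℕ)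
    have h12 : Disjoint E1 E2 := by
      rw [disjoint_left]; rintro ⟨i, j, l⟩; simp [E1, E2]; omega
    have h123 : Disjoint (E1 ∪ E2) E3 := by
      rw [disjoint_left]; rintro ⟨i, j, l⟩; simp [E1, E2, E3]; omega
    refine le_of_eq_of_le ?_ (card_le_card_triples pp hv hw (E1 ∪ E2 ∪ E3) ?_)
    · rw [card_union_of_disjoint h123, card_union_of_disjoint h12]
      simp [E1, E2, E3]; ring
    · rintro ⟨i, j, l⟩; simp [E1, E2, E3]; omega
  split_ifs with h1 h2 h3
  · let E := (range (k + 1) ×ˢ range (k + 1) ×ˢ range (k + 1)) \ (range k ×ˢ range k ×ˢ range k)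
    refine le_trans ?_ (card_le_card_triples pp hv (hv.mul_left 2) E ?_)
    · have := le_card_sdiff (range k ×ˢ range k ×ˢ range k)
        (range (k + 1) ×ˢ range (k + 1) ×ˢ range (k + 1))
      refine le_trans ?_ this
      simp only [card_product, card_range]
      apply Nat.le_sub_of_add_le
      apply le_of_eq; ring
    · rintro ⟨i, j, l⟩; simp [E]; omega
  · have hw : p ^ (v + 1) ∣ 2 * h := by
      rw [pow_succ', h2]; exact mul_dvd_mul_left 2 (h2 ▸ hv)
    let E1 := range (v + 1) ×ˢ ({k} : Finset ℕ) ×ˢ range (v + 1)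
    let E2 := ({k} : Finset ℕ) ×ˢ range (v + 1) ×ˢ range (v + 1)
    let E3 := range (v + 2) ×ˢ range (v + 1) ×ˢ ({k} : Finset ℕ)
    have h12 : Disjoint E1 E2 := by
      rw [disjoint_left]; rintro ⟨i, j, l⟩; simp [E1, E2]; omega
    have h123 : Disjoint (E1 ∪ E2) E3 := by
      rw [disjoint_left]; rintro ⟨i, j, l⟩; simp [E1, E2, E3]; omega
    refine le_of_eq_of_le ?_ (card_le_card_triples pp hv hw (E1 ∪ E2 ∪ E3) ?_)
    · rw [card_union_of_disjoint h123, card_union_of_disjoint h12]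
      simp [E1, E2, E3]; ring
    · rintro ⟨i, j, l⟩; simp [E1, E2, E3]; omega
  · have hw : p ^ (v + 1) ∣ 2 * h := by
      rw [pow_succ', h2]; exact mul_dvd_mul_left 2 (h2 ▸ hv)
    refine le_of_eq_of_le ?_ (big (v + 1) (by omega) hw (by omega))
    ring
  · refine le_of_eq_of_le ?_ (big v le_rfl (hv.mul_left 2) (by omega))
    ring

lemma exists_dvd_sub_and_dvd_sub {p q : ℕ} (hpq : p.Coprime q) (x y : ℤ) :
    ∃ n : ℤ, (p : ℤ) ∣ n - x ∧ (q : ℤ) ∣ n - y := by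
  obtain ⟨u, v, huv⟩ := Nat.isCoprime_iff_coprime.2 hpq
  refine ⟨x * (v * q) + y * (u * p), ⟨(y - x) * u, ?_⟩, ⟨(x - y) * v, ?_⟩⟩
  · linear_combination x * huv
  · linear_combination y * huv

lemma DvdTriple.congr {h a b c q : ℕ} {n n' : ℤ} (H : DvdTriple h n a b c) (hn : (q : ℤ) ∣ n' - n)
    (ha : a ∣ q) (hb : b ∣ q) (hc : c ∣ q) : DvdTriple h n' a b c := by
  obtain ⟨h1, h2, h3⟩ := H
  have key {a : ℕ} (ha : a ∣ q) : (a : ℤ) ∣ n' - n := (Int.natCast_dvd_natCast.2 ha).trans hn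
  refine ⟨?_, ?_, ?_⟩
  · have e : n' - h = n - h + (n' - n) := by ring
    exact e ▸ dvd_add h1 (key ha)
  · have e : n' = n + (n' - n) := by ring
    exact e ▸ dvd_add h2 (key hb)
  · have e : n' + h = n + h + (n' - n) := by ring
    exact e ▸ dvd_add h3 (key hc)

lemma DvdTriple.mul {h a b c a' b' c' : ℕ} {n : ℤ} (H : DvdTriple h n a b c)
    (H' : DvdTriple h n a' b' c') (ha : a.Coprime a') (hb : b.Coprime b') (hc : c.Coprime c') :
    DvdTriple h n (a * a') (b * b') (c * c') := by
  unfold DvdTriple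
  push_cast
  exact ⟨(Nat.isCoprime_iff_coprime.2 ha).mul_dvd H.1 H'.1,
    (Nat.isCoprime_iff_coprime.2 hb).mul_dvd H.2.1 H'.2.1,
    (Nat.isCoprime_iff_coprime.2 hc).mul_dvd H.2.2 H'.2.2⟩

lemma mul_left_injective_of_coprime {a a' b b' l l' : ℕ} (hll : l.Coprime l') (ha : a ∣ l)
    (ha' : a' ∣ l') (hb : b ∣ l) (hb' : b' ∣ l') (heq : a * a' = b * b') : a = b := by
  apply Nat.dvd_antisymm
  · exact (hll.coprime_dvd_left ha |>.coprime_dvd_right hb').dvd_of_dvd_mul_right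
      (heq ▸ dvd_mul_right a a')
  · exact (hll.coprime_dvd_left hb |>.coprime_dvd_right ha').dvd_of_dvd_mul_right
      (heq ▸ dvd_mul_right b b')

lemma dvd_of_lcm_eq {a b c l : ℕ} (h : a.lcm (b.lcm c) = l) : a ∣ l ∧ b ∣ l ∧ c ∣ l := by
  subst h
  exact ⟨Nat.dvd_lcm_left _ _, (Nat.dvd_lcm_left b c).trans (Nat.dvd_lcm_right _ _),
    (Nat.dvd_lcm_right b c).trans (Nat.dvd_lcm_right _ _)⟩

lemma card_triples_mul_le {h l l' : ℕ} (hl : l ≠ 0) (hl' : l' ≠ 0) (hll : l.Coprime l') :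
    (triples h l).card * (triples h l').card ≤ (triples h (l * l')).card := by
  rw [← card_product]
  refine card_le_card_of_injOn
    (fun t => (t.1.1 * t.2.1, t.1.2.1 * t.2.2.1, t.1.2.2 * t.2.2.2)) ?_ ?_
  · rintro ⟨⟨a, b, c⟩, a', b', c'⟩ ht
    obtain ⟨h1, h2⟩ := mem_product.1 (mem_coe.1 ht)
    rw [mem_triples hl] at h1
    rw [mem_triples hl'] at h2
    obtain ⟨e, n, hn⟩ := h1
    obtain ⟨e', n', hn'⟩ := h2
    obtain ⟨ha, hb, hc⟩ := dvd_of_lcm_eq e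
    obtain ⟨ha', hb', hc'⟩ := dvd_of_lcm_eq e'
    refine mem_coe.2 ((mem_triples (mul_ne_zero hl hl')).2 ⟨?_, ?_⟩)
    · apply Nat.dvd_antisymm
      · exact Nat.lcm_dvd (mul_dvd_mul ha ha') (Nat.lcm_dvd (mul_dvd_mul hb hb')
          (mul_dvd_mul hc hc'))
      · obtain ⟨ka, kb, kc⟩ := dvd_of_lcm_eq (a := a * a') (b := b * b') (c := c * c') rfl
        apply hll.mul_dvd_of_dvd_of_dvd
        · rw [← e]
          exact Nat.lcm_dvd ((dvd_mul_right _ _).trans ka) (Nat.lcm_dvd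
            ((dvd_mul_right _ _).trans kb) ((dvd_mul_right _ _).trans kc))
        · rw [← e']
          exact Nat.lcm_dvd ((dvd_mul_left _ _).trans ka) (Nat.lcm_dvd
            ((dvd_mul_left _ _).trans kb) ((dvd_mul_left _ _).trans kc))
    · obtain ⟨N, hN, hN'⟩ := exists_dvd_sub_and_dvd_sub hll n n'
      have cop {x y : ℕ} (hx : x ∣ l) (hy : y ∣ l') : x.Coprime y :=
        (hll.coprime_dvd_left hx).coprime_dvd_right hy
      exact ⟨N, (hn.congr hN ha hb hc).mul (hn'.congr hN' ha' hb' hc') (cop ha ha') (cop hb hb')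
        (cop hc hc')⟩
  · rintro ⟨⟨a, b, c⟩, a', b', c'⟩ ht ⟨⟨x, y, z⟩, x', y', z'⟩ hs heq
    obtain ⟨h1, h2⟩ := mem_product.1 (mem_coe.1 ht)
    obtain ⟨h3, h4⟩ := mem_product.1 (mem_coe.1 hs)
    rw [mem_triples hl] at h1 h3
    rw [mem_triples hl'] at h2 h4
    obtain ⟨ha, hb, hc⟩ := dvd_of_lcm_eq h1.1
    obtain ⟨ha', hb', hc'⟩ := dvd_of_lcm_eq h2.1
    obtain ⟨hx, hy, hz⟩ := dvd_of_lcm_eq h3.1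
    obtain ⟨hx', hy', hz'⟩ := dvd_of_lcm_eq h4.1
    simp only [Prod.mk.injEq] at heq ⊢
    obtain ⟨e1, e2, e3⟩ := heq
    refine ⟨⟨mul_left_injective_of_coprime hll ha ha' hx hx' e1,
      mul_left_injective_of_coprime hll hb hb' hy hy' e2,
      mul_left_injective_of_coprime hll hc hc' hz hz' e3⟩,
      mul_left_injective_of_coprime hll.symm ha' ha hx' hx (by rwa [mul_comm a', mul_comm x']),
      mul_left_injective_of_coprime hll.symm hb' hb hy' hy (by rwa [mul_comm b', mul_comm y']),
      mul_left_injective_of_coprime hll.symm hc' hc hz' hz (by rwa [mul_comm c', mul_comm z'])⟩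

/-- The multiplicative function with value `tau h p k` at `p ^ k`. -/
def tauMul (h l : ℕ) : ℕ := l.factorization.prod (tau h)

lemma tau_zero (h p : ℕ) : tau h p 0 = 1 := by simp [tau]

lemma tauMul_one (h : ℕ) : tauMul h 1 = 1 := by simp [tauMul]

lemma tauMul_mul {h l l' : ℕ} (hll : l.Coprime l') :
    tauMul h (l * l') = tauMul h l * tauMul h l' := by
  unfold tauMul
  rw [Nat.factorization_mul_of_coprime hll]
  exact Finsupp.prod_add_index_of_disjoint (by simpa using hll.disjoint_primeFactors) _

lemma tauMul_prime_pow {h p : ℕ} (pp : p.Prime) (k : ℕ) : tauMul h (p ^ k) = tau h p k := by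
  rw [tauMul, pp.factorization_pow, Finsupp.prod_single_index (tau_zero h p)]

lemma tauMul_le_card_triples {h l : ℕ} (hl : l ≠ 0) :
    tauMul h l ≤ (triples h l).card := by
  induction l using Nat.recOnPosPrimePosCoprime with
  | prime_pow p k pp hk => rw [tauMul_prime_pow pp]; exact tau_le_card_triples pp k
  | zero => exact absurd rfl hl
  | one =>
    have := tau_le_card_triples (h := h) Nat.prime_two 0
    rw [tau_zero, pow_zero] at this
    rwa [tauMul_one]
  | coprime a b ha hb hab iha ihb =>
    rw [tauMul_mul hab]
    exact (Nat.mul_le_mul (iha (by omega)) (ihb (by omega))).trans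
      (card_triples_mul_le (by omega) (by omega) hab)

lemma div_sub_one_le_card_filter_dvd {q : ℕ} (hq : 0 < q) (n₀ : ℤ) (h X : ℕ) :
    ((X : ℝ) - h) / q - 1 ≤ ((Ioc h X).filter fun n : ℕ => (q : ℤ) ∣ n - n₀).card := by
  have hq' : (q : ℤ) ≠ 0 := by exact_mod_cast hq.ne'
  obtain ⟨v, hv⟩ := Int.eq_ofNat_of_zero_le (Int.emod_nonneg n₀ hq')
  have hfil : (Ioc h X).filter (fun n : ℕ => (q : ℤ) ∣ n - n₀) =
      (Ioc h X).filter (fun n : ℕ => n ≡ v [MOD q]) := by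
    refine filter_congr fun n _ => ?_
    rw [← Int.natCast_modEq_iff, ← hv, Int.modEq_iff_dvd, dvd_sub_comm]
    have e : n₀ % q - (n : ℤ) = n₀ - n - (n₀ - n₀ % q) := by ring
    rw [e]
    exact (dvd_sub_left Int.dvd_self_sub_emod).symm
  rw [hfil]
  have hc := Nat.Ioc_filter_modEq_card h X hq v
  set N := ((Ioc h X).filter (fun n : ℕ => n ≡ v [MOD q])).card
  have h1 : ⌊((X : ℚ) - v) / q⌋ - ⌊((h : ℚ) - v) / q⌋ ≤ (N : ℤ) := by
    rw [hc]; exact le_max_left _ _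
  have h2 := Int.lt_floor_add_one (((X : ℚ) - v) / q)
  have h3 := Int.floor_le (((h : ℚ) - v) / q)
  have h4 : (⌊((X : ℚ) - v) / q⌋ : ℚ) - ⌊((h : ℚ) - v) / q⌋ ≤ N := by exact_mod_cast h1
  have h5 : ((X : ℚ) - h) / q - 1 ≤ N := by
    have : ((X : ℚ) - h) / q = ((X : ℚ) - v) / q - ((h : ℚ) - v) / q := by ring
    linarith
  exact_mod_cast h5

open Classical in
lemma sum_card_dvdTriple_le_S (x : ℝ) (h Y : ℕ) :
    ∑ t ∈ Icc 1 Y ×ˢ Icc 1 Y ×ˢ Icc 1 Y,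
      (((Ioc h ⌊x⌋₊).filter fun n : ℕ => DvdTriple h n t.1 t.2.1 t.2.2).card : ℝ) ≤ S x h := by
  have hswap := sum_card_bipartiteAbove_eq_sum_card_bipartiteBelow
    (s := Icc 1 Y ×ˢ Icc 1 Y ×ˢ Icc 1 Y) (t := Ioc h ⌊x⌋₊)
    (fun t (n : ℕ) => DvdTriple h n t.1 t.2.1 t.2.2)
  unfold bipartiteAbove bipartiteBelow at hswap
  unfold S
  rw [← Nat.cast_sum, hswap, Nat.cast_sum]
  refine sum_le_sum fun n hn => ?_
  obtain ⟨hn, -⟩ := mem_Ioc.1 hn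
  norm_cast
  unfold numDiv
  rw [mul_assoc, ← card_product, ← card_product]
  refine card_le_card ?_
  rintro ⟨a, b, c⟩ ht
  obtain ⟨-, h1, h2, h3⟩ := mem_filter.1 ht
  simp only [mem_product, Nat.mem_divisors]
  refine ⟨⟨?_, by omega⟩, ⟨by exact_mod_cast h2, by omega⟩, ⟨by exact_mod_cast h3, by omega⟩⟩
  rw [← Nat.cast_sub hn.le] at h1
  exact_mod_cast h1

open Classical in
lemma div_sub_le_card_dvdTriple {h m l a b c a' b' c' : ℕ} (hl : l ≠ 0)
    (hlm : ∀ p, p.Prime → p ∣ l → p ∣ m) (ht : (a, b, c) ∈ triples h l) (hi : Indep m a' b' c')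
    (ha0 : 0 < a') (hb0 : 0 < b') (hc0 : 0 < c') (x : ℝ) :
    x * (1 / ((a' : ℝ) * b' * c')) / l - (h + 2) ≤
      ((Ioc h ⌊x⌋₊).filter fun n : ℕ => DvdTriple h n (a * a') (b * b') (c * c')).card := by
  obtain ⟨hlcm, n₀, hn₀⟩ := (mem_triples hl).1 ht
  obtain ⟨ha, hb, hc⟩ := dvd_of_lcm_eq hlcm
  obtain ⟨i1, i2, i3⟩ := hi
  have hcop {k : ℕ} (hk : k.Coprime m) : l.Coprime k := by
    by_contra hnot
    obtain ⟨p, pp, h1, h2⟩ := Nat.Prime.not_coprime_iff_dvd.1 hnot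
    exact pp.not_dvd_one (hk ▸ Nat.dvd_gcd h2 (hlm p pp h1))
  have la := hcop i1
  have lb := hcop (i2.coprime_dvd_right (dvd_mul_left _ _))
  have lc := hcop (i3.coprime_dvd_right (dvd_mul_left _ _))
  have ab : a'.Coprime b' := (i2.coprime_dvd_right (dvd_mul_right _ _)).symm
  have abc : (a' * b').Coprime c' := (i3.coprime_dvd_right (dvd_mul_right _ _)).symm
  obtain ⟨n₁, u1, u2⟩ := exists_dvd_sub_and_dvd_sub ab h 0
  obtain ⟨n₂, v1, v2⟩ := exists_dvd_sub_and_dvd_sub abc n₁ (-h)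
  obtain ⟨n₃, w1, w2⟩ := exists_dvd_sub_and_dvd_sub
    (show l.Coprime (a' * b' * c') from (la.mul_right lb).mul_right lc) n₀ n₂
  have hd : DvdTriple h n₂ a' b' c' := by
    have v1a : (a' : ℤ) ∣ n₂ - n₁ := (by push_cast; exact dvd_mul_right _ _ :
      (a' : ℤ) ∣ ((a' * b' : ℕ) : ℤ)).trans v1
    have v1b : (b' : ℤ) ∣ n₂ - n₁ := (by push_cast; exact dvd_mul_left _ _ :
      (b' : ℤ) ∣ ((a' * b' : ℕ) : ℤ)).trans v1
    refine ⟨?_, ?_, by simpa using v2⟩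
    · have e : n₂ - h = n₂ - n₁ + (n₁ - h) := by ring
      exact e ▸ dvd_add v1a u1
    · have e : n₂ = n₂ - n₁ + (n₁ - 0) := by ring
      exact e ▸ dvd_add v1b u2
  have hsub : (Ioc h ⌊x⌋₊).filter (fun n : ℕ => ((l * (a' * b' * c') : ℕ) : ℤ) ∣ n - n₃) ⊆
      (Ioc h ⌊x⌋₊).filter fun n : ℕ => DvdTriple h n (a * a') (b * b') (c * c') := by
    refine fun n hn => mem_filter.2 ⟨(mem_filter.1 hn).1, ?_⟩
    have hq := (mem_filter.1 hn).2
    push_cast at hq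
    have q1 : (l : ℤ) ∣ n - n₀ := by
      have e : (n : ℤ) - n₀ = n - n₃ + (n₃ - n₀) := by ring
      exact e ▸ dvd_add ((dvd_mul_right _ _).trans hq) w1
    have q2 : ((a' * b' * c' : ℕ) : ℤ) ∣ n - n₂ := by
      have e : (n : ℤ) - n₂ = n - n₃ + (n₃ - n₂) := by ring
      refine e ▸ dvd_add ?_ w2
      push_cast
      exact (dvd_mul_left _ _).trans hq
    refine (hn₀.congr q1 ha hb hc).mul (hd.congr q2 ?_ ?_ ?_) (la.coprime_dvd_left ha)
      (lb.coprime_dvd_left hb) (lc.coprime_dvd_left hc)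
    · exact (dvd_mul_right _ _).trans (dvd_mul_right _ _)
    · exact (dvd_mul_left _ _).trans (dvd_mul_right _ _)
    · exact dvd_mul_left _ _
  have hcard := div_sub_one_le_card_filter_dvd (q := l * (a' * b' * c'))
    (Nat.mul_pos (Nat.pos_of_ne_zero hl) (by positivity)) n₃ h ⌊x⌋₊
  refine le_trans (le_trans ?_ hcard) (by exact_mod_cast card_le_card hsub)
  have hq1 : (1 : ℝ) ≤ ((l * (a' * b' * c') : ℕ) : ℝ) := by
    exact_mod_cast Nat.mul_pos (Nat.pos_of_ne_zero hl) (by positivity)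
  have e : x * (1 / ((a' : ℝ) * b' * c')) / l = x / ((l * (a' * b' * c') : ℕ) : ℝ) := by
    push_cast
    rw [mul_one_div, div_div, mul_comm (l : ℝ)]
  rw [e]
  generalize ((l * (a' * b' * c') : ℕ) : ℝ) = q at hq1
  have hfl := Nat.lt_floor_add_one x
  have : (x - (⌊x⌋₊ - h)) / q ≤ h + 1 := by
    rw [div_le_iff₀ (by linarith)]
    nlinarith [(Nat.cast_nonneg h : (0 : ℝ) ≤ h)]
  rw [sub_div] at this
  linarith

lemma sum_triples_sub_le_S {h m Y : ℕ} {x : ℝ} (F : Finset ℕ)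
    (hF0 : ∀ l ∈ F, l ≠ 0) (hFm : ∀ l ∈ F, ∀ p, p.Prime → p ∣ l → p ∣ m) :
    ∑ l ∈ F, ∑ t ∈ triples h l, x * (∑ a ∈ Icc 1 (Y / t.1), ∑ b ∈ Icc 1 (Y / t.2.1),
      ∑ c ∈ Icc 1 (Y / t.2.2), if Indep m a b c then 1 / ((a : ℝ) * b * c) else 0) / l -
        (h + 2) * (Y : ℝ) ^ 3 ≤ S x h := by
  classical
  let V : (Σ _ : ℕ, ℕ × ℕ × ℕ) → Finset (ℕ × ℕ × ℕ) := fun s =>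
    (Icc 1 (Y / s.2.1) ×ˢ Icc 1 (Y / s.2.2.1) ×ˢ Icc 1 (Y / s.2.2.2)).filter
      fun v => Indep m v.1 v.2.1 v.2.2
  let J := (F.sigma (triples h)).sigma V
  let φ : (Σ _ : (Σ _ : ℕ, ℕ × ℕ × ℕ), ℕ × ℕ × ℕ) → ℕ × ℕ × ℕ := fun s =>
    (s.1.2.1 * s.2.1, s.1.2.2.1 * s.2.2.1, s.1.2.2.2 * s.2.2.2)
  let I := Icc 1 Y ×ˢ Icc 1 Y ×ˢ Icc 1 Y
  have memJ {l a b c a' b' c' : ℕ} (hs : ⟨⟨l, a, b, c⟩, a', b', c'⟩ ∈ J) :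
      l ∈ F ∧ (a, b, c) ∈ triples h l ∧ (a' ∈ Icc 1 (Y / a) ∧ b' ∈ Icc 1 (Y / b) ∧
        c' ∈ Icc 1 (Y / c)) ∧ Indep m a' b' c' := by
    simpa [J, V, and_assoc] using hs
  have maps : ∀ s ∈ J, φ s ∈ I := by
    rintro ⟨⟨l, a, b, c⟩, a', b', c'⟩ hs
    obtain ⟨hl, ht, ⟨ha', hb', hc'⟩, -⟩ := memJ hs
    obtain ⟨ha, hb, hc⟩ := dvd_of_lcm_eq ((mem_triples (hF0 l hl)).1 ht).1
    have key {a a' : ℕ} (ha : a ∣ l) (ha' : a' ∈ Icc 1 (Y / a)) : a * a' ∈ Icc 1 Y := by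
      have pa := Nat.pos_of_dvd_of_pos ha (Nat.pos_of_ne_zero (hF0 l hl))
      rw [mem_Icc, Nat.le_div_iff_mul_le pa] at ha'
      exact mem_Icc.2 ⟨Nat.mul_pos pa ha'.1, by rw [mul_comm]; exact ha'.2⟩
    exact mem_product.2 ⟨key ha ha', mem_product.2 ⟨key hb hb', key hc hc'⟩⟩
  have inj : Set.InjOn φ J := by
    rintro ⟨⟨l, a, b, c⟩, a', b', c'⟩ hs ⟨⟨k, x, y, z⟩, x', y', z'⟩ hs' heq
    obtain ⟨hl, ht, -, i1, i2, i3⟩ := memJ hs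
    obtain ⟨hk, ht', -, j1, j2, j3⟩ := memJ hs'
    have et := ((mem_triples (hF0 l hl)).1 ht).1
    have et' := ((mem_triples (hF0 k hk)).1 ht').1
    obtain ⟨ha, hb, hc⟩ := dvd_of_lcm_eq et
    obtain ⟨hx, hy, hz⟩ := dvd_of_lcm_eq et'
    have cop {l u w : ℕ} (hl : l ∈ F) (hu : u ∣ l) (hw : w.Coprime m) : u.Coprime w := by
      by_contra hnot
      obtain ⟨p, pp, h1, h2⟩ := Nat.Prime.not_coprime_iff_dvd.1 hnot
      exact pp.not_dvd_one (hw ▸ Nat.dvd_gcd h2 (hFm l hl p pp (h1.trans hu)))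
    have key {a a' x x' : ℕ} (ha : a ∣ l) (hx : x ∣ k) (ha' : a'.Coprime m) (hx' : x'.Coprime m)
        (e : a * a' = x * x') : a = x ∧ a' = x' := by
      have h1 : a = x := Nat.dvd_antisymm
        ((cop hl ha hx').dvd_of_dvd_mul_right (e ▸ dvd_mul_right a a'))
        ((cop hk hx ha').dvd_of_dvd_mul_right (e ▸ dvd_mul_right x x'))
      subst h1
      have pa := Nat.pos_of_dvd_of_pos ha (Nat.pos_of_ne_zero (hF0 l hl))
      exact ⟨rfl, Nat.eq_of_mul_eq_mul_left pa e⟩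
    simp only [φ, Prod.mk.injEq] at heq
    obtain ⟨e1, e2, e3⟩ := heq
    obtain ⟨rfl, rfl⟩ := key ha hx i1 j1 e1
    obtain ⟨rfl, rfl⟩ := key hb hy (i2.coprime_dvd_right (dvd_mul_left _ _))
      (j2.coprime_dvd_right (dvd_mul_left _ _)) e2
    obtain ⟨rfl, rfl⟩ := key hc hz (i3.coprime_dvd_right (dvd_mul_left _ _))
      (j3.coprime_dvd_right (dvd_mul_left _ _)) e3
    obtain rfl : l = k := et.symm.trans et'
    rfl
  have hcard : (J.card : ℝ) ≤ (Y : ℝ) ^ 3 := by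
    have := card_le_card_of_injOn φ maps inj
    have hI : I.card = Y ^ 3 := by simp [I]; ring
    rw [hI] at this
    exact_mod_cast this
  let N : ℕ × ℕ × ℕ → ℝ := fun t =>
    ((Ioc h ⌊x⌋₊).filter fun n : ℕ => DvdTriple h n t.1 t.2.1 t.2.2).card
  have hmain : ∑ s ∈ J, (x * (1 / ((s.2.1 : ℝ) * s.2.2.1 * s.2.2.2)) / s.1.1 - (h + 2)) ≤
      S x h := by
    calc _ ≤ ∑ s ∈ J, N (φ s) := by
          refine sum_le_sum ?_
          rintro ⟨⟨l, a, b, c⟩, a', b', c'⟩ hs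
          obtain ⟨hl, ht, ⟨ha', hb', hc'⟩, hi⟩ := memJ hs
          exact div_sub_le_card_dvdTriple (hF0 l hl) (hFm l hl) ht hi (mem_Icc.1 ha').1
            (mem_Icc.1 hb').1 (mem_Icc.1 hc').1 x
      _ = ∑ t ∈ J.image φ, N t := (sum_image inj).symm
      _ ≤ ∑ t ∈ I, N t := sum_le_sum_of_subset_of_nonneg
          (image_subset_iff.2 maps) fun _ _ _ => Nat.cast_nonneg _
      _ ≤ S x h := sum_card_dvdTriple_le_S x h Y
  rw [sum_sub_distrib, sum_const, nsmul_eq_mul] at hmain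
  have hsum : ∑ s ∈ J, x * (1 / ((s.2.1 : ℝ) * s.2.2.1 * s.2.2.2)) / s.1.1 =
      ∑ l ∈ F, ∑ t ∈ triples h l, x * (∑ a ∈ Icc 1 (Y / t.1), ∑ b ∈ Icc 1 (Y / t.2.1),
      ∑ c ∈ Icc 1 (Y / t.2.2), if Indep m a b c then 1 / ((a : ℝ) * b * c) else 0) / l := by
    simp only [J]
    rw [sum_sigma, sum_sigma]
    refine sum_congr rfl fun l _ => sum_congr rfl fun t _ => ?_
    dsimp only
    rw [← sum_div, ← mul_sum]
    simp only [V]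
    rw [sum_filter, sum_product]
    simp only [sum_product]
  rw [hsum] at hmain
  have : (J.card : ℝ) * (h + 2) ≤ (h + 2) * (Y : ℝ) ^ 3 := by
    rw [mul_comm]; gcongr
  linarith

lemma sum_range_cubic_diff_mul_pow (u : ℝ) (n : ℕ) :
    (1 - u) ^ 3 * ∑ k ∈ range n, (3 * (k : ℝ) ^ 2 + 3 * k + 1) * u ^ k = 1 + 4 * u + u ^ 2 -
      u ^ n * (3 * (1 - u) ^ 2 * n ^ 2 + 3 * (1 - u ^ 2) * n + (1 + 4 * u + u ^ 2)) := by
  induction n with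
  | zero => simp
  | succ n ih =>
    rw [sum_range_succ, mul_add, ih]
    push_cast
    ring

lemma tau_le (h p k : ℕ) :
    tau h p k ≤ 3 * (h.factorization p + 1) ^ 2 + 2 * (h.factorization p + 1) := by
  unfold tau
  split_ifs <;> nlinarith

lemma tau_add_one (h p : ℕ) : tau h p (h.factorization p + 1) =
    if p = 2 then 3 * (h.factorization p + 1) ^ 2 + (h.factorization p + 1)
    else 3 * (h.factorization p + 1) ^ 2 := by
  rw [tau, if_neg (by simp), if_pos rfl]

lemma tau_of_add_two_le {h p k : ℕ} (hk : h.factorization p + 2 ≤ k) : tau h p k =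
    if p = 2 then 3 * (h.factorization p + 1) ^ 2 + 2 * (h.factorization p + 1)
    else 3 * (h.factorization p + 1) ^ 2 := by
  rw [tau, if_neg (show ¬k ≤ h.factorization p by omega),
    if_neg (show ¬k = h.factorization p + 1 by omega)]

lemma summable_tau_mul_pow (h p : ℕ) {u : ℝ} (h0 : 0 ≤ u) (h1 : u < 1) :
    Summable fun k => (tau h p k : ℝ) * u ^ k := by
  refine Summable.of_nonneg_of_le (fun k => by positivity) (fun k => ?_)
    ((summable_geometric_of_lt_one h0 h1).mul_left
      ((3 * (h.factorization p + 1) ^ 2 + 2 * (h.factorization p + 1) : ℕ) : ℝ))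
  exact mul_le_mul_of_nonneg_right (by exact_mod_cast tau_le h p k) (by positivity)

/-- The local sum `∑_k tau h p k / p ^ k`. -/
noncomputable def localSum (h p : ℕ) : ℝ := ∑' k, (tau h p k : ℝ) * (1 / (p : ℝ)) ^ k

lemma localSum_nonneg (h p : ℕ) : 0 ≤ localSum h p := tsum_nonneg fun k => by positivity

lemma cube_mul_tsum_tau (h p : ℕ) {u : ℝ} (h0 : 0 ≤ u) (h1 : u < 1) :
    (1 - u) ^ 3 * ∑' k, (tau h p k : ℝ) * u ^ k = 1 + 4 * u + u ^ 2 -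
      u ^ (h.factorization p + 1) * (3 * (1 - u) ^ 2 * (h.factorization p + 1) ^ 2 +
        3 * (1 - u ^ 2) * (h.factorization p + 1) + (1 + 4 * u + u ^ 2)) +
      (1 - u) ^ 3 * tau h p (h.factorization p + 1) * u ^ (h.factorization p + 1) +
      (1 - u) ^ 2 * tau h p (h.factorization p + 2) * u ^ (h.factorization p + 2) := by
  have hs := summable_tau_mul_pow h p h0 h1
  rw [← hs.sum_add_tsum_nat_add (h.factorization p + 2)]
  have htail (k : ℕ) : (tau h p (k + (h.factorization p + 2)) : ℝ) *
      u ^ (k + (h.factorization p + 2)) = tau h p (h.factorization p + 2) *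
        u ^ (h.factorization p + 2) * u ^ k := by
    have : tau h p (k + (h.factorization p + 2)) = tau h p (h.factorization p + 2) := by
      rw [tau_of_add_two_le (Nat.le_add_left _ k), tau_of_add_two_le le_rfl]
    rw [this, pow_add]; ring
  simp_rw [htail]
  rw [tsum_mul_left, tsum_geometric_of_lt_one h0 h1, sum_range_succ]
  have hhead : ∑ k ∈ range (h.factorization p + 1), (tau h p k : ℝ) * u ^ k =
      ∑ k ∈ range (h.factorization p + 1), (3 * (k : ℝ) ^ 2 + 3 * k + 1) * u ^ k := by
    refine sum_congr rfl fun k hk => ?_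
    rw [tau, if_pos (by have := mem_range.1 hk; omega)]
    push_cast; rfl
  have := sum_range_cubic_diff_mul_pow u (h.factorization p + 1)
  push_cast at this
  rw [hhead, mul_add, mul_add, this]
  have h1' : 1 - u ≠ 0 := by linarith
  field_simp

lemma one_div_prime_lt_one {p : ℕ} (pp : p.Prime) : (1 : ℝ) / p < 1 := by
  rw [div_lt_one (by exact_mod_cast pp.pos)]
  exact_mod_cast pp.one_lt

lemma cube_mul_localSum {h p : ℕ} (pp : p.Prime) :
    (1 - 1 / (p : ℝ)) ^ 3 * localSum h p = (if p = 2 then 11 / 8 else 1) *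
      fPrimePow p (h.factorization p) * ((1 - 1 / (p : ℝ)) ^ 2 * (1 + 2 / p)) := by
  have p0 : (0 : ℝ) < p := by exact_mod_cast pp.pos
  have u1 := one_div_prime_lt_one pp
  rw [localSum, cube_mul_tsum_tau h p (by positivity) u1, tau_add_one, tau_of_add_two_le le_rfl,
    fPrimePow]
  set v := h.factorization p
  split_ifs with h2
  · subst h2
    have e (y : ℝ) : y / (11 * 2 ^ v) = y * (1 / 2) ^ v / 11 := by
      rw [one_div, inv_pow]; field_simp
    push_cast
    rw [e]
    ring
  · have e (k : ℕ) (y : ℝ) : y / (p : ℝ) ^ k = y * (1 / (p : ℝ)) ^ k := by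
      rw [one_div, inv_pow, div_eq_mul_inv]
    have e1 (y : ℝ) : y / (p : ℝ) = y * (1 / (p : ℝ)) := by ring
    have ne1 : (1 - 1 / (p : ℝ)) ^ 2 ≠ 0 := pow_ne_zero _ (by linarith)
    have ne2 : 1 + 2 / (p : ℝ) ≠ 0 := by positivity
    have cancel (z s t : ℝ) (hs : s ≠ 0) (ht : t ≠ 0) : 1 * (z * s⁻¹ * t⁻¹) * (t * s) = z := by
      field_simp
    rw [cancel _ _ _ ne2 ne1]
    simp only [e, e1 4]
    push_cast
    ring

lemma fPrimePow_two_zero : fPrimePow 2 0 = 1 := by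
  norm_num [fPrimePow]

lemma fPrimePow_nonneg {h p : ℕ} (pp : p.Prime) : 0 ≤ fPrimePow p (h.factorization p) := by
  have p0 : (0 : ℝ) < p := by exact_mod_cast pp.pos
  have u1 : 0 < 1 - 1 / (p : ℝ) := sub_pos.2 (one_div_prime_lt_one pp)
  have h1 : 0 ≤ (1 - 1 / (p : ℝ)) ^ 3 * localSum h p :=
    mul_nonneg (pow_nonneg u1.le _) (localSum_nonneg h p)
  rw [cube_mul_localSum pp, mul_right_comm] at h1
  refine nonneg_of_mul_nonneg_right h1 ?_
  split_ifs <;> positivity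

lemma fBrowning_nonneg (h : ℕ) : 0 ≤ fBrowning h :=
  prod_nonneg fun _ hp => fPrimePow_nonneg (Nat.prime_of_mem_primeFactors hp)

lemma fBrowning_eq {h : ℕ} (hh : h ≠ 0) :
    fBrowning h = ∏ p ∈ (2 * h).primeFactors, fPrimePow p (h.factorization p) := by
  unfold fBrowning
  refine prod_subset (Nat.primeFactors_mono (dvd_mul_left _ _) (by omega)) fun p hp hp' => ?_
  have pp := Nat.prime_of_mem_primeFactors hp
  have hnd : ¬p ∣ h := fun hd => hp' (Nat.mem_primeFactors.2 ⟨pp, hd, hh⟩)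
  have h2 : p = 2 := (Nat.prime_dvd_prime_iff_eq pp Nat.prime_two).1
    ((pp.dvd_mul.1 (Nat.dvd_of_mem_primeFactors hp)).resolve_right hnd)
  rw [Nat.factorization_eq_zero_of_not_dvd hnd, h2, fPrimePow_two_zero]

lemma prod_localFactor_mul_prod_localSum {h : ℕ} (hh : h ≠ 0) (T : Finset ℕ)
    (hT : ∀ p ∈ T, p.Prime) (hsub : (2 * h).primeFactors ⊆ T) :
    (∏ p ∈ T, localFactor (2 * h) p) * ∏ p ∈ (2 * h).primeFactors, localSum h p =
      11 / 8 * fBrowning h * ∏ p ∈ T, (1 - 1 / (p : ℝ)) ^ 2 * (1 + 2 / p) := by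
  rw [← prod_sdiff hsub, ← prod_sdiff hsub, fBrowning_eq hh]
  have h1 : ∏ p ∈ T \ (2 * h).primeFactors, localFactor (2 * h) p =
      ∏ p ∈ T \ (2 * h).primeFactors, (1 - 1 / (p : ℝ)) ^ 2 * (1 + 2 / p) := by
    refine prod_congr rfl fun p hp => if_neg fun hd => ?_
    obtain ⟨hpT, hp⟩ := mem_sdiff.1 hp
    exact hp (Nat.mem_primeFactors.2 ⟨hT p hpT, hd, by omega⟩)
  have h2 : (∏ p ∈ (2 * h).primeFactors, localFactor (2 * h) p) *
      ∏ p ∈ (2 * h).primeFactors, localSum h p = 11 / 8 *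
      (∏ p ∈ (2 * h).primeFactors, fPrimePow p (h.factorization p)) *
      ∏ p ∈ (2 * h).primeFactors, (1 - 1 / (p : ℝ)) ^ 2 * (1 + 2 / p) := by
    have h3 : (11 / 8 : ℝ) = ∏ p ∈ (2 * h).primeFactors, if p = 2 then (11 / 8 : ℝ) else 1 := by
      rw [prod_ite_eq', if_pos (Nat.mem_primeFactors.2 ⟨Nat.prime_two, dvd_mul_right _ _, by omega⟩)]
    conv_rhs => rw [h3]
    rw [← prod_mul_distrib, ← prod_mul_distrib, ← prod_mul_distrib]
    refine prod_congr rfl fun p hp => ?_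
    rw [localFactor, if_pos (Nat.dvd_of_mem_primeFactors hp),
      cube_mul_localSum (Nat.prime_of_mem_primeFactors hp)]
  rw [h1, mul_assoc, h2]
  ring

lemma eulerFactor_mem_Icc {p : ℕ} (pp : p.Prime) :
    (1 - 1 / (p : ℝ)) ^ 2 * (1 + 2 / p) ∈ Set.Icc (0 : ℝ) 1 := by
  have u1 := one_div_prime_lt_one pp
  have u0 : 0 ≤ 1 / (p : ℝ) := by positivity
  have e : (2 : ℝ) / p = 2 * (1 / p) := by ring
  rw [e]
  generalize 1 / (p : ℝ) = u at u1 u0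
  exact ⟨by positivity, by nlinarith [mul_nonneg u0 u0, mul_nonneg (mul_nonneg u0 u0) u0]⟩

lemma multipliable_eulerFactor :
    Multipliable fun p : Nat.Primes => (1 - 1 / ((p : ℕ) : ℝ)) ^ 2 * (1 + 2 / ((p : ℕ) : ℝ)) := by
  have hs : Summable fun p : Nat.Primes => 3 * (1 / ((p : ℕ) : ℝ) ^ 2) :=
    ((Real.summable_one_div_nat_pow.2 one_lt_two).comp_injective
      Nat.Primes.coe_nat_injective).mul_left 3
  have := multipliable_one_add_of_summable (R := ℝ)
    (f := fun p : Nat.Primes => (1 - 1 / ((p : ℕ) : ℝ)) ^ 2 * (1 + 2 / ((p : ℕ) : ℝ)) - 1)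
    (Summable.of_nonneg_of_le (fun _ => norm_nonneg _) (fun p => ?_) hs)
  · simpa using this
  · obtain ⟨-, h1⟩ := eulerFactor_mem_Icc p.2
    have u0 : 0 ≤ 1 / ((p : ℕ) : ℝ) := by positivity
    rw [Real.norm_of_nonpos (by linarith), ← one_div_pow]
    have e : (2 : ℝ) / (p : ℕ) = 2 * (1 / (p : ℕ)) := by ring
    rw [e]
    generalize 1 / ((p : ℕ) : ℝ) = u at u0
    nlinarith [mul_nonneg (mul_nonneg u0 u0) u0]

lemma tprod_eulerFactor_le (T : Finset ℕ) (hT : ∀ p ∈ T, p.Prime) :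
    ∏' p : Nat.Primes, (1 - 1 / ((p : ℕ) : ℝ)) ^ 2 * (1 + 2 / ((p : ℕ) : ℝ)) ≤
      ∏ p ∈ T, (1 - 1 / (p : ℝ)) ^ 2 * (1 + 2 / p) := by
  let w : ℕ → ℝ := fun p => (1 - 1 / (p : ℝ)) ^ 2 * (1 + 2 / p)
  let T' : Finset Nat.Primes := T.subtype Nat.Prime
  have hTT' : ∏ p ∈ T, w p = ∏ p ∈ T', w p := by
    rw [← prod_subtype_of_mem w hT]
    rfl
  have hp := multipliable_eulerFactor.hasProd
  rw [HasProd, SummationFilter.unconditional_filter] at hp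
  refine le_of_tendsto hp ?_
  filter_upwards [Filter.eventually_ge_atTop T'] with s hs
  change ∏ p ∈ s, w p ≤ ∏ p ∈ T, w p
  rw [hTT', ← prod_sdiff hs]
  exact mul_le_of_le_one_left (prod_nonneg fun p _ => (eulerFactor_mem_Icc p.2).1)
    (prod_le_one (fun p _ => (eulerFactor_mem_Icc p.2).1) fun p _ => (eulerFactor_mem_Icc p.2).2)

lemma cBrowning_le {h : ℕ} (hh : h ≠ 0) (T : Finset ℕ) (hT : ∀ p ∈ T, p.Prime)
    (hsub : (2 * h).primeFactors ⊆ T) : cBrowning h ≤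
      (∏ p ∈ T, localFactor (2 * h) p) * ∏ p ∈ (2 * h).primeFactors, localSum h p := by
  rw [prod_localFactor_mul_prod_localSum hh T hT hsub, cBrowning]
  exact mul_le_mul_of_nonneg_left (tprod_eulerFactor_le T hT)
    (mul_nonneg (by norm_num) (fBrowning_nonneg h))

lemma hasSum_tauMul_mul (h : ℕ) (s : Finset ℕ) (w : ℕ →* ℝ) (w0 : ∀ n, 0 ≤ w n)
    (w1 : ∀ p, p.Prime → w p < 1) :
    HasSum (fun l : Nat.factoredNumbers s => (tauMul h l : ℝ) * w l)
      (∏ p ∈ s with p.Prime, ∑' k, (tau h p k : ℝ) * w p ^ k) := by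
  have hpow {p : ℕ} (pp : p.Prime) (k : ℕ) :
      (tauMul h (p ^ k) : ℝ) * w (p ^ k) = (tau h p k : ℝ) * w p ^ k := by
    rw [tauMul_prime_pow pp, map_pow]
  have hs := (EulerProduct.summable_and_hasSum_factoredNumbers_prod_filter_prime_tsum
    (f := fun l => (tauMul h l : ℝ) * w l) (by simp [tauMul_one])
    (fun {l l'} hll => by simp only [tauMul_mul hll, map_mul, Nat.cast_mul]; ring)
    (fun {p} pp => by
      simp only [hpow pp]
      exact (summable_tau_mul_pow h p (w0 p) (w1 p pp)).norm) s).2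
  rwa [prod_congr rfl fun p hp => tsum_congr fun k => hpow (mem_filter.1 hp).2 k] at hs

lemma hasSum_tauMul_div (h m : ℕ) :
    HasSum (fun l : Nat.factoredNumbers m.primeFactors => (tauMul h l : ℝ) / (l : ℕ))
      (∏ p ∈ m.primeFactors, localSum h p) := by
  have hs := hasSum_tauMul_mul h m.primeFactors
    { toFun := fun n => 1 / (n : ℝ)
      map_one' := by simp
      map_mul' := fun a b => by push_cast; rw [one_div_mul_one_div] }
    (fun n => by simp) (fun p pp => one_div_prime_lt_one pp)
  rw [filter_true_of_mem fun p hp => Nat.prime_of_mem_primeFactors hp] at hs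
  simpa only [MonoidHom.coe_mk, OneHom.coe_mk, mul_one_div, localSum] using hs

lemma summable_tauMul_div_sqrt (h m : ℕ) :
    Summable fun l : Nat.factoredNumbers m.primeFactors => (tauMul h l : ℝ) / √(l : ℕ) := by
  have hs := (hasSum_tauMul_mul h m.primeFactors
    { toFun := fun n => 1 / √(n : ℝ)
      map_one' := by simp
      map_mul' := fun a b => by
        push_cast; rw [Real.sqrt_mul (Nat.cast_nonneg a), one_div_mul_one_div] }
    (fun n => by simp) (fun p pp => by
      have hp : 1 < √(p : ℝ) := Real.lt_sqrt_of_sq_lt (by simpa using pp.one_lt)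
      simpa only [MonoidHom.coe_mk, OneHom.coe_mk] using
        (div_lt_one (by linarith)).2 hp)).summable
  simpa only [MonoidHom.coe_mk, OneHom.coe_mk, mul_one_div] using hs

lemma pow_three_sub_le_mul {L l₁ l₂ l₃ H₁ H₂ H₃ : ℝ} (hL : 0 ≤ L) (h₁ : 0 ≤ l₁) (h₂ : 0 ≤ l₂)
    (h₃ : 0 ≤ l₃) (p₁ : 0 ≤ H₁) (p₂ : 0 ≤ H₂) (p₃ : 0 ≤ H₃) (q₁ : L - l₁ ≤ H₁)
    (q₂ : L - l₂ ≤ H₂) (q₃ : L - l₃ ≤ H₃) :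
    L ^ 3 - L ^ 2 * (l₁ + l₂ + l₃) ≤ H₁ * H₂ * H₃ := by
  have key {l : ℝ} (hl : 0 ≤ l) : 0 ≤ max 0 (L - l) ∧ max 0 (L - l) ≤ L ∧
      L - max 0 (L - l) ≤ l :=
    ⟨le_max_left _ _, max_le hL (by linarith), by linarith [le_max_right 0 (L - l)]⟩
  obtain ⟨a₁, b₁, c₁⟩ := key h₁
  obtain ⟨a₂, b₂, c₂⟩ := key h₂
  obtain ⟨a₃, b₃, c₃⟩ := key h₃
  refine le_trans ?_ (mul_le_mul (mul_le_mul (max_le p₁ q₁) (max_le p₂ q₂) a₂ p₁)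
    (max_le p₃ q₃) a₃ (mul_nonneg p₁ p₂))
  generalize max 0 (L - l₁) = K₁ at *
  generalize max 0 (L - l₂) = K₂ at *
  generalize max 0 (L - l₃) = K₃ at *
  have e₁ : (L - K₁) * (L * L) ≤ l₁ * (L * L) := by gcongr
  have e₂ : K₁ * L * (L - K₂) ≤ L * L * l₂ := by gcongr
  have e₃ : K₁ * K₂ * (L - K₃) ≤ L * L * l₃ := by gcongr
  linarith

lemma log_sub_log_le_harm {y : ℝ} (hy : 0 < y) {a : ℕ} (ha : a ≠ 0) :
    log y - log a ≤ harm (⌊y⌋₊ / a) := by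
  rw [← Real.log_div hy.ne' (by exact_mod_cast ha), ← Nat.floor_div_natCast]
  exact log_le_harm _ (by positivity)

lemma log_le_two_mul_sqrt {l : ℕ} (hl : l ≠ 0) : log l ≤ 2 * √(l : ℝ) := by
  have h0 : (0 : ℝ) < l := by exact_mod_cast Nat.pos_of_ne_zero hl
  have := Real.log_le_sub_one_of_pos (Real.sqrt_pos.2 h0)
  rw [Real.log_sqrt h0.le] at this
  linarith

lemma log_pow_three_sub_le_harm_mul {y : ℝ} (hy : 1 ≤ y) {l a b c : ℕ} (hl : l ≠ 0) (ha : a ∣ l)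
    (hb : b ∣ l) (hc : c ∣ l) :
    log y ^ 3 - 6 * log y ^ 2 * √(l : ℝ) ≤
      harm (⌊y⌋₊ / a) * harm (⌊y⌋₊ / b) * harm (⌊y⌋₊ / c) := by
  have hlog {a : ℕ} (ha : a ∣ l) : log a ≤ 2 * √(l : ℝ) :=
    (Real.log_le_log (by exact_mod_cast Nat.pos_of_dvd_of_pos ha (Nat.pos_of_ne_zero hl))
      (by exact_mod_cast Nat.le_of_dvd (Nat.pos_of_ne_zero hl) ha)).trans
      (log_le_two_mul_sqrt hl)
  have hy0 : 0 < y := by linarith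
  refine le_trans ?_ (pow_three_sub_le_mul (Real.log_nonneg hy) (Real.log_natCast_nonneg a)
    (Real.log_natCast_nonneg b) (Real.log_natCast_nonneg c) (harm_nonneg _) (harm_nonneg _)
    (harm_nonneg _) (log_sub_log_le_harm hy0 (ne_zero_of_dvd_ne_zero hl ha))
    (log_sub_log_le_harm hy0 (ne_zero_of_dvd_ne_zero hl hb))
    (log_sub_log_le_harm hy0 (ne_zero_of_dvd_ne_zero hl hc)))
  have : log y ^ 2 * (log a + log b + log c) ≤ log y ^ 2 * (6 * √(l : ℝ)) :=
    mul_le_mul_of_nonneg_left (by linarith [hlog ha, hlog hb, hlog hc]) (sq_nonneg _)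
  linarith

lemma localFactor_mem_Icc (m : ℕ) {p : ℕ} (pp : p.Prime) :
    localFactor m p ∈ Set.Icc (0 : ℝ) 1 := by
  unfold localFactor
  have u1 := one_div_prime_lt_one pp
  have u0 : 0 ≤ 1 / (p : ℝ) := by positivity
  split_ifs
  · exact ⟨pow_nonneg (by linarith) _, pow_le_one₀ (by linarith) (by linarith)⟩
  · exact eulerFactor_mem_Icc pp

lemma prod_localFactor_mul_sum_tauMul_le_S {h : ℕ} {x : ℝ} (hx : 1 ≤ x)
    {T : Finset ℕ} (hT : ∀ p ∈ T, p.Prime)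
    (hT' : ∀ p, p.Prime → p ≤ ⌊x ^ (1 / 3 : ℝ)⌋₊ → p ∈ T) {m : ℕ} (F : Finset ℕ)
    (hF0 : ∀ l ∈ F, l ≠ 0) (hFm : ∀ l ∈ F, ∀ p, p.Prime → p ∣ l → p ∣ m) :
    x * ((∏ p ∈ T, localFactor m p) * (log x / 3) ^ 3 * ∑ l ∈ F, (tauMul h l : ℝ) / l -
      6 * (log x / 3) ^ 2 * ∑ l ∈ F, (tauMul h l : ℝ) / √(l : ℝ)) - (h + 2) * x ≤ S x h := by
  have hx0 : 0 ≤ x := by linarith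
  set y := x ^ (1 / 3 : ℝ) with hy
  have y1 : 1 ≤ y := Real.one_le_rpow hx (by norm_num)
  have ylog : log y = log x / 3 := by rw [hy, Real.log_rpow (by linarith)]; ring
  have y3 : y ^ 3 = x := by
    rw [hy, ← Real.rpow_natCast, ← Real.rpow_mul hx0]; norm_num
  have Y3 : (⌊y⌋₊ : ℝ) ^ 3 ≤ x := by
    rw [← y3]; gcongr; exact Nat.floor_le (by linarith)
  set Λ := ∏ p ∈ T, localFactor m p
  have Λ0 : 0 ≤ Λ := prod_nonneg fun p hp => (localFactor_mem_Icc m (hT p hp)).1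
  have Λ1 : Λ ≤ 1 := prod_le_one (fun p hp => (localFactor_mem_Icc m (hT p hp)).1)
    fun p hp => (localFactor_mem_Icc m (hT p hp)).2
  have hmain := sum_triples_sub_le_S (h := h) (Y := ⌊y⌋₊) (x := x) F hF0 hFm
  have hY : (h + 2 : ℝ) * (⌊y⌋₊ : ℝ) ^ 3 ≤ (h + 2) * x := by gcongr
  refine le_trans (sub_le_sub ?_ hY) hmain
  rw [mul_sum, mul_sum, ← sum_sub_distrib, mul_sum]
  refine sum_le_sum fun l hl => ?_
  have l0 := hF0 l hl
  have lpos : (0 : ℝ) < l := by exact_mod_cast Nat.pos_of_ne_zero l0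
  set M := max 0 (log y ^ 3 - 6 * log y ^ 2 * √(l : ℝ)) with hM
  have hterm : ∀ t ∈ triples h l, x * (Λ * M) / l ≤ x * (∑ a ∈ Icc 1 (⌊y⌋₊ / t.1),
      ∑ b ∈ Icc 1 (⌊y⌋₊ / t.2.1), ∑ c ∈ Icc 1 (⌊y⌋₊ / t.2.2),
        if Indep m a b c then 1 / ((a : ℝ) * b * c) else 0) / l := by
    rintro ⟨a, b, c⟩ ht
    obtain ⟨ha, hb, hc⟩ := dvd_of_lcm_eq ((mem_triples l0).1 ht).1
    have hle (a : ℕ) (p : ℕ) (pp : p.Prime) (hp : p ≤ ⌊y⌋₊ / a) : p ∈ T :=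
      hT' p pp (hp.trans (Nat.div_le_self _ _))
    gcongr
    refine le_trans ?_ (prod_localFactor_mul_harm_le T hT m _ _ _ (hle a) (hle b) (hle c))
    gcongr
    exact max_le (mul_nonneg (mul_nonneg (harm_nonneg _) (harm_nonneg _)) (harm_nonneg _))
      (log_pow_three_sub_le_harm_mul y1 l0 ha hb hc)
  calc x * (Λ * (log x / 3) ^ 3 * ((tauMul h l : ℝ) / l) -
        6 * (log x / 3) ^ 2 * ((tauMul h l : ℝ) / √(l : ℝ)))
      = tauMul h l * (x * (Λ * log y ^ 3 - 6 * log y ^ 2 * √(l : ℝ)) / l) := by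
        rw [ylog]
        have : 1 / √(l : ℝ) = √(l : ℝ) / l := by rw [Real.sqrt_div_self']
        rw [div_eq_mul_one_div _ √(l : ℝ), this]
        ring
    _ ≤ tauMul h l * (x * (Λ * M) / l) := by
        gcongr
        have h1 : Λ * (log y ^ 3 - 6 * log y ^ 2 * √(l : ℝ)) ≤ Λ * M := by
          gcongr; exact le_max_right _ _
        have h2 : Λ * (6 * log y ^ 2 * √(l : ℝ)) ≤ 1 * (6 * log y ^ 2 * √(l : ℝ)) := by gcongr
        linarith
    _ ≤ (triples h l).card * (x * (Λ * M) / l) := by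
        have : 0 ≤ M := le_max_left _ _
        gcongr
        exact tauMul_le_card_triples l0
    _ ≤ _ := by
        rw [← nsmul_eq_mul]
        exact card_nsmul_le_sum _ _ _ hterm

lemma cBrowning_mul_log_pow_le_S {h : ℕ} (hh : h ≠ 0) {x : ℝ} (hx : 1 ≤ x) :
    cBrowning h * x * log x ^ 3 / 27 ≤ S x h + (h + 2) * x + 6 * (log x / 3) ^ 2 * x *
      ∑' l : Nat.factoredNumbers (2 * h).primeFactors, (tauMul h l : ℝ) / √((l : ℕ) : ℝ) := by
  set T := (range (⌊x ^ (1 / 3 : ℝ)⌋₊ + 2 * h + 1)).filter Nat.Prime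
  have hT : ∀ p ∈ T, p.Prime := fun p hp => (mem_filter.1 hp).2
  have hT' : ∀ p, p.Prime → p ≤ ⌊x ^ (1 / 3 : ℝ)⌋₊ → p ∈ T := fun p pp hp =>
    mem_filter.2 ⟨mem_range.2 (by omega), pp⟩
  have hsub : (2 * h).primeFactors ⊆ T := fun p hp => mem_filter.2
    ⟨mem_range.2 (by have := Nat.le_of_mem_primeFactors hp; omega),
      Nat.prime_of_mem_primeFactors hp⟩
  have hlog : 0 ≤ log x := Real.log_nonneg hx
  have hc := cBrowning_le hh T hT hsub
  have hsum := ((hasSum_tauMul_div h (2 * h)).mul_left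
    (x * (∏ p ∈ T, localFactor (2 * h) p) * (log x / 3) ^ 3))
  calc cBrowning h * x * log x ^ 3 / 27 = cBrowning h * (x * (log x / 3) ^ 3) := by ring
    _ ≤ (∏ p ∈ T, localFactor (2 * h) p) * (∏ p ∈ (2 * h).primeFactors, localSum h p) *
        (x * (log x / 3) ^ 3) := by gcongr
    _ = x * (∏ p ∈ T, localFactor (2 * h) p) * (log x / 3) ^ 3 *
        ∏ p ∈ (2 * h).primeFactors, localSum h p := by ring
    _ ≤ _ := ?_
  refine hasSum_le_of_sum_le hsum fun F => ?_
  have hF (l) (hl : l ∈ F.map (Function.Embedding.subtype _)) :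
      l ∈ Nat.factoredNumbers (2 * h).primeFactors := by
    obtain ⟨l', -, rfl⟩ := mem_map.1 hl
    exact l'.2
  have hS := prod_localFactor_mul_sum_tauMul_le_S (h := h) (m := 2 * h) hx hT hT'
    (F.map (Function.Embedding.subtype _)) (fun l hl => (hF l hl).1)
    (fun l hl p pp hp => Nat.dvd_of_mem_primeFactors ((hF l hl).2 p
      ((Nat.mem_primeFactorsList (hF l hl).1).2 ⟨pp, hp⟩)))
  rw [sum_map, sum_map] at hS
  simp only [Function.Embedding.coe_subtype] at hS
  have hB := (summable_tauMul_div_sqrt h (2 * h)).sum_le_tsum F fun l _ => by positivity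
  have hB' := mul_le_mul_of_nonneg_left hB (show 0 ≤ 6 * (log x / 3) ^ 2 * x by positivity)
  rw [← mul_sum]
  linarith

theorem stmt0 (h : ℕ) (hh : 0 < h) :
    ∃ C : ℝ, 0 < C ∧ ∃ x₀ : ℝ, ∀ x ≥ x₀,
      S x h ≥ cBrowning h * x * (Real.log x) ^ 3 / 27 - C * x * (Real.log x) ^ 2 := by
  set B := ∑' l : Nat.factoredNumbers (2 * h).primeFactors, (tauMul h l : ℝ) / √((l : ℕ) : ℝ)
  have hB : 0 ≤ B := tsum_nonneg fun l => by positivity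
  refine ⟨6 / 9 * B + h + 2, by positivity, Real.exp 1, fun x hx => ?_⟩
  have x1 : 1 ≤ x := (Real.one_le_exp zero_le_one).trans hx
  have hlog : 1 ≤ log x := (Real.le_log_iff_exp_le (by linarith)).2 hx
  have hmain := cBrowning_mul_log_pow_le_S hh.ne' x1
  have hx2 : (h + 2) * x * 1 ≤ (h + 2) * x * log x ^ 2 := by
    gcongr
    exact one_le_pow₀ hlog
  linarith
end

section
/- Let h be a fixed positive integer and let S(x;h) = ∑_{h < n ≤ x} d(n-h) d(n) d(n+h). Then S(x;h) ≪_h x (log x)^3 as x → ∞; that is, there exists a constant C = C(h) > 0 such that for all x ≥ 2, S(x;h) ≤ C x (log x)^3. -/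
open Real Finset

lemma numDiv_mul_le (m n : ℕ) : numDiv (m * n) ≤ numDiv m * numDiv n := by
  unfold numDiv
  rw [Nat.divisors_mul]
  exact Finset.card_mul_le

lemma numDiv_le_prod_mul_rpow {ε : ℝ} {c : ℕ → ℝ} {n : ℕ} (hn : n ≠ 0)
    (H : ∀ p ∈ n.primeFactors, ∀ v : ℕ, (v + 1 : ℝ) ≤ c p * ((p : ℝ) ^ ε) ^ v) :
    (numDiv n : ℝ) ≤ (∏ p ∈ n.primeFactors, c p) * (n : ℝ) ^ ε := by
  have key : (n : ℝ) ^ ε = ∏ p ∈ n.primeFactors, ((p : ℝ) ^ ε) ^ n.factorization p := by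
    conv_lhs => rw [← Nat.prod_factorization_pow_eq_self hn]
    rw [Finsupp.prod, Nat.support_factorization]
    push_cast
    rw [← Real.finsetProd_rpow _ _ (fun i _ => by positivity)]
    refine Finset.prod_congr rfl fun p _ => ?_
    rw [← Real.rpow_natCast, ← Real.rpow_natCast, ← Real.rpow_mul (by positivity),
      ← Real.rpow_mul (by positivity), mul_comm]
  rw [key, ← Finset.prod_mul_distrib, numDiv, Nat.card_divisors hn]
  push_cast
  exact Finset.prod_le_prod (fun _ _ => by positivity) fun p hp => H p hp _

lemma add_one_le_two_pow (v : ℕ) : (v + 1 : ℝ) ≤ 2 ^ v := by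
  exact_mod_cast Nat.lt_two_pow_self (n := v)

lemma numDiv_le_rpow {ε : ℝ} {n : ℕ} (hn : n ≠ 0)
    (H : ∀ p : ℕ, p.Prime → p ∣ n → (2 : ℝ) ≤ (p : ℝ) ^ ε) : (numDiv n : ℝ) ≤ (n : ℝ) ^ ε := by
  have := numDiv_le_prod_mul_rpow (c := fun _ => 1) (ε := ε) hn (fun p hp v => by
    rw [one_mul]
    exact (add_one_le_two_pow v).trans (pow_le_pow_left₀ (by norm_num)
      (H p (Nat.prime_of_mem_primeFactors hp) (Nat.dvd_of_mem_primeFactors hp)) v))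
  simpa using this

lemma exists_numDiv_le_rpow_sixth :
    ∃ C : ℝ, 0 < C ∧ ∀ n : ℕ, n ≠ 0 → (numDiv n : ℝ) ≤ C * (n : ℝ) ^ (1 / 6 : ℝ) := by
  refine ⟨12 ^ 64, by positivity, fun n hn => ?_⟩
  have h1 := numDiv_le_prod_mul_rpow (c := fun p => if p < 64 then 12 else 1) (ε := 1 / 6) hn
    (fun p hp v => by
      have hp2 : (2 : ℝ) ≤ p := by exact_mod_cast (Nat.prime_of_mem_primeFactors hp).two_le
      split_ifs with h
      · have hl : (1 / 12 : ℝ) ≤ (p : ℝ) ^ (1 / 6 : ℝ) - 1 := by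
          have h2 : (1 + 1 / 12 : ℝ) ≤ (2 : ℝ) ^ (1 / 6 : ℝ) := by
            rw [one_div 6]
            exact (Real.le_rpow_inv_iff_of_pos (by norm_num) (by norm_num) (by norm_num)).2
              (by norm_num)
          have := Real.rpow_le_rpow (by norm_num) hp2 (by norm_num : (0 : ℝ) ≤ 1 / 6)
          linarith
        have hb := one_add_mul_le_pow (a := (p : ℝ) ^ (1 / 6 : ℝ) - 1) (by linarith) v
        rw [add_sub_cancel] at hb
        have : (v : ℝ) * (1 / 12) ≤ v * ((p : ℝ) ^ (1 / 6 : ℝ) - 1) := by gcongr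
        linarith
      · rw [one_mul]
        refine (add_one_le_two_pow v).trans (pow_le_pow_left₀ (by norm_num) ?_ v)
        rw [one_div]
        refine (Real.le_rpow_inv_iff_of_pos (by norm_num) (by positivity) (by norm_num)).2 ?_
        have : (64 : ℝ) ≤ p := by exact_mod_cast not_lt.1 h
        norm_num
        linarith)
  refine h1.trans ?_
  gcongr
  rw [← Finset.prod_filter, Finset.prod_const]
  refine pow_le_pow_right₀ (by norm_num) ?_
  calc _ ≤ #(range 64) := Finset.card_le_card fun p hp => mem_range.2 (mem_filter.1 hp).2
    _ = 64 := card_range _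

/-- Every `n > y` splits at its `y`-threshold: multiplying the prime factors in increasing order,
`p` is the first one at which the product exceeds `y`. -/
lemma exists_threshold_factorization {y : ℝ} (hy : 1 ≤ y) :
    ∀ n : ℕ, y < n → ∃ a p b : ℕ, n = a * (p * b) ∧ p.Prime ∧ (a : ℝ) ≤ y ∧ y < a * p ∧
      (∀ q : ℕ, q.Prime → q ∣ a → q ≤ p) ∧ (∀ q : ℕ, q.Prime → q ∣ p * b → p ≤ q) := by
  intro n
  induction n using Nat.strong_induction_on with
  | _ n ih =>
    intro hn
    have hn1 : 1 < n := by exact_mod_cast hy.trans_lt hn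
    obtain ⟨P, hP, hmax⟩ := n.primeFactors.exists_max_image id
      (Nat.nonempty_primeFactors.2 hn1)
    have hPp := Nat.prime_of_mem_primeFactors hP
    obtain ⟨m, rfl⟩ := Nat.dvd_of_mem_primeFactors hP
    have hmax' : ∀ q : ℕ, q.Prime → q ∣ P * m → q ≤ P := fun q hq hd =>
      hmax q (Nat.mem_primeFactors.2 ⟨hq, hd, by omega⟩)
    by_cases hm : y < m
    · have hm0 : 0 < m := by
        have : (0 : ℝ) < m := by linarith
        exact_mod_cast this
      obtain ⟨a, p, b, rfl, hp, ha, hap, h1, h2⟩ := ih m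
        (by nlinarith [hPp.two_le]) hm
      refine ⟨a, p, b * P, by ring, hp, ha, hap, h1, fun q hq hd => ?_⟩
      rw [← mul_assoc] at hd
      rcases (Nat.Prime.dvd_mul hq).1 hd with hd | hd
      · exact h2 q hq hd
      · rw [(Nat.prime_dvd_prime_iff_eq hq hPp).1 hd]
        exact hmax' p hp ⟨P * a * b, by ring⟩
    · refine ⟨m, P, 1, by ring, hPp, not_lt.1 hm, by push_cast at hn; linarith, fun q hq hd =>
        hmax' q hq (hd.mul_left _), fun q hq hd => ?_⟩
      rw [mul_one] at hd
      exact ((Nat.prime_dvd_prime_iff_eq hq hPp).1 hd).ge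

lemma numDiv_mul_rpow_le (a : ℕ) (θ : ℝ) :
    numDiv a * (a : ℝ) ^ θ ≤ ∑ d ∈ a.divisors, (d : ℝ) ^ (2 * θ) := by
  have h1 : ∑ d ∈ a.divisors, ((a / d : ℕ) : ℝ) ^ (2 * θ) = ∑ d ∈ a.divisors, (d : ℝ) ^ (2 * θ) :=
    Nat.sum_div_divisors a fun d => (d : ℝ) ^ (2 * θ)
  have h2 : ∑ d ∈ a.divisors, 2 * (a : ℝ) ^ θ ≤
      ∑ d ∈ a.divisors, ((d : ℝ) ^ (2 * θ) + ((a / d : ℕ) : ℝ) ^ (2 * θ)) := by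
    refine Finset.sum_le_sum fun d hd => ?_
    have hda := Nat.dvd_of_mem_divisors hd
    have e1 : (a : ℝ) ^ θ = (d : ℝ) ^ θ * ((a / d : ℕ) : ℝ) ^ θ := by
      rw [← Real.mul_rpow (by positivity) (by positivity), ← Nat.cast_mul, Nat.mul_div_cancel' hda]
    have e2 : ∀ m : ℕ, (m : ℝ) ^ (2 * θ) = ((m : ℝ) ^ θ) ^ 2 := fun m => by
      rw [mul_comm, Real.rpow_mul (by positivity), Real.rpow_two]
    rw [e1, e2, e2]
    nlinarith [sq_nonneg ((d : ℝ) ^ θ - ((a / d : ℕ) : ℝ) ^ θ)]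
  rw [Finset.sum_add_distrib, h1, Finset.sum_const, nsmul_eq_mul] at h2
  unfold numDiv
  linarith

lemma sum_log_div_primesBelow_le (Y : ℕ) :
    ∑ p ∈ (Y + 1).primesBelow, Real.log p / p ≤ Real.log Y + Real.log 4 := by
  rcases Nat.eq_zero_or_pos Y with rfl | hY
  · have : Nat.primesBelow (0 + 1) = ∅ := by decide
    rw [this]
    simpa using Real.log_nonneg (by norm_num)
  have hY' : (0 : ℝ) < Y := by exact_mod_cast hY
  have hsub : ∀ n ∈ Ioc 0 Y, ∑ p ∈ (Y + 1).primesBelow, (if p ∣ n then Real.log p else 0)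
      ≤ Real.log Y := by
    intro n hn
    obtain ⟨hn0, hnY⟩ := mem_Ioc.1 hn
    have e : (Y + 1).primesBelow.filter (· ∣ n) = n.primeFactors := by
      ext p
      simp only [mem_filter, Nat.mem_primesBelow, Nat.mem_primeFactors]
      constructor
      · rintro ⟨⟨_, h⟩, h'⟩; exact ⟨h, h', by omega⟩
      · rintro ⟨h, h', _⟩
        exact ⟨⟨by have := Nat.le_of_dvd hn0 h'; omega, h⟩, h'⟩
    rw [← Finset.sum_filter, e, ← Real.log_prod (fun p hp => by
      exact_mod_cast (Nat.prime_of_mem_primeFactors hp).ne_zero), ← Nat.cast_prod]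
    refine Real.log_le_log ?_ ?_
    · exact_mod_cast Finset.prod_pos fun p hp => (Nat.prime_of_mem_primeFactors hp).pos
    · exact_mod_cast (Nat.le_of_dvd hn0 (Nat.prod_primeFactors_dvd n)).trans hnY
  have h1 := Finset.sum_le_sum hsub
  rw [Finset.sum_comm] at h1
  have h2 : ∀ p ∈ (Y + 1).primesBelow, Y * (Real.log p / p) - Real.log p ≤
      ∑ n ∈ Ioc 0 Y, (if p ∣ n then Real.log p else 0) := by
    intro p hp
    have hp' := (Nat.mem_primesBelow.1 hp).2
    have hpp : (0 : ℝ) < p := by exact_mod_cast hp'.pos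
    rw [← Finset.sum_filter, Finset.sum_const, nsmul_eq_mul, Nat.Ioc_filter_dvd_card_eq_div]
    have hf : (Y : ℝ) / p - 1 ≤ (Y / p : ℕ) := by
      have := Nat.lt_floor_add_one ((Y : ℝ) / p)
      rw [Nat.floor_div_eq_div] at this
      linarith
    have hl : 0 ≤ Real.log p := Real.log_natCast_nonneg p
    calc _ = ((Y : ℝ) / p - 1) * Real.log p := by field_simp
      _ ≤ _ := by gcongr
  have h3 := (Finset.sum_le_sum h2).trans h1
  rw [Finset.sum_sub_distrib, ← Finset.mul_sum, Finset.sum_const, nsmul_eq_mul, Nat.card_Ioc,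
    Nat.sub_zero] at h3
  have h4 : ∑ p ∈ (Y + 1).primesBelow, Real.log p ≤ Real.log 4 * Y := by
    have := Chebyshev.theta_le_log4_mul_x hY'.le
    rw [Chebyshev.theta_eq_sum_primesLE_log] at this
    exact this
  have : (Y : ℝ) * ∑ p ∈ (Y + 1).primesBelow, Real.log p / p ≤
      Y * (Real.log Y + Real.log 4) := by linarith
  exact le_of_mul_le_mul_left this (by positivity)

/-- `n ↦ n ^ s` as a monoid homomorphism. -/
noncomputable def natRpowHom (s : ℝ) : ℕ →* ℝ where
  toFun n := (n : ℝ) ^ s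
  map_one' := by simp
  map_mul' m n := by
    push_cast
    exact Real.mul_rpow (by positivity) (by positivity)

lemma hasSum_smoothNumbers_rpow {s : ℝ} (hs : 0 < s) (Y : ℕ) :
    HasSum (fun m : Y.smoothNumbers => ((m : ℕ) : ℝ) ^ (-s))
      (∏ p ∈ Y.primesBelow, (1 - (p : ℝ) ^ (-s))⁻¹) := by
  refine (EulerProduct.summable_and_hasSum_smoothNumbers_prod_primesBelow_geometric
    (f := natRpowHom (-s)) (fun {p} hp => ?_) Y).2
  have : (1 : ℝ) < p := by exact_mod_cast hp.one_lt
  change ‖(p : ℝ) ^ (-s)‖ < 1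
  rw [Real.norm_of_nonneg (by positivity)]
  exact Real.rpow_lt_one_of_one_lt_of_neg this (by linarith)

lemma sum_rpow_smooth_le {s : ℝ} (hs : 0 < s) (Y : ℕ) (F : Finset ℕ)
    (hF : ∀ d ∈ F, d ∈ Y.smoothNumbers) :
    ∑ d ∈ F, (d : ℝ) ^ (-s) ≤ ∏ p ∈ Y.primesBelow, (1 - (p : ℝ) ^ (-s))⁻¹ := by
  have h := sum_le_hasSum (F.subtype (· ∈ Y.smoothNumbers)) (fun _ _ => by positivity)
    (hasSum_smoothNumbers_rpow hs Y)
  rwa [Finset.sum_subtype_of_mem (fun d : ℕ => (d : ℝ) ^ (-s)) hF] at h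

lemma mul_rpow_neg_one_add_le {δ x : ℝ} (hδ : 0 < δ) (hx : 0 < x) :
    δ * (x + 1) ^ (-(1 + δ)) ≤ x ^ (-δ) - (x + 1) ^ (-δ) := by
  have hx1 : 0 < x + 1 := by linarith
  have e1 : x ^ (-δ) = (x + 1) ^ (-δ) * Real.exp (δ * (Real.log (x + 1) - Real.log x)) := by
    rw [Real.rpow_def_of_pos hx, Real.rpow_def_of_pos hx1, ← Real.exp_add]
    ring_nf
  have e2 : (x + 1) ^ (-(1 + δ)) = (x + 1) ^ (-δ) * (x + 1)⁻¹ := by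
    rw [neg_add_rev, Real.rpow_add hx1, Real.rpow_neg_one]
  have h1 : (x + 1)⁻¹ ≤ Real.log (x + 1) - Real.log x := by
    rw [← Real.log_div hx1.ne' hx.ne']
    have := Real.one_sub_inv_le_log_of_pos (div_pos hx1 hx)
    rw [inv_div] at this
    refine le_trans (le_of_eq ?_) this
    field_simp
    ring
  have h2 := Real.add_one_le_exp (δ * (Real.log (x + 1) - Real.log x))
  have h3 := mul_le_mul_of_nonneg_left h1 hδ.le
  have h4 : 0 < (x + 1) ^ (-δ) := by positivity
  rw [e1, e2]
  nlinarith

lemma sum_range_rpow_le {δ : ℝ} (hδ : 0 < δ) (n : ℕ) :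
    ∑ k ∈ range (n + 1), ((k + 1 : ℕ) : ℝ) ^ (-(1 + δ)) ≤
      1 + 1 / δ - 1 / δ * (n + 1 : ℝ) ^ (-δ) := by
  induction n with
  | zero => simp
  | succ n ih =>
    rw [Finset.sum_range_succ]
    have h := mul_rpow_neg_one_add_le hδ (x := n + 1) (by positivity)
    have h' : (n + 1 + 1 : ℝ) ^ (-(1 + δ)) ≤
        1 / δ * ((n + 1 : ℝ) ^ (-δ) - (n + 1 + 1 : ℝ) ^ (-δ)) := by
      rw [one_div, ← div_eq_inv_mul, le_div_iff₀ hδ]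
      linarith
    push_cast at ih ⊢
    linarith

lemma prod_primesBelow_le {δ : ℝ} (hδ : 0 < δ) (Y : ℕ) :
    ∏ p ∈ Y.primesBelow, (1 - (p : ℝ) ^ (-(1 + δ)))⁻¹ ≤ 1 + 1 / δ := by
  refine hasSum_le_of_sum_le (hasSum_smoothNumbers_rpow (by linarith) Y) fun F => ?_
  have e : ∑ m ∈ F, ((m : ℕ) : ℝ) ^ (-(1 + δ)) =
      ∑ d ∈ F.map (Function.Embedding.subtype _), (d : ℝ) ^ (-(1 + δ)) := by
    rw [Finset.sum_map]; rfl
  rw [e]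
  set G := F.map (Function.Embedding.subtype _) with hG
  have hsub : G ⊆ (range (G.sup id + 1)).map (addRightEmbedding 1) := by
    intro d hd
    have h1 : d ≤ G.sup id := Finset.le_sup (f := id) hd
    have h2 : d ≠ 0 := by
      obtain ⟨m, _, rfl⟩ := Finset.mem_map.1 hd
      exact m.2.1
    exact Finset.mem_map.2 ⟨d - 1, mem_range.2 (by omega), by simp; omega⟩
  refine (Finset.sum_le_sum_of_subset_of_nonneg hsub fun _ _ _ => by positivity).trans ?_
  rw [Finset.sum_map]
  refine (sum_range_rpow_le hδ _).trans ?_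
  have : 0 ≤ 1 / δ * ((G.sup id : ℕ) + 1 : ℝ) ^ (-δ) := by positivity
  linarith

lemma inv_one_sub_le {A B : ℝ} (hA : A ≤ 3 / 4) (hBA : B ≤ A) :
    (1 - A)⁻¹ ≤ (1 - B)⁻¹ * Real.exp (4 * (A - B)) := by
  have h1 := Real.add_one_le_exp (4 * (A - B))
  have hB : 0 < 1 - B := by linarith
  have hA' : 0 < 1 - A := by linarith
  rw [inv_mul_eq_div, le_div_iff₀ hB, inv_mul_le_iff₀ hA']
  nlinarith

/-- Rankin-type bound for the sum of `d ^ (12 / L - 1)` over `exp L`-smooth numbers `d`. -/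
lemma exists_sum_smooth_le :
    ∃ C : ℝ, 0 < C ∧ ∀ L : ℝ, 24 ≤ L → ∀ F : Finset ℕ,
      (∀ d ∈ F, d ≠ 0 ∧ ∀ p : ℕ, p.Prime → p ∣ d → Real.log p ≤ L) →
      ∑ d ∈ F, (d : ℝ) ^ (12 / L - 1) ≤ C * L := by
  refine ⟨2 * Real.exp (104 * Real.exp 12), by positivity, fun L hL F hF => ?_⟩
  have hL0 : 0 < L := by linarith
  have hKL : 12 / L ≤ 1 / 2 := by rw [div_le_iff₀ hL0]; linarith
  set Y := ⌊Real.exp L⌋₊ with hY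
  have hY0 : 0 < Y := Nat.floor_pos.2 (Real.one_le_exp hL0.le)
  have hlogY : Real.log Y ≤ L := by
    rw [← Real.log_exp L]
    exact Real.log_le_log (by exact_mod_cast hY0) (Nat.floor_le (by positivity))
  have h1 := sum_rpow_smooth_le (s := 1 - 12 / L) (by linarith) (Y + 1) F (fun d hd =>
    Nat.mem_smoothNumbers'.2 fun p hp hpd => Nat.lt_succ_of_le <| Nat.le_floor <| by
      rw [← Real.log_le_iff_le_exp (by exact_mod_cast hp.pos)]
      exact (hF d hd).2 p hp hpd)
  rw [neg_sub] at h1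
  have hfac : ∀ p ∈ (Y + 1).primesBelow, (1 - (p : ℝ) ^ (12 / L - 1))⁻¹ ≤
      (1 - (p : ℝ) ^ (-(1 + 1 / L)))⁻¹ * Real.exp (52 * Real.exp 12 / L * (Real.log p / p)) := by
    intro p hp
    obtain ⟨hpY, hpp⟩ := Nat.mem_primesBelow.1 hp
    have hp0 : (0 : ℝ) < p := by exact_mod_cast hpp.pos
    have hp2 : (2 : ℝ) ≤ p := by exact_mod_cast hpp.two_le
    have hlp0 : 0 ≤ Real.log p := Real.log_natCast_nonneg p
    have hlp : Real.log p ≤ L :=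
      (Real.log_le_log hp0 (by exact_mod_cast Nat.lt_succ_iff.1 hpY)).trans hlogY
    set u := Real.log p / L with hu
    have hu0 : 0 ≤ u := by positivity
    have hu1 : u ≤ 1 := (div_le_one hL0).2 hlp
    have eA : (p : ℝ) ^ (12 / L - 1) = (p : ℝ)⁻¹ * Real.exp (12 * u) := by
      rw [Real.rpow_sub_one hp0.ne', Real.rpow_def_of_pos hp0, div_eq_inv_mul, hu]
      ring_nf
    have eB : (p : ℝ) ^ (-(1 + 1 / L)) = (p : ℝ)⁻¹ * Real.exp (-u) := by
      rw [neg_add, Real.rpow_add hp0, Real.rpow_neg_one, Real.rpow_def_of_pos hp0, hu]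
      ring_nf
    have hA : (p : ℝ) ^ (12 / L - 1) ≤ 3 / 4 := by
      have s1 : (p : ℝ) ^ (12 / L - 1) ≤ (p : ℝ) ^ (-(1 / 2) : ℝ) :=
        Real.rpow_le_rpow_of_exponent_le (by linarith) (by linarith)
      have s2 : (p : ℝ) ^ (-(1 / 2) : ℝ) ≤ (2 : ℝ) ^ (-(1 / 2) : ℝ) :=
        Real.rpow_le_rpow_of_nonpos (by norm_num) hp2 (by norm_num)
      have s3 : (2 : ℝ) ^ (-(1 / 2) : ℝ) ≤ 3 / 4 := by
        rw [Real.rpow_neg (by norm_num), ← Real.sqrt_eq_rpow]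
        refine inv_le_of_inv_le₀ (by norm_num) ?_
        refine Real.le_sqrt_of_sq_le ?_
        norm_num
      linarith
    have hexp : Real.exp (12 * u) - Real.exp (-u) ≤ 13 * Real.exp 12 * u := by
      have t1 : Real.exp (-u) = Real.exp (12 * u) * Real.exp (-(13 * u)) := by
        rw [← Real.exp_add]; ring_nf
      have t2 := Real.add_one_le_exp (-(13 * u))
      have t3 : Real.exp (12 * u) ≤ Real.exp 12 := Real.exp_le_exp.2 (by linarith)
      have t4 := Real.exp_pos (12 * u)
      rw [t1]
      nlinarith
    have hBA : (p : ℝ) ^ (-(1 + 1 / L)) ≤ (p : ℝ) ^ (12 / L - 1) :=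
      Real.rpow_le_rpow_of_exponent_le (by linarith) (by
        have : 0 < 12 / L := by positivity
        have : 0 < 1 / L := by positivity
        linarith)
    refine (inv_one_sub_le hA hBA).trans ?_
    have hB1 : 0 < 1 - (p : ℝ) ^ (-(1 + 1 / L)) := by linarith
    refine mul_le_mul_of_nonneg_left (Real.exp_le_exp.2 ?_) (by positivity)
    rw [eA, eB, ← mul_sub]
    calc 4 * ((p : ℝ)⁻¹ * (Real.exp (12 * u) - Real.exp (-u)))
        ≤ 4 * ((p : ℝ)⁻¹ * (13 * Real.exp 12 * u)) := by gcongr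
      _ = 52 * Real.exp 12 / L * (Real.log p / p) := by rw [hu]; field_simp; ring
  have h2 : ∏ p ∈ (Y + 1).primesBelow, (1 - (p : ℝ) ^ (12 / L - 1))⁻¹ ≤
      (∏ p ∈ (Y + 1).primesBelow, (1 - (p : ℝ) ^ (-(1 + 1 / L)))⁻¹) *
        Real.exp (52 * Real.exp 12 / L * ∑ p ∈ (Y + 1).primesBelow, Real.log p / p) := by
    rw [Finset.mul_sum, Real.exp_sum, ← Finset.prod_mul_distrib]
    refine Finset.prod_le_prod (fun p hp => ?_) hfac
    have hp1 : (1 : ℝ) < p := by exact_mod_cast (Nat.mem_primesBelow.1 hp).2.one_lt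
    have := Real.rpow_lt_one_of_one_lt_of_neg hp1 (by linarith : 12 / L - 1 < 0)
    exact inv_nonneg.2 (by linarith)
  have h3 := prod_primesBelow_le (δ := 1 / L) (by positivity) (Y + 1)
  rw [one_div_one_div] at h3
  have h4 : 52 * Real.exp 12 / L * ∑ p ∈ (Y + 1).primesBelow, Real.log p / p ≤
      104 * Real.exp 12 := by
    have hlog4 : Real.log 4 ≤ 24 := (Real.log_le_sub_one_of_pos (by norm_num)).trans (by norm_num)
    calc _ ≤ 52 * Real.exp 12 / L * (2 * L) := by
            gcongr
            linarith [sum_log_div_primesBelow_le Y]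
      _ = _ := by field_simp; ring
  calc _ ≤ _ := h1
    _ ≤ _ := h2
    _ ≤ (1 + L) * Real.exp (104 * Real.exp 12) := by gcongr
    _ ≤ _ := by nlinarith [Real.exp_pos (104 * Real.exp 12)]

/-- Every prime factor `p` of `d` satisfies `log p ≤ L`. -/
def IsLogSmooth (L : ℝ) (d : ℕ) : Prop := ∀ p : ℕ, p.Prime → p ∣ d → Real.log p ≤ L

lemma IsLogSmooth.of_dvd {L : ℝ} {a d : ℕ} (ha : IsLogSmooth L a) (h : d ∣ a) :
    IsLogSmooth L d := fun p hp hpd => ha p hp (hpd.trans h)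

open Classical in
/-- A weight whose sum over the small divisors of `n ≤ N` dominates `numDiv n`. -/
noncomputable def divWeight (C N : ℝ) (d : ℕ) : ℝ :=
  64 + ∑ k ∈ Icc 6 ⌊Real.log N / 24⌋₊, 2 * (2 / Real.exp 1) ^ k *
      (if IsLogSmooth (Real.log N / k) d then (d : ℝ) ^ (12 / (Real.log N / k)) else 0) +
    C * (if IsLogSmooth 24 d then (d : ℝ) ^ (1 / 2 : ℝ) else 0)

section Terms

variable {C : ℝ} (N : ℝ) (d : ℕ)

open Classical in
lemma ite_rpow_nonneg (P : Prop) (s : ℝ) : 0 ≤ if P then (d : ℝ) ^ s else 0 := by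
  split_ifs <;> positivity

open Classical in
lemma divWeight_middle_nonneg (k : ℕ) : 0 ≤ 2 * (2 / Real.exp 1) ^ k *
    (if IsLogSmooth (Real.log N / k) d then (d : ℝ) ^ (12 / (Real.log N / k)) else 0) :=
  mul_nonneg (by positivity) (ite_rpow_nonneg _ _ _)

lemma le_divWeight (hC : 0 ≤ C) : 64 ≤ divWeight C N d := by
  have h1 := Finset.sum_nonneg fun k (_ : k ∈ Icc 6 ⌊Real.log N / 24⌋₊) =>
    divWeight_middle_nonneg N d k
  have h2 := mul_nonneg hC (ite_rpow_nonneg d (IsLogSmooth 24 d) (1 / 2))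
  unfold divWeight
  linarith

lemma middle_le_divWeight (hC : 0 ≤ C) {k : ℕ} (hk : 6 ≤ k) (hkN : (k : ℝ) ≤ Real.log N / 24)
    (hd : IsLogSmooth (Real.log N / k) d) :
    2 * (2 / Real.exp 1) ^ k * (d : ℝ) ^ (12 / (Real.log N / k)) ≤ divWeight C N d := by
  have h1 := Finset.single_le_sum (fun k _ => divWeight_middle_nonneg N d k)
    (mem_Icc.2 ⟨hk, Nat.le_floor hkN⟩)
  rw [if_pos hd] at h1
  have h2 := mul_nonneg hC (ite_rpow_nonneg d (IsLogSmooth 24 d) (1 / 2))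
  unfold divWeight
  linarith

lemma rpow_half_le_divWeight (hd : IsLogSmooth 24 d) :
    C * (d : ℝ) ^ (1 / 2 : ℝ) ≤ divWeight C N d := by
  have h1 := Finset.sum_nonneg fun k (_ : k ∈ Icc 6 ⌊Real.log N / 24⌋₊) =>
    divWeight_middle_nonneg N d k
  unfold divWeight
  rw [if_pos hd]
  linarith

end Terms

lemma numDiv_le_two_rpow {N : ℝ} {m p : ℕ} (hp : p.Prime) (hm : m ≠ 0) (hmN : m ≤ N)
    (h : ∀ q : ℕ, q.Prime → q ∣ m → p ≤ q) :
    (numDiv m : ℝ) ≤ 2 ^ (Real.log N / Real.log p) := by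
  have hp1 : (1 : ℝ) < p := by exact_mod_cast hp.one_lt
  have hlp := Real.log_pos hp1
  have hm0 : (0 : ℝ) < m := by exact_mod_cast Nat.pos_of_ne_zero hm
  have hε : 0 ≤ Real.log 2 / Real.log p := div_nonneg (Real.log_nonneg (by norm_num)) hlp.le
  have hp2 : (p : ℝ) ^ (Real.log 2 / Real.log p) = 2 := by
    rw [Real.rpow_def_of_pos (by linarith), mul_div_cancel₀ _ hlp.ne', Real.exp_log (by norm_num)]
  refine (numDiv_le_rpow (ε := Real.log 2 / Real.log p) hm fun q hq hqm => ?_).trans ?_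
  · exact hp2.symm.le.trans
      (Real.rpow_le_rpow (by positivity) (by exact_mod_cast h q hq hqm) hε)
  · refine (Real.rpow_le_rpow hm0.le hmN hε).trans (le_of_eq ?_)
    rw [Real.rpow_def_of_pos (hm0.trans_le hmN), Real.rpow_def_of_pos (by norm_num)]
    ring_nf

/-- For `n ≤ N`, some divisor `a ≤ N ^ (1 / 3)` of `n` carries enough weight. -/
lemma exists_divisor_numDiv_le :
    ∃ C : ℝ, 0 < C ∧ ∀ N : ℝ, 2 ≤ N → ∀ n : ℕ, n ≠ 0 → n ≤ N →
      ∃ a : ℕ, a ∣ n ∧ (a : ℝ) ^ 3 ≤ N ∧ (numDiv n : ℝ) ≤ ∑ d ∈ a.divisors, divWeight C N d := by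
  obtain ⟨C₀, hC₀, hdiv⟩ := exists_numDiv_le_rpow_sixth
  refine ⟨C₀ * Real.exp 12, by positivity, fun N hN n hn hnN => ?_⟩
  set C := C₀ * Real.exp 12 with hCdef
  have hC : 0 ≤ C := by positivity
  have hN0 : 0 < N := by linarith
  have hlogN : 0 < Real.log N := Real.log_pos (by linarith)
  have hy1 : 1 ≤ N ^ (1 / 3 : ℝ) := Real.one_le_rpow (by linarith) (by norm_num)
  have hy3 : (N ^ (1 / 3 : ℝ)) ^ 3 = N := by
    rw [← Real.rpow_natCast, ← Real.rpow_mul hN0.le]; norm_num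
  have h64 : ∀ a : ℕ, 64 * (numDiv a : ℝ) ≤ ∑ d ∈ a.divisors, divWeight C N d := fun a => by
    have := Finset.card_nsmul_le_sum a.divisors (divWeight C N) 64
      fun d _ => le_divWeight N d hC
    rw [nsmul_eq_mul, mul_comm] at this
    exact this
  rcases le_or_gt (n : ℝ) (N ^ (1 / 3 : ℝ)) with hny | hny
  · refine ⟨n, dvd_rfl, ?_, ?_⟩
    · rw [← hy3]; gcongr
    · have := h64 n
      have : (0 : ℝ) ≤ numDiv n := by positivity
      linarith
  obtain ⟨a, p, b, rfl, hp, hay, hyap, hap, hpb⟩ := exists_threshold_factorization hy1 n hny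
  have ha : a ≠ 0 := left_ne_zero_of_mul hn
  have hm : p * b ≠ 0 := right_ne_zero_of_mul hn
  have ha0 : (0 : ℝ) < a := by exact_mod_cast Nat.pos_of_ne_zero ha
  have hp0 : (0 : ℝ) < p := by exact_mod_cast hp.pos
  have hlp : 0 < Real.log p := Real.log_pos (by exact_mod_cast hp.one_lt)
  refine ⟨a, dvd_mul_right _ _, by rw [← hy3]; gcongr, ?_⟩
  have hmN : ((p * b : ℕ) : ℝ) ≤ N := by
    refine le_trans ?_ hnN
    exact_mod_cast Nat.le_mul_of_pos_left _ (Nat.pos_of_ne_zero ha)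
  have hb := numDiv_le_two_rpow hp hm hmN hpb
  have hmul : (numDiv (a * (p * b)) : ℝ) ≤ numDiv a * 2 ^ (Real.log N / Real.log p) := by
    have := numDiv_mul_le a (p * b)
    calc _ ≤ (numDiv a * numDiv (p * b) : ℝ) := by exact_mod_cast this
      _ ≤ _ := by gcongr
  have hsmooth : ∀ L, Real.log p ≤ L → IsLogSmooth L a := fun L hL q hq hqa =>
    (Real.log_le_log (by exact_mod_cast hq.pos) (by exact_mod_cast hap q hq hqa)).trans hL
  have hloga : Real.log N / 3 ≤ Real.log a + Real.log p := by
    have := Real.log_le_log (by positivity) hyap.le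
    rw [Real.log_rpow hN0, Real.log_mul ha0.ne' hp0.ne'] at this
    linarith
  rcases le_or_gt (Real.log N) (6 * Real.log p) with h6 | h6
  · have h1 : Real.log N / Real.log p ≤ 6 := (div_le_iff₀ hlp).2 h6
    have h2 : (2 : ℝ) ^ (Real.log N / Real.log p) ≤ 64 := by
      refine (Real.rpow_le_rpow_of_exponent_le (by norm_num) h1).trans (le_of_eq ?_)
      norm_num
    calc _ ≤ _ := hmul
      _ ≤ numDiv a * 64 := by gcongr
      _ ≤ _ := by rw [mul_comm]; exact h64 a
  rcases le_or_gt 24 (Real.log p) with h24 | h24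
  · set k := ⌊Real.log N / Real.log p⌋₊ with hk
    have hk6 : 6 ≤ k := Nat.le_floor (by rw [le_div_iff₀ hlp]; exact_mod_cast h6.le)
    have hk0 : (0 : ℝ) < k := by exact_mod_cast (by omega : 0 < k)
    have hkle : (k : ℝ) ≤ Real.log N / Real.log p := Nat.floor_le (by positivity)
    have hklt : Real.log N / Real.log p < k + 1 := Nat.lt_floor_add_one _
    have hpk : Real.log p ≤ Real.log N / k := by
      rw [le_div_iff₀ hlp] at hkle
      rw [le_div_iff₀ hk0]
      linarith
    have hk24 : (k : ℝ) ≤ Real.log N / 24 := hkle.trans (by gcongr)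
    have h2k : (2 : ℝ) ^ (Real.log N / Real.log p) ≤ 2 * 2 ^ k := by
      refine (Real.rpow_le_rpow_of_exponent_le (by norm_num) hklt.le).trans (le_of_eq ?_)
      rw [Real.rpow_add_one (by norm_num), Real.rpow_natCast, mul_comm]
    set θ := 6 / (Real.log N / k) with hθ
    have hθ0 : 0 ≤ θ := by positivity
    have haθ : Real.exp 1 ^ k ≤ (a : ℝ) ^ θ := by
      rw [← Real.exp_nat_mul, mul_one, Real.rpow_def_of_pos ha0]
      refine Real.exp_le_exp.2 ?_
      calc (k : ℝ) = Real.log N / 6 * θ := by rw [hθ]; field_simp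
        _ ≤ _ := by
          gcongr
          linarith
    have hsum := numDiv_mul_rpow_le a θ
    have h12 : 2 * θ = 12 / (Real.log N / k) := by rw [hθ]; ring
    have he : (0 : ℝ) < Real.exp 1 ^ k := by positivity
    calc _ ≤ _ := hmul
      _ ≤ numDiv a * (2 * 2 ^ k) := by gcongr
      _ = 2 * (2 / Real.exp 1) ^ k * (numDiv a * Real.exp 1 ^ k) := by
        rw [div_pow]; field_simp
      _ ≤ 2 * (2 / Real.exp 1) ^ k * (numDiv a * (a : ℝ) ^ θ) := by gcongr
      _ ≤ 2 * (2 / Real.exp 1) ^ k * ∑ d ∈ a.divisors, (d : ℝ) ^ (2 * θ) := by gcongr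
      _ ≤ _ := by
        rw [Finset.mul_sum, h12]
        exact Finset.sum_le_sum fun d hd => middle_le_divWeight N d hC hk6 hk24
          ((hsmooth _ hpk).of_dvd (Nat.dvd_of_mem_divisors hd))
  · have h1 : N ^ (1 / 6 : ℝ) ≤ Real.exp 12 * (a : ℝ) ^ (1 / 2 : ℝ) := by
      rw [Real.rpow_def_of_pos hN0, Real.rpow_def_of_pos ha0, ← Real.exp_add]
      exact Real.exp_le_exp.2 (by linarith)
    calc _ ≤ C₀ * ((a * (p * b) : ℕ) : ℝ) ^ (1 / 6 : ℝ) := hdiv _ hn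
      _ ≤ C₀ * N ^ (1 / 6 : ℝ) := by gcongr
      _ ≤ C₀ * (Real.exp 12 * (a : ℝ) ^ (1 / 2 : ℝ)) := by gcongr
      _ = C * (a : ℝ) ^ (1 / 2 : ℝ) := by rw [hCdef]; ring
      _ ≤ divWeight C N a := rpow_half_le_divWeight N a (hsmooth _ h24.le)
      _ ≤ _ := Finset.single_le_sum (f := divWeight C N)
          (fun d _ => (by norm_num : (0 : ℝ) ≤ 64).trans (le_divWeight N d hC))
          (Nat.mem_divisors_self a ha)

lemma sum_two_div_exp_pow_le (s : Finset ℕ) : ∑ k ∈ s, (2 / Real.exp 1) ^ k ≤ 4 := by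
  have h : 2 / Real.exp 1 ≤ 3 / 4 := by
    rw [div_le_iff₀ (Real.exp_pos 1)]
    linarith [Real.exp_one_gt_d9]
  calc _ ≤ ∑ k ∈ s, (3 / 4 : ℝ) ^ k := by gcongr
    _ ≤ ∑' k : ℕ, (3 / 4 : ℝ) ^ k :=
      (summable_geometric_of_lt_one (by norm_num) (by norm_num)).sum_le_tsum _
        fun _ _ => by positivity
    _ = 4 := by rw [tsum_geometric_of_lt_one (by norm_num) (by norm_num)]; norm_num

lemma exists_sum_divWeight_div_le {C : ℝ} (hC : 0 ≤ C) :
    ∃ C' : ℝ, 0 < C' ∧ ∀ N : ℝ, 2 ≤ N → ∀ F ⊆ Icc 1 ⌊N⌋₊,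
      ∑ d ∈ F, divWeight C N d / d ≤ C' * Real.log N := by
  classical
  obtain ⟨B, hB, hsm⟩ := exists_sum_smooth_le
  have hl2 : 0 < Real.log 2 := Real.log_pos (by norm_num)
  refine ⟨64 * (1 / Real.log 2 + 1) + 8 * B + C * (B * 24) / Real.log 2, by positivity,
    fun N hN F hF => ?_⟩
  have hlogN : Real.log 2 ≤ Real.log N := Real.log_le_log (by norm_num) hN
  have hlogN0 : 0 < Real.log N := hl2.trans_le hlogN
  have h1N : 1 ≤ 1 / Real.log 2 * Real.log N := by
    rw [one_div, inv_mul_eq_div, one_le_div hl2]; exact hlogN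
  have hpos : ∀ d ∈ F, (0 : ℝ) < d := fun d hd => by
    exact_mod_cast (mem_Icc.1 (hF hd)).1
  have hlevel : ∀ L : ℝ, 24 ≤ L →
      ∑ d ∈ F, (if IsLogSmooth L d then (d : ℝ) ^ (12 / L - 1) else 0) ≤ B * L := fun L hL => by
    rw [← Finset.sum_filter]
    refine hsm L hL _ fun d hd => ⟨?_, (mem_filter.1 hd).2⟩
    have := hpos d (mem_filter.1 hd).1
    exact_mod_cast this.ne'
  have hexpand : ∀ d ∈ F, divWeight C N d / d = 64 * (d : ℝ)⁻¹ +
      ∑ k ∈ Icc 6 ⌊Real.log N / 24⌋₊, 2 * (2 / Real.exp 1) ^ k *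
        (if IsLogSmooth (Real.log N / k) d then (d : ℝ) ^ (12 / (Real.log N / k) - 1) else 0) +
      C * (if IsLogSmooth 24 d then (d : ℝ) ^ (12 / 24 - 1 : ℝ) else 0) := fun d hd => by
    have h := hpos d hd
    rw [divWeight, add_div, add_div, Finset.sum_div, div_eq_mul_inv]
    congr 2
    · refine Finset.sum_congr rfl fun k _ => ?_
      rw [mul_div_assoc, ite_div, zero_div, Real.rpow_sub_one h.ne']
    · rw [mul_div_assoc, ite_div, zero_div, Real.rpow_sub_one h.ne']
      norm_num
  rw [Finset.sum_congr rfl hexpand, Finset.sum_add_distrib, Finset.sum_add_distrib,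
    Finset.sum_comm, ← Finset.mul_sum, ← Finset.mul_sum]
  have hfirst : ∑ d ∈ F, (d : ℝ)⁻¹ ≤ 1 + Real.log N := by
    calc _ ≤ ∑ d ∈ Icc 1 ⌊N⌋₊, (d : ℝ)⁻¹ :=
          Finset.sum_le_sum_of_subset_of_nonneg hF fun _ _ _ => by positivity
      _ = (harmonic ⌊N⌋₊ : ℝ) := by
          rw [harmonic_eq_sum_Icc]; push_cast; rfl
      _ ≤ _ := harmonic_floor_le_one_add_log N (by linarith)
  have hmid : ∑ k ∈ Icc 6 ⌊Real.log N / 24⌋₊, ∑ d ∈ F, 2 * (2 / Real.exp 1) ^ k *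
      (if IsLogSmooth (Real.log N / k) d then (d : ℝ) ^ (12 / (Real.log N / k) - 1) else 0) ≤
      8 * B * Real.log N := by
    calc _ ≤ ∑ k ∈ Icc 6 ⌊Real.log N / 24⌋₊, 2 * (2 / Real.exp 1) ^ k * (B * Real.log N) := by
          refine Finset.sum_le_sum fun k hk => ?_
          obtain ⟨hk6, hk24⟩ := mem_Icc.1 hk
          have hk1 : (1 : ℝ) ≤ k := by exact_mod_cast (by omega : 1 ≤ k)
          have hk24' : (k : ℝ) ≤ Real.log N / 24 :=
            (Nat.le_floor_iff (by positivity)).1 hk24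
          rw [← Finset.mul_sum]
          have h1 := hlevel (Real.log N / k) (by
            rw [le_div_iff₀ (by linarith)]; linarith)
          have h2 : Real.log N / k ≤ Real.log N := div_le_self hlogN0.le hk1
          gcongr
          exact h1.trans (by gcongr)
      _ = 2 * (B * Real.log N) * ∑ k ∈ Icc 6 ⌊Real.log N / 24⌋₊, (2 / Real.exp 1) ^ k := by
          rw [Finset.mul_sum]
          exact Finset.sum_congr rfl fun _ _ => by ring
      _ ≤ 2 * (B * Real.log N) * 4 := by
          gcongr
          exact sum_two_div_exp_pow_le _
      _ = _ := by ring
  have hlast := mul_le_mul_of_nonneg_left (hlevel 24 le_rfl) hC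
  have hlast' : C * (B * 24) ≤ C * (B * 24) / Real.log 2 * Real.log N := by
    calc C * (B * 24) = C * (B * 24) * 1 := by ring
      _ ≤ C * (B * 24) * (1 / Real.log 2 * Real.log N) := by gcongr
      _ = _ := by ring
  nlinarith

lemma card_residue_class_le {l X : ℕ} (T : Finset ℕ) (hT : ∀ n ∈ T, n ≤ X)
    (h : ∀ m ∈ T, ∀ n ∈ T, m ≡ n [MOD l]) : #T ≤ X / l + 1 := by
  have : #T ≤ #(range (X / l + 1)) := by
    refine Finset.card_le_card_of_injOn (· / l) (fun n hn => ?_) fun m hm n hn hmn => ?_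
    · simpa using Nat.lt_succ_of_le (Nat.div_le_div_right (hT n hn))
    · have h1 : m % l = n % l := h m hm n hn
      have h2 : m / l = n / l := hmn
      rw [← Nat.div_add_mod m l, ← Nat.div_add_mod n l, h1, h2]
  simpa using this

lemma mul_mul_dvd_mul_lcm {h a b c n : ℕ} (hh : 0 < h) (hn : h ≤ n)
    (ha : a ∣ n - h) (hb : b ∣ n) (hc : c ∣ n + h) :
    a * b * c ∣ 2 * h ^ 3 * (a.lcm b).lcm c := by
  have hab : a.gcd b ∣ h := by
    have := Nat.dvd_sub ((a.gcd_dvd_right b).trans hb) ((a.gcd_dvd_left b).trans ha)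
    rwa [Nat.sub_sub_self hn] at this
  have hbc : b.gcd c ∣ h := by
    have := Nat.dvd_sub ((b.gcd_dvd_right c).trans hc) ((b.gcd_dvd_left c).trans hb)
    rwa [Nat.add_sub_cancel_left] at this
  have hac : a.gcd c ∣ 2 * h := by
    have := Nat.dvd_sub ((a.gcd_dvd_right c).trans hc) ((a.gcd_dvd_left c).trans ha)
    rwa [show n + h - (n - h) = 2 * h by omega] at this
  have h1 : (a.lcm b).gcd c ∣ 2 * h * h := by
    have e : (a.lcm b).gcd c ∣ a.gcd c * b.gcd c := by
      refine (Nat.gcd_dvd_gcd_of_dvd_left c (Nat.lcm_dvd_mul a b)).trans ?_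
      simpa only [Nat.gcd_comm c] using Nat.gcd_mul_right_dvd_mul_gcd c a b
    exact e.trans (mul_dvd_mul hac hbc)
  calc a * b * c = a.gcd b * ((a.lcm b).gcd c * (a.lcm b).lcm c) := by
        rw [Nat.gcd_mul_lcm, ← mul_assoc, Nat.gcd_mul_lcm]
    _ ∣ h * (2 * h * h * (a.lcm b).lcm c) := mul_dvd_mul hab (mul_dvd_mul_right h1 _)
    _ = _ := by ring

/-- The number of `n ≤ X` with `a ∣ n - h`, `b ∣ n`, `c ∣ n + h`. -/
lemma card_triple_dvd_le {h X a b c : ℕ} (hh : 0 < h) (ha : a ≠ 0) (hb : b ≠ 0) (hc : c ≠ 0) :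
    #{n ∈ Ioc h X | a ∣ n - h ∧ b ∣ n ∧ c ∣ n + h} * (a * b * c) ≤
      2 * h ^ 3 * (X + a * b * c) := by
  set T := {n ∈ Ioc h X | a ∣ n - h ∧ b ∣ n ∧ c ∣ n + h} with hT
  rcases T.eq_empty_or_nonempty with h0 | ⟨n₀, hn₀⟩
  · simp [h0]
  have hmem : ∀ n ∈ T, h ≤ n ∧ n ≤ X ∧ a ∣ n - h ∧ b ∣ n ∧ c ∣ n + h := fun n hn => by
    obtain ⟨h1, h2⟩ := mem_filter.1 hn
    exact ⟨(mem_Ioc.1 h1).1.le, (mem_Ioc.1 h1).2, h2⟩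
  set l := (a.lcm b).lcm c with hl
  have hl0 : l ≠ 0 := Nat.lcm_ne_zero (Nat.lcm_ne_zero ha hb) hc
  have hcong : ∀ m ∈ T, ∀ n ∈ T, m ≡ n [MOD l] := fun m hm n hn => by
    obtain ⟨m0, -, m1, m2, m3⟩ := hmem m hm
    obtain ⟨n0, -, n1, n2, n3⟩ := hmem n hn
    rw [Nat.modEq_iff_dvd]
    have k1 : (a : ℤ) ∣ n - m := by
      have e1 : (a : ℤ) ∣ ((n - h : ℕ) : ℤ) := by exact_mod_cast n1
      have e2 : (a : ℤ) ∣ ((m - h : ℕ) : ℤ) := by exact_mod_cast m1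
      have := dvd_sub e1 e2
      rwa [Nat.cast_sub n0, Nat.cast_sub m0, sub_sub_sub_cancel_right] at this
    have k2 : (b : ℤ) ∣ n - m := dvd_sub (by exact_mod_cast n2) (by exact_mod_cast m2)
    have k3 : (c : ℤ) ∣ n - m := by
      have e1 : (c : ℤ) ∣ ((n + h : ℕ) : ℤ) := by exact_mod_cast n3
      have e2 : (c : ℤ) ∣ ((m + h : ℕ) : ℤ) := by exact_mod_cast m3
      have := dvd_sub e1 e2
      rwa [Nat.cast_add, Nat.cast_add, add_sub_add_right_eq_sub] at this
    rw [Int.natCast_dvd] at *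
    exact Nat.lcm_dvd (Nat.lcm_dvd k1 k2) k3
  have hcard := card_residue_class_le T (fun n hn => (hmem n hn).2.1) hcong
  obtain ⟨p0, -, p1, p2, p3⟩ := hmem n₀ hn₀
  have hprod : a * b * c ≤ 2 * h ^ 3 * l :=
    Nat.le_of_dvd (by positivity) (mul_mul_dvd_mul_lcm hh p0 p1 p2 p3)
  have hl' : l ≤ a * b * c := by
    refine Nat.le_of_dvd (by positivity) (Nat.lcm_dvd (Nat.lcm_dvd ?_ ?_) ?_)
    · exact ⟨b * c, by ring⟩
    · exact ⟨a * c, by ring⟩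
    · exact ⟨a * b, by ring⟩
  calc #T * (a * b * c) ≤ (X / l + 1) * (2 * h ^ 3 * l) := Nat.mul_le_mul hcard hprod
    _ = 2 * h ^ 3 * (X / l * l + l) := by ring
    _ ≤ 2 * h ^ 3 * (X + a * b * c) := by
      gcongr
      exact Nat.div_mul_le_self X l

lemma mul_mul_le_of_pow_three_le {a b c N : ℝ} (ha : 0 ≤ a) (hb : 0 ≤ b) (hc : 0 ≤ c)
    (ha3 : a ^ 3 ≤ N) (hb3 : b ^ 3 ≤ N) (hc3 : c ^ 3 ≤ N) : a * b * c ≤ N := by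
  have hN : 0 ≤ N := le_trans (by positivity) ha3
  refine le_of_pow_le_pow_left₀ three_ne_zero hN ?_
  calc (a * b * c) ^ 3 = a ^ 3 * b ^ 3 * c ^ 3 := by ring
    _ ≤ N * N * N := by gcongr
    _ = N ^ 3 := by ring

lemma sum_triple_le {h X : ℕ} {N : ℝ} (hh : 0 < h) (hXN : X ≤ N) (D : Finset ℕ)
    (hD : ∀ d ∈ D, d ≠ 0 ∧ (d : ℝ) ^ 3 ≤ N) (w : ℕ → ℝ) (hw : ∀ d, 0 ≤ w d) :
    ∑ n ∈ Ioc h X, (∑ a ∈ D, if a ∣ n - h then w a else 0) *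
      (∑ b ∈ D, if b ∣ n then w b else 0) * (∑ c ∈ D, if c ∣ n + h then w c else 0) ≤
      4 * h ^ 3 * N * (∑ d ∈ D, w d / d) ^ 3 := by
  have e1 : ∀ n, (∑ a ∈ D, if a ∣ n - h then w a else 0) *
      (∑ b ∈ D, if b ∣ n then w b else 0) * (∑ c ∈ D, if c ∣ n + h then w c else 0) =
      ∑ a ∈ D, ∑ b ∈ D, ∑ c ∈ D,
        if a ∣ n - h ∧ b ∣ n ∧ c ∣ n + h then w a * w b * w c else 0 := fun n => by
    rw [Finset.sum_mul_sum, Finset.sum_mul]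
    refine Finset.sum_congr rfl fun a _ => ?_
    rw [Finset.sum_mul_sum]
    refine Finset.sum_congr rfl fun b _ => Finset.sum_congr rfl fun c _ => ?_
    by_cases p : a ∣ n - h <;> by_cases q : b ∣ n <;> by_cases r : c ∣ n + h <;> simp [p, q, r]
  have e2 : (∑ d ∈ D, w d / d) ^ 3 =
      ∑ a ∈ D, ∑ b ∈ D, ∑ c ∈ D, w a / a * (w b / b) * (w c / c) := by
    rw [pow_three', Finset.sum_mul_sum, Finset.sum_mul]
    exact Finset.sum_congr rfl fun a _ => Finset.sum_mul_sum _ _ _ _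
  rw [Finset.sum_congr rfl fun n _ => e1 n, e2, Finset.sum_comm, Finset.mul_sum]
  refine Finset.sum_le_sum fun a ha => ?_
  rw [Finset.sum_comm, Finset.mul_sum]
  refine Finset.sum_le_sum fun b hb => ?_
  rw [Finset.sum_comm, Finset.mul_sum]
  refine Finset.sum_le_sum fun c hc => ?_
  rw [← Finset.sum_filter, Finset.sum_const, nsmul_eq_mul]
  obtain ⟨ha0, ha3⟩ := hD a ha
  obtain ⟨hb0, hb3⟩ := hD b hb
  obtain ⟨hc0, hc3⟩ := hD c hc
  have hcount := card_triple_dvd_le (X := X) hh ha0 hb0 hc0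
  set t := #{n ∈ Ioc h X | a ∣ n - h ∧ b ∣ n ∧ c ∣ n + h}
  have hcount' : (t : ℝ) * (a * b * c) ≤ 2 * h ^ 3 * (X + a * b * c) := by exact_mod_cast hcount
  have hprod := mul_mul_le_of_pow_three_le (by positivity) (by positivity) (by positivity)
    ha3 hb3 hc3
  have ha' : (0 : ℝ) < a := by exact_mod_cast Nat.pos_of_ne_zero ha0
  have hb' : (0 : ℝ) < b := by exact_mod_cast Nat.pos_of_ne_zero hb0
  have hc' : (0 : ℝ) < c := by exact_mod_cast Nat.pos_of_ne_zero hc0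
  have ht : (t : ℝ) ≤ 4 * h ^ 3 * N / (a * b * c) := by
    rw [le_div_iff₀ (by positivity)]
    refine hcount'.trans ?_
    calc (2 * h ^ 3 * (X + a * b * c) : ℝ) ≤ 2 * h ^ 3 * (N + N) := by gcongr
      _ = _ := by ring
  have hwww : 0 ≤ w a * w b * w c := mul_nonneg (mul_nonneg (hw a) (hw b)) (hw c)
  calc (t : ℝ) * (w a * w b * w c) ≤ 4 * h ^ 3 * N / (a * b * c) * (w a * w b * w c) := by gcongr
    _ = _ := by field_simp

lemma log_add_le {h : ℕ} {x : ℝ} (hx : 2 ≤ x) :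
    Real.log (x + h) ≤ (1 + Real.log (1 + h) / Real.log 2) * Real.log x := by
  have hl2 : 0 < Real.log 2 := Real.log_pos (by norm_num)
  have hh : (0 : ℝ) ≤ h := by positivity
  have hlx : Real.log 2 ≤ Real.log x := Real.log_le_log (by norm_num) hx
  have hlh : 0 ≤ Real.log (1 + h) := Real.log_nonneg (by linarith)
  calc Real.log (x + h) ≤ Real.log ((1 + h) * x) :=
        Real.log_le_log (by linarith) (by nlinarith)
    _ = Real.log (1 + h) / Real.log 2 * Real.log 2 + Real.log x := by
        rw [Real.log_mul (by positivity) (by positivity), div_mul_cancel₀ _ hl2.ne']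
    _ ≤ Real.log (1 + h) / Real.log 2 * Real.log x + Real.log x := by gcongr
    _ = _ := by ring

theorem stmt1 (h : ℕ) (hh : 0 < h) :
    ∃ C : ℝ, 0 < C ∧ ∀ x : ℝ, 2 ≤ x → S x h ≤ C * x * (Real.log x) ^ 3 := by
  obtain ⟨C, hC, hpt⟩ := exists_divisor_numDiv_le
  obtain ⟨C', hC', hmean⟩ := exists_sum_divWeight_div_le hC.le
  have hl2 : 0 < Real.log 2 := Real.log_pos (by norm_num)
  have hlh : 0 ≤ Real.log (1 + h) := Real.log_nonneg (by linarith [Nat.cast_nonneg (α := ℝ) h])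
  refine ⟨4 * h ^ 3 * (1 + h) * (C' * (1 + Real.log (1 + h) / Real.log 2)) ^ 3, by positivity,
    fun x hx => ?_⟩
  have hh0 : (0 : ℝ) ≤ h := by positivity
  set N := x + h with hN
  have hN2 : 2 ≤ N := by linarith
  set w := divWeight C N with hw
  have hw0 : ∀ d, 0 ≤ w d := fun d => (by norm_num : (0 : ℝ) ≤ 64).trans (le_divWeight N d hC.le)
  set D := {d ∈ Icc 1 ⌊N⌋₊ | ((d : ℕ) : ℝ) ^ 3 ≤ N} with hD
  have hbound : ∀ m : ℕ, m ≠ 0 → m ≤ N →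
      (numDiv m : ℝ) ≤ ∑ d ∈ D, if d ∣ m then w d else 0 := fun m hm hmN => by
    obtain ⟨a, ham, ha3, hle⟩ := hpt N hN2 m hm hmN
    refine hle.trans ?_
    rw [← Finset.sum_filter]
    refine Finset.sum_le_sum_of_subset_of_nonneg (fun d hd => ?_) fun d _ _ => hw0 d
    have hda := Nat.dvd_of_mem_divisors hd
    have hd1 : d ≤ a := Nat.divisor_le hd
    have hd0 : 1 ≤ d := Nat.pos_of_mem_divisors hd
    have hdm : (d : ℝ) ≤ m := by
      exact_mod_cast Nat.le_of_dvd (Nat.pos_of_ne_zero hm) (hda.trans ham)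
    refine mem_filter.2 ⟨mem_filter.2 ⟨mem_Icc.2 ⟨hd0, Nat.le_floor (hdm.trans hmN)⟩, ?_⟩,
      hda.trans ham⟩
    exact le_trans (by gcongr) ha3
  have hX : (⌊x⌋₊ : ℝ) ≤ x := Nat.floor_le (by linarith)
  have h1 : S x h ≤ ∑ n ∈ Ioc h ⌊x⌋₊, (∑ a ∈ D, if a ∣ n - h then w a else 0) *
      (∑ b ∈ D, if b ∣ n then w b else 0) * (∑ c ∈ D, if c ∣ n + h then w c else 0) := by
    refine Finset.sum_le_sum fun n hn => ?_
    obtain ⟨hn1, hn2⟩ := mem_Ioc.1 hn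
    have hnx : (n : ℝ) ≤ x := le_trans (by exact_mod_cast hn2) hX
    have i1 := hbound (n - h) (by omega)
      (by rw [Nat.cast_sub hn1.le]; linarith)
    have i2 := hbound n (by omega) (by linarith)
    have i3 := hbound (n + h) (by omega) (by push_cast; linarith)
    have j1 : (0 : ℝ) ≤ ∑ d ∈ D, if d ∣ n - h then w d else 0 := le_trans (by positivity) i1
    have j2 : (0 : ℝ) ≤ ∑ d ∈ D, if d ∣ n then w d else 0 := le_trans (by positivity) i2
    gcongr
  have h2 := sum_triple_le (X := ⌊x⌋₊) (N := N) hh (by linarith) D (fun d hd => by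
    obtain ⟨k1, k2⟩ := mem_filter.1 hd
    exact ⟨by have := (mem_Icc.1 k1).1; omega, k2⟩) w hw0
  have h3 := hmean N hN2 D (Finset.filter_subset _ _)
  have h4 : ∑ d ∈ D, w d / d ≤ C' * (1 + Real.log (1 + h) / Real.log 2) * Real.log x := by
    refine h3.trans ?_
    rw [mul_assoc]
    gcongr
    exact log_add_le hx
  have h5 : 0 ≤ ∑ d ∈ D, w d / d := Finset.sum_nonneg fun d _ => div_nonneg (hw0 d) (by positivity)
  have hNx : N ≤ (1 + h) * x := by rw [hN]; nlinarith
  calc S x h ≤ 4 * h ^ 3 * N * (∑ d ∈ D, w d / d) ^ 3 := h1.trans h2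
    _ ≤ 4 * h ^ 3 * ((1 + h) * x) *
        (C' * (1 + Real.log (1 + h) / Real.log 2) * Real.log x) ^ 3 := by gcongr
    _ = _ := by ring
end

section
/- Let h be a fixed positive integer and let S(x;h) = ∑_{h < n ≤ x} d(n-h) d(n) d(n+h). Then S(x;h) ≫_h x (log x)^3 as x → ∞; that is, there exist constants c = c(h) > 0 and x_0 = x_0(h) such that for all x ≥ x_0, S(x;h) ≥ c x (log x)^3. -/
open Real Finset

/-- The odd numbers `1, 3, …, 2 * M - 1`. -/
def oddsBelow (M : ℕ) : Finset ℕ := (Finset.range M).image fun i => 2 * i + 1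

lemma mem_oddsBelow {M a : ℕ} : a ∈ oddsBelow M ↔ Odd a ∧ a < 2 * M := by
  simp only [oddsBelow, Finset.mem_image, Finset.mem_range]
  constructor
  · rintro ⟨i, hi, rfl⟩
    exact ⟨⟨i, rfl⟩, by omega⟩
  · rintro ⟨⟨i, rfl⟩, hi⟩
    exact ⟨i, by omega, rfl⟩

lemma sum_oddsBelow (M : ℕ) (f : ℕ → ℝ) :
    ∑ a ∈ oddsBelow M, f a = ∑ i ∈ Finset.range M, f (2 * i + 1) := by
  rw [oddsBelow, Finset.sum_image]
  intro i _ j _ hij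
  simpa using hij

lemma half_log_le_sum_inv_oddsBelow (M : ℕ) :
    Real.log (M + 1) / 2 ≤ ∑ a ∈ oddsBelow M, (a : ℝ)⁻¹ := by
  have h1 : Real.log (M + 1) ≤ harmonic M := by
    have := log_add_one_le_harmonic M
    exact_mod_cast this
  have h2 : (harmonic M : ℝ) / 2 ≤ ∑ a ∈ oddsBelow M, (a : ℝ)⁻¹ := by
    rw [sum_oddsBelow, harmonic]
    push_cast
    rw [Finset.sum_div]
    refine Finset.sum_le_sum fun i _ => ?_
    rw [div_eq_mul_inv, ← mul_inv]
    apply inv_anti₀ <;> first | positivity | linarith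
  linarith

lemma sum_range_inv_sq_odd_le (M : ℕ) :
    ∑ i ∈ Finset.range M, ((2 * i + 3 : ℝ)⁻¹) ^ 2 ≤ 1 / 4 - 1 / (4 * (M + 1)) := by
  induction M with
  | zero => simp
  | succ k ih =>
    rw [Finset.sum_range_succ]
    have : ((2 * k + 3 : ℝ)⁻¹) ^ 2 ≤ 1 / (4 * (k + 1)) - 1 / (4 * ((k : ℝ) + 1 + 1)) := by
      rw [inv_pow, div_sub_div _ _ (by positivity) (by positivity), ← one_div,
        div_le_div_iff₀ (by positivity) (by positivity)]
      have : (0 : ℝ) ≤ k := by positivity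
      nlinarith
    push_cast
    linarith

lemma sum_inv_sq_oddsBelow_erase_one_le (M : ℕ) :
    ∑ d ∈ (oddsBelow M).erase 1, ((d : ℝ)⁻¹) ^ 2 ≤ 1 / 4 := by
  have hsub : (oddsBelow M).erase 1 ⊆ (Finset.range M).image (fun i => 2 * i + 3) := by
    intro d hd
    rw [Finset.mem_erase, mem_oddsBelow] at hd
    obtain ⟨h1, ⟨i, rfl⟩, h2⟩ := hd
    exact Finset.mem_image.2 ⟨i - 1, by simp; omega, by omega⟩
  calc ∑ d ∈ (oddsBelow M).erase 1, ((d : ℝ)⁻¹) ^ 2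
      ≤ ∑ d ∈ (Finset.range M).image (fun i : ℕ => (2 * i + 3 : ℕ)), (((d : ℕ) : ℝ)⁻¹) ^ 2 :=
        Finset.sum_le_sum_of_subset_of_nonneg hsub fun _ _ _ => by positivity
    _ = ∑ i ∈ Finset.range M, ((2 * i + 3 : ℝ)⁻¹) ^ 2 := by
        rw [Finset.sum_image (fun i _ j _ hij => by simpa using hij)]
        push_cast
        rfl
    _ ≤ 1 / 4 - 1 / (4 * (M + 1)) := sum_range_inv_sq_odd_le M
    _ ≤ 1 / 4 := sub_le_self _ (by positivity)

lemma sum_inv_multiples_oddsBelow_le (M d : ℕ) (hd : 0 < d) :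
    ∑ a ∈ oddsBelow M, (a : ℝ)⁻¹ * (if d ∣ a then 1 else 0) ≤
      (d : ℝ)⁻¹ * ∑ a ∈ oddsBelow M, (a : ℝ)⁻¹ := by
  simp only [mul_ite, mul_one, mul_zero]
  rw [← Finset.sum_filter]
  have hinj : Set.InjOn (fun a => a / d) ((oddsBelow M).filter (d ∣ ·) : Finset ℕ) := by
    intro a ha b hb hab
    simp only [Finset.coe_filter, Set.mem_ofPred_eq] at ha hb
    exact Nat.div_left_inj ha.2 hb.2 |>.1 hab
  have hsub : ((oddsBelow M).filter (d ∣ ·)).image (fun a => a / d) ⊆ oddsBelow M := by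
    intro k hk
    obtain ⟨a, ha, rfl⟩ := Finset.mem_image.1 hk
    rw [Finset.mem_filter, mem_oddsBelow] at ha
    obtain ⟨⟨ho, hlt⟩, b, rfl⟩ := ha
    rw [mem_oddsBelow, Nat.mul_div_cancel_left _ hd]
    exact ⟨(Nat.odd_mul.1 ho).2, lt_of_le_of_lt (Nat.le_mul_of_pos_left _ hd) hlt⟩
  calc ∑ a ∈ (oddsBelow M).filter (d ∣ ·), (a : ℝ)⁻¹
      = ∑ a ∈ (oddsBelow M).filter (d ∣ ·), (d : ℝ)⁻¹ * ((a / d : ℕ) : ℝ)⁻¹ := by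
        refine Finset.sum_congr rfl fun a ha => ?_
        rw [← mul_inv, ← Nat.cast_mul, Nat.mul_div_cancel' (Finset.mem_filter.1 ha).2]
    _ = (d : ℝ)⁻¹ * ∑ k ∈ ((oddsBelow M).filter (d ∣ ·)).image (fun a => a / d), (k : ℝ)⁻¹ := by
        rw [← Finset.mul_sum, Finset.sum_image hinj]
    _ ≤ _ := by
        gcongr

/-- The indicator of `a` and `b` not being coprime. -/
noncomputable def nonCoprime (a b : ℕ) : ℝ := if a.Coprime b then 0 else 1

lemma nonCoprime_le_sum_dvd {M a b : ℕ} (ha : a ∈ oddsBelow M) :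
    nonCoprime a b ≤ ∑ d ∈ (oddsBelow M).erase 1,
      (if d ∣ a then 1 else 0) * (if d ∣ b then 1 else 0) := by
  have hnn : ∀ d ∈ (oddsBelow M).erase 1,
      (0 : ℝ) ≤ (if d ∣ a then 1 else 0) * (if d ∣ b then 1 else 0) := by
    intro d _
    positivity
  unfold nonCoprime
  split_ifs with hc
  · exact Finset.sum_nonneg hnn
  · rw [mem_oddsBelow] at ha
    have hmem : a.gcd b ∈ (oddsBelow M).erase 1 := by
      rw [Finset.mem_erase, mem_oddsBelow]
      exact ⟨hc, ha.1.of_dvd_nat (Nat.gcd_dvd_left a b),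
        (Nat.gcd_le_left b ha.1.pos).trans_lt ha.2⟩
    refine le_trans ?_ (Finset.single_le_sum hnn hmem)
    simp [Nat.gcd_dvd_left, Nat.gcd_dvd_right]

lemma sum_inv_nonCoprime_le (M : ℕ) :
    ∑ a ∈ oddsBelow M, ∑ b ∈ oddsBelow M, (a : ℝ)⁻¹ * (b : ℝ)⁻¹ * nonCoprime a b ≤
      (∑ a ∈ oddsBelow M, (a : ℝ)⁻¹) ^ 2 / 4 := by
  set O := ∑ a ∈ oddsBelow M, (a : ℝ)⁻¹
  calc ∑ a ∈ oddsBelow M, ∑ b ∈ oddsBelow M, (a : ℝ)⁻¹ * (b : ℝ)⁻¹ * nonCoprime a b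
      ≤ ∑ a ∈ oddsBelow M, ∑ b ∈ oddsBelow M, ∑ d ∈ (oddsBelow M).erase 1,
          ((a : ℝ)⁻¹ * (if d ∣ a then 1 else 0)) * ((b : ℝ)⁻¹ * (if d ∣ b then 1 else 0)) := by
        refine Finset.sum_le_sum fun a ha => Finset.sum_le_sum fun b _ => ?_
        refine (mul_le_mul_of_nonneg_left (nonCoprime_le_sum_dvd ha) (by positivity)).trans_eq ?_
        rw [Finset.mul_sum]
        exact Finset.sum_congr rfl fun d _ => by ring
    _ = ∑ d ∈ (oddsBelow M).erase 1,
          (∑ a ∈ oddsBelow M, (a : ℝ)⁻¹ * (if d ∣ a then 1 else 0)) ^ 2 := by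
        rw [Finset.sum_congr rfl fun a _ => Finset.sum_comm, Finset.sum_comm]
        exact Finset.sum_congr rfl fun d _ => by rw [sq, Finset.sum_mul_sum]
    _ ≤ ∑ d ∈ (oddsBelow M).erase 1, ((d : ℝ)⁻¹ * O) ^ 2 := by
        refine Finset.sum_le_sum fun d hd => ?_
        rw [Finset.mem_erase, mem_oddsBelow] at hd
        refine pow_le_pow_left₀ (Finset.sum_nonneg fun a _ => by positivity) ?_ 2
        exact sum_inv_multiples_oddsBelow_le M d hd.2.1.pos
    _ = (∑ d ∈ (oddsBelow M).erase 1, ((d : ℝ)⁻¹) ^ 2) * O ^ 2 := by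
        rw [Finset.sum_mul]
        exact Finset.sum_congr rfl fun d _ => mul_pow _ _ _
    _ ≤ 1 / 4 * O ^ 2 := by
        gcongr
        exact sum_inv_sq_oddsBelow_erase_one_le M
    _ = O ^ 2 / 4 := by ring

/-- A sieve lower bound for the weighted number of pairwise coprime triples of odd numbers. -/
lemma le_sum_inv_pairwise_coprime (M : ℕ) :
    (∑ a ∈ oddsBelow M, (a : ℝ)⁻¹) ^ 3 / 4 ≤
      ∑ a ∈ oddsBelow M, ∑ b ∈ oddsBelow M, ∑ c ∈ oddsBelow M,
        (a : ℝ)⁻¹ * (b : ℝ)⁻¹ * (c : ℝ)⁻¹ *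
          (1 - nonCoprime a b - nonCoprime a c - nonCoprime b c) := by
  have hE := sum_inv_nonCoprime_le M
  set O := ∑ a ∈ oddsBelow M, (a : ℝ)⁻¹ with hO
  set E := ∑ a ∈ oddsBelow M, ∑ b ∈ oddsBelow M, (a : ℝ)⁻¹ * (b : ℝ)⁻¹ * nonCoprime a b with hEdef
  have hO0 : 0 ≤ O := Finset.sum_nonneg fun a _ => by positivity
  have key : ∑ a ∈ oddsBelow M, ∑ b ∈ oddsBelow M, ∑ c ∈ oddsBelow M,
        (a : ℝ)⁻¹ * (b : ℝ)⁻¹ * (c : ℝ)⁻¹ *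
          (1 - nonCoprime a b - nonCoprime a c - nonCoprime b c) = O ^ 3 - 3 * (E * O) := by
    have e0 : ∑ a ∈ oddsBelow M, ∑ b ∈ oddsBelow M, ∑ c ∈ oddsBelow M,
        (a : ℝ)⁻¹ * (b : ℝ)⁻¹ * (c : ℝ)⁻¹ = O ^ 3 := by
      simp only [← Finset.mul_sum, ← Finset.sum_mul, ← hO]
      ring
    have e1 : ∑ a ∈ oddsBelow M, ∑ b ∈ oddsBelow M, ∑ c ∈ oddsBelow M,
        (a : ℝ)⁻¹ * (b : ℝ)⁻¹ * nonCoprime a b * (c : ℝ)⁻¹ = E * O := by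
      simp only [← Finset.mul_sum, ← Finset.sum_mul, ← hO, ← hEdef]
    have e2 : ∑ a ∈ oddsBelow M, ∑ b ∈ oddsBelow M, ∑ c ∈ oddsBelow M,
        (a : ℝ)⁻¹ * (c : ℝ)⁻¹ * nonCoprime a c * (b : ℝ)⁻¹ = E * O := by
      rw [← e1]
      exact Finset.sum_congr rfl fun a _ => Finset.sum_comm
    have e3 : ∑ a ∈ oddsBelow M, ∑ b ∈ oddsBelow M, ∑ c ∈ oddsBelow M,
        (a : ℝ)⁻¹ * ((b : ℝ)⁻¹ * (c : ℝ)⁻¹ * nonCoprime b c) = E * O := by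
      simp only [← Finset.mul_sum, ← Finset.sum_mul, ← hO, ← hEdef]
      ring
    calc _ = ∑ a ∈ oddsBelow M, ∑ b ∈ oddsBelow M, ∑ c ∈ oddsBelow M,
          ((a : ℝ)⁻¹ * (b : ℝ)⁻¹ * (c : ℝ)⁻¹
            - (a : ℝ)⁻¹ * (b : ℝ)⁻¹ * nonCoprime a b * (c : ℝ)⁻¹
            - (a : ℝ)⁻¹ * (c : ℝ)⁻¹ * nonCoprime a c * (b : ℝ)⁻¹
            - (a : ℝ)⁻¹ * ((b : ℝ)⁻¹ * (c : ℝ)⁻¹ * nonCoprime b c)) := by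
          refine Finset.sum_congr rfl fun a _ => Finset.sum_congr rfl fun b _ =>
            Finset.sum_congr rfl fun c _ => by ring
      _ = O ^ 3 - 3 * (E * O) := by
          simp only [Finset.sum_sub_distrib, e0, e1, e2, e3]
          ring
  rw [key]
  nlinarith [mul_le_mul_of_nonneg_right hE hO0]

lemma sum_dvd_le_numDiv {D : Finset ℕ} {n : ℕ} (hn : n ≠ 0) :
    ∑ a ∈ D, (if a ∣ n then (1 : ℝ) else 0) ≤ numDiv n := by
  rw [Finset.sum_boole, numDiv]
  exact_mod_cast Finset.card_le_card fun a ha =>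
    Nat.mem_divisors.2 ⟨(Finset.mem_filter.1 ha).2, hn⟩

lemma div_sub_one_le_card_modEq (h N r v : ℕ) (hr : 0 < r) :
    ((N : ℝ) - h) / r - 1 ≤ ((Finset.Ioc h N).filter (· ≡ v [MOD r])).card := by
  have hcard := Nat.Ioc_filter_modEq_card h N hr v
  have h1 : (⌊((N : ℚ) - v) / r⌋ - ⌊((h : ℚ) - v) / r⌋ : ℤ) ≤
      ((Finset.Ioc h N).filter (· ≡ v [MOD r])).card := by
    rw [hcard]
    exact le_max_left _ _
  have h2 := Int.sub_one_lt_floor (((N : ℚ) - v) / r)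
  have h3 := Int.floor_le (((h : ℚ) - v) / r)
  have h4 : ((⌊((N : ℚ) - v) / r⌋ : ℤ) - (⌊((h : ℚ) - v) / r⌋ : ℤ) : ℚ) ≤
      ((Finset.Ioc h N).filter (· ≡ v [MOD r])).card := by exact_mod_cast h1
  have h5 : ((N : ℚ) - h) / r - 1 ≤ ((Finset.Ioc h N).filter (· ≡ v [MOD r])).card := by
    have : ((N : ℚ) - h) / r = ((N : ℚ) - v) / r - ((h : ℚ) - v) / r := by ring
    linarith
  exact_mod_cast h5

/-- By the Chinese remainder theorem, the three divisibility conditions cut out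
a residue class modulo `a * b * c`. -/
lemma le_sum_dvd_of_coprime {a b c : ℕ} (h N : ℕ) (ha : 0 < a) (hb : 0 < b) (hc : 0 < c)
    (hab : a.Coprime b) (hac : a.Coprime c) (hbc : b.Coprime c) :
    ((N : ℝ) - h) / (a * b * c : ℕ) - 1 ≤ ∑ n ∈ Finset.Ioc h N,
      (if a ∣ n - h then (1 : ℝ) else 0) * (if b ∣ n then 1 else 0) *
        (if c ∣ n + h then 1 else 0) := by
  obtain ⟨u, hua, hub⟩ := Nat.chineseRemainder hab h 0
  obtain ⟨v, hvu, hvc⟩ := Nat.chineseRemainder (Nat.Coprime.mul_left hac hbc) u ((c - 1) * h)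
  refine (div_sub_one_le_card_modEq h N (a * b * c) v (by positivity)).trans ?_
  rw [← Finset.sum_boole]
  refine Finset.sum_le_sum fun n hn => ?_
  rw [Finset.mem_Ioc] at hn
  by_cases hmod : n ≡ v [MOD a * b * c]
  · have hnu : n ≡ u [MOD a * b] := (hmod.of_mul_right c).trans hvu
    have hna : a ∣ n - h :=
      (Nat.modEq_iff_dvd' hn.1.le).1 ((hnu.of_mul_right b).trans hua).symm
    have hnb : b ∣ n := Nat.modEq_zero_iff_dvd.1 ((hnu.of_mul_left a).trans hub)
    have hnc : c ∣ n + h := by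
      have := ((hmod.of_mul_left (a * b)).trans hvc).add_right h
      rw [← Nat.succ_mul, Nat.succ_eq_add_one, Nat.sub_add_cancel hc] at this
      exact (this.dvd_iff dvd_rfl).2 (dvd_mul_right c h)
    simp [hmod, hna, hnb, hnc]
  · rw [if_neg hmod]
    positivity

/-- A lower bound for `S` as soon as the moduli are at most `x ^ (1 / 3) / 2`. -/
lemma le_S_of_pow_le {x : ℝ} {h M : ℕ} (hx : 2 * (h + 1) ≤ x) (hM : (2 * M : ℝ) ^ 3 ≤ x / 8) :
    x / 16 * (∑ a ∈ oddsBelow M, (a : ℝ)⁻¹) ^ 3 ≤ S x h := by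
  have hx0 : 0 < x := by
    have : (0 : ℝ) ≤ h := by positivity
    linarith
  have hN : x - 1 < (⌊x⌋₊ : ℝ) := Nat.sub_one_lt_floor x
  set N := ⌊x⌋₊
  set D := oddsBelow M
  have hterm : ∀ a ∈ D, ∀ b ∈ D, ∀ c ∈ D,
      x / 4 * ((a : ℝ)⁻¹ * (b : ℝ)⁻¹ * (c : ℝ)⁻¹ *
          (1 - nonCoprime a b - nonCoprime a c - nonCoprime b c)) ≤
      ∑ n ∈ Finset.Ioc h N, (if a ∣ n - h then (1 : ℝ) else 0) * (if b ∣ n then 1 else 0) *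
        (if c ∣ n + h then 1 else 0) := by
    intro a ha b hb c hc
    have hnonneg : ∀ a b, 0 ≤ nonCoprime a b := by
      intro a b
      unfold nonCoprime
      positivity
    rw [mem_oddsBelow] at ha hb hc
    by_cases hcop : a.Coprime b ∧ a.Coprime c ∧ b.Coprime c
    · obtain ⟨hab, hac, hbc⟩ := hcop
      have ha0 := ha.1.pos
      have hb0 := hb.1.pos
      have hc0 := hc.1.pos
      refine le_trans ?_ (le_sum_dvd_of_coprime h N ha0 hb0 hc0 hab hac hbc)
      have hm : ((a * b * c : ℕ) : ℝ) ≤ x / 8 := by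
        refine le_trans ?_ hM
        have : a * b * c ≤ (2 * M) * (2 * M) * (2 * M) :=
          Nat.mul_le_mul (Nat.mul_le_mul ha.2.le hb.2.le) hc.2.le
        calc ((a * b * c : ℕ) : ℝ) ≤ ((2 * M) * (2 * M) * (2 * M) : ℕ) := by exact_mod_cast this
          _ = _ := by push_cast; ring
      have hm0 : (0 : ℝ) < (a * b * c : ℕ) := by positivity
      have hz : ∀ {k l : ℕ}, k.Coprime l → nonCoprime k l = 0 := fun hkl => if_pos hkl
      rw [hz hab, hz hac, hz hbc, sub_zero, sub_zero, sub_zero, mul_one, ← mul_inv, ← mul_inv,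
        ← Nat.cast_mul, ← Nat.cast_mul, ← div_eq_mul_inv, div_sub_one hm0.ne']
      gcongr
      linarith
    · refine le_trans ?_ (Finset.sum_nonneg fun n _ => by positivity)
      refine mul_nonpos_of_nonneg_of_nonpos (by positivity)
        (mul_nonpos_of_nonneg_of_nonpos (by positivity) ?_)
      have h1 := hnonneg a b
      have h2 := hnonneg a c
      have h3 := hnonneg b c
      have : nonCoprime a b = 1 ∨ nonCoprime a c = 1 ∨ nonCoprime b c = 1 := by
        unfold nonCoprime
        grind
      rcases this with h | h | h <;> linarith
  calc x / 16 * (∑ a ∈ D, (a : ℝ)⁻¹) ^ 3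
      = x / 4 * ((∑ a ∈ D, (a : ℝ)⁻¹) ^ 3 / 4) := by ring
    _ ≤ x / 4 * ∑ a ∈ D, ∑ b ∈ D, ∑ c ∈ D, (a : ℝ)⁻¹ * (b : ℝ)⁻¹ * (c : ℝ)⁻¹ *
          (1 - nonCoprime a b - nonCoprime a c - nonCoprime b c) := by
        gcongr
        exact le_sum_inv_pairwise_coprime M
    _ ≤ ∑ a ∈ D, ∑ b ∈ D, ∑ c ∈ D, ∑ n ∈ Finset.Ioc h N,
          (if a ∣ n - h then (1 : ℝ) else 0) * (if b ∣ n then 1 else 0) *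
            (if c ∣ n + h then 1 else 0) := by
        simp only [Finset.mul_sum]
        exact Finset.sum_le_sum fun a ha => Finset.sum_le_sum fun b hb =>
          Finset.sum_le_sum fun c hc => hterm a ha b hb c hc
    _ = ∑ n ∈ Finset.Ioc h N, (∑ a ∈ D, if a ∣ n - h then (1 : ℝ) else 0) *
          (∑ b ∈ D, if b ∣ n then 1 else 0) * (∑ c ∈ D, if c ∣ n + h then 1 else 0) := by
        simp only [Finset.sum_comm (t := Finset.Ioc h N), ← Finset.mul_sum, ← Finset.sum_mul]
    _ ≤ S x h := by
        refine Finset.sum_le_sum fun n hn => ?_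
        rw [Finset.mem_Ioc] at hn
        have hnn : ∀ k, (0 : ℝ) ≤ ∑ a ∈ D, if a ∣ k then 1 else 0 :=
          fun k => Finset.sum_nonneg fun a _ => by positivity
        refine mul_le_mul (mul_le_mul (sum_dvd_le_numDiv (by omega)) (sum_dvd_le_numDiv (by omega))
          (hnn _) (by positivity)) (sum_dvd_le_numDiv (by omega)) (hnn _) (by positivity)

theorem stmt2 (h : ℕ) (hh : 0 < h) :
    ∃ c : ℝ, 0 < c ∧ ∃ x₀ : ℝ, ∀ x ≥ x₀, S x h ≥ c * x * (Real.log x) ^ 3 := by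
  refine ⟨1 / 16 * (1 / 12) ^ 3, by positivity, max 4096 (2 * (h + 1)), fun x hx => ?_⟩
  have hx1 : 4096 ≤ x := (le_max_left _ _).trans hx
  have hx2 : 2 * ((h : ℝ) + 1) ≤ x := (le_max_right _ _).trans hx
  have hx0 : 0 < x := by linarith
  set y := x ^ (1 / 3 : ℝ) with hy
  have hy0 : 0 < y := by positivity
  have hy3 : y ^ 3 = x := by
    rw [hy, ← Real.rpow_natCast, ← Real.rpow_mul hx0.le]
    norm_num
  set M := ⌊y / 4⌋₊
  have hM1 : (M : ℝ) ≤ y / 4 := Nat.floor_le (by positivity)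
  have hM2 : y / 4 < M + 1 := Nat.lt_floor_add_one _
  have hM : (2 * M : ℝ) ^ 3 ≤ x / 8 := by
    calc (2 * M : ℝ) ^ 3 ≤ (y / 2) ^ 3 := by gcongr; linarith
      _ = x / 8 := by rw [div_pow, hy3]; norm_num
  have hlog : Real.log x / 6 ≤ Real.log (M + 1) := by
    have h1 : Real.log (y / 4) ≤ Real.log (M + 1) := Real.log_le_log (by positivity) hM2.le
    rw [Real.log_div hy0.ne' (by norm_num), hy, Real.log_rpow hx0] at h1
    have h2 : Real.log 4096 ≤ Real.log x := Real.log_le_log (by norm_num) hx1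
    rw [show (4096 : ℝ) = 4 ^ 6 by norm_num, Real.log_pow] at h2
    push_cast at h2
    linarith
  have hO : Real.log x / 12 ≤ ∑ a ∈ oddsBelow M, (a : ℝ)⁻¹ := by
    linarith [half_log_le_sum_inv_oddsBelow M]
  have hl0 : 0 ≤ Real.log x := Real.log_nonneg (by linarith)
  calc 1 / 16 * (1 / 12) ^ 3 * x * Real.log x ^ 3 = x / 16 * (Real.log x / 12) ^ 3 := by ring
    _ ≤ x / 16 * (∑ a ∈ oddsBelow M, (a : ℝ)⁻¹) ^ 3 := by gcongr
    _ ≤ S x h := le_S_of_pow_le hx2 hM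
end

section
/- Let f(x) = a_0 x^m + a_1 x^{m-1} + ⋯ + a_m be a primitive integral polynomial of degree m ≥ 1 (i.e., with integer coefficients whose greatest common divisor is 1) whose discriminant D is nonzero, let p be a prime and a a positive integer. If p divides D, then the congruence f(x) ≡ 0 (mod p^a) has at most m D² solutions in residue classes modulo p^a; if p does not divide D, then it has at most m solutions modulo p^a. -/
open Polynomial Finset

/-- The discriminant agrees, up to sign, with the product formula over an enumeration of the
complex roots. -/
theorem discr_dvd_of_eq_prod_roots (f : ℤ[X]) (m : ℕ) (hm : 1 ≤ m) (hdeg : f.natDegree = m)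
    (r : Fin m → ℂ)
    (hroots : f.map (Int.castRingHom ℂ) = C ((f.leadingCoeff : ℤ) : ℂ) * ∏ i, (X - C (r i)))
    (D : ℤ)
    (hD : (D : ℂ) = ((f.leadingCoeff : ℤ) : ℂ) ^ (2 * m - 2) *
      ∏ i, ∏ j ∈ Finset.univ.filter (fun j => i < j), (r i - r j) ^ 2) :
    f.discr ∣ D := by
  have hf0 : f ≠ 0 := by rintro rfl; simp at hdeg; omega
  have hc : ((f.leadingCoeff : ℤ) : ℂ) ≠ 0 := by simpa using hf0
  set c : ℂ := ((f.leadingCoeff : ℤ) : ℂ)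
  have hinj : Function.Injective (Int.castRingHom ℂ) := Int.cast_injective
  have hpos : 0 < f.degree := natDegree_pos_iff_degree_pos.mp (by omega)
  have hres := congrArg (Int.castRingHom ℂ) (resultant_deriv hpos)
  rw [← resultant_map_map] at hres
  have hg : (f.map (Int.castRingHom ℂ)).natDegree = f.natDegree :=
    natDegree_map_eq_of_injective hinj f
  have hlc : (f.map (Int.castRingHom ℂ)).leadingCoeff = c :=
    leadingCoeff_map_of_injective hinj f
  have hrts : (f.map (Int.castRingHom ℂ)).roots = Finset.univ.val.map r := by
    rw [hroots, roots_C_mul _ hc, Finset.prod_eq_multiset_prod,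
      show (univ.val.map fun i => X - C (r i)) = (univ.val.map r).map fun a => X - C a by
        rw [Multiset.map_map]; rfl,
      roots_multiset_prod_X_sub_C]
  have hder : ∀ i, (f.derivative.map (Int.castRingHom ℂ)).eval (r i) =
      c * ∏ j ∈ {i}ᶜ, (r i - r j) := by
    intro i
    rw [← derivative_map, hroots, derivative_C_mul, eval_C_mul,
      derivative_prod_finset, eval_finsetSum, Finset.sum_eq_single i]
    · simp [eval_prod, Finset.compl_eq_univ_sdiff, Finset.sdiff_singleton_eq_erase]
    · intro b _ hb
      simp only [derivative_X_sub_C, mul_one, eval_prod]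
      exact Finset.prod_eq_zero (Finset.mem_erase.mpr ⟨hb.symm, Finset.mem_univ i⟩) (by simp)
    · simp
  have hdd : (f.derivative.map (Int.castRingHom ℂ)).natDegree ≤ f.natDegree - 1 :=
    natDegree_map_le.trans (natDegree_derivative_le f)
  rw [← hg, resultant_eq_prod_eval _ _ _ (hg ▸ hdd) (IsAlgClosed.splits _), hlc, hrts, hg,
    Multiset.map_map] at hres
  have hprod : (Multiset.map ((fun z => eval z (f.derivative.map (Int.castRingHom ℂ))) ∘ r)
      Finset.univ.val).prod = c ^ m * ∏ i, ∏ j ∈ {i}ᶜ, (r i - r j) := by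
    change ∏ i, eval (r i) _ = _
    simp_rw [hder]
    rw [Finset.prod_mul_distrib]
    simp
  have hoff : ∏ i, ∏ j ∈ {i}ᶜ, (r i - r j) =
      (∏ i : Fin m, ∏ j ∈ Finset.univ.filter (fun j => i < j), (-1 : ℂ)) *
      ∏ i, ∏ j ∈ Finset.univ.filter (fun j => i < j), (r i - r j) ^ 2 := by
    rw [← Finset.prod_prod_Ioi_mul_eq_prod_prod_off_diag (fun j i => r i - r j),
      ← Finset.prod_mul_distrib]
    refine Finset.prod_congr rfl fun i _ => ?_
    rw [← Finset.prod_mul_distrib]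
    refine Finset.prod_congr (by ext; simp) fun j _ => by ring
  obtain ⟨s, hs, hs1⟩ : ∃ s : ℤ, ((s : ℂ) =
      ∏ i : Fin m, ∏ j ∈ Finset.univ.filter (fun j => i < j), (-1 : ℂ)) ∧ s * s = 1 := by
    refine ⟨∏ i : Fin m, ∏ j ∈ Finset.univ.filter (fun j => i < j), (-1), by simp, ?_⟩
    simp [← Finset.prod_mul_distrib, ← mul_pow]
  have hpow : c ^ (m - 1) * c ^ m = c * c ^ (2 * m - 2) := by
    rw [← pow_add, ← pow_succ']; congr 1; omega
  rw [hprod, hdeg, hoff, ← hs] at hres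
  simp only [map_mul, map_pow, map_neg, map_one, eq_intCast] at hres
  have key : c * ((s * D : ℤ) : ℂ) =
      c * (((-1) ^ (m * (m - 1) / 2) * f.discr : ℤ) : ℂ) := by
    push_cast
    rw [hD]
    linear_combination hres - s * (∏ i, ∏ j ∈ Finset.univ.filter (fun j => i < j),
      (r i - r j) ^ 2) * hpow
  have key2 : s * D = (-1) ^ (m * (m - 1) / 2) * f.discr := by
    exact_mod_cast mul_left_cancel₀ hc key
  exact ⟨s * (-1) ^ (m * (m - 1) / 2), by linear_combination s * key2 - D * hs1⟩

theorem discr_taylor (f : ℤ[X]) (x : ℤ) : (taylor x f).discr = f.discr := by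
  rcases Nat.eq_zero_or_pos f.natDegree with h | h
  · rw [eq_C_of_natDegree_eq_zero h, taylor_C]
  have hf0 : f ≠ 0 := by rintro rfl; simp at h
  have hd : derivative (taylor x f) = taylor x (derivative f) := by
    simp [taylor_apply, derivative_comp]
  have h1 := resultant_deriv (natDegree_pos_iff_degree_pos.mp h)
  have h2 := resultant_deriv (f := taylor x f)
    (natDegree_pos_iff_degree_pos.mp (by rwa [natDegree_taylor]))
  have h3 := resultant_taylor f (derivative f) x
  have hdn : (derivative f).natDegree = f.natDegree - 1 := natDegree_derivative _
  rw [natDegree_taylor, natDegree_taylor, hdn] at h3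
  rw [natDegree_taylor, leadingCoeff_taylor, hd, h3, h1] at h2
  exact (mul_left_cancel₀ (mul_ne_zero (by simp) (by simpa using hf0)) h2).symm

theorem dvd_discr_of_dvd_coeff (f : ℤ[X]) (hdeg : 2 ≤ f.natDegree) (d : ℤ)
    (h0 : d ∣ f.coeff 0) (h1 : d ∣ f.coeff 1) : d ∣ f.discr := by
  have hrow : ∀ j, d ∣ f.sylvesterDeriv ⟨0, by omega⟩ j := by
    intro j
    rw [sylvesterDeriv, dif_neg (by omega), Matrix.updateRow_ne (by simp [Fin.ext_iff]; omega)]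
    refine Fin.addCases (fun j => ?_) (fun j => ?_) j
    · simp only [sylvester, Matrix.of_apply, Fin.addCases_left]
      split_ifs <;> simp [h0]
    · simp only [sylvester, Matrix.of_apply, Fin.addCases_right]
      split_ifs <;> simp [coeff_derivative, h1]
  choose w hw using hrow
  rw [discr]
  refine Dvd.dvd.mul_right ?_ _
  have : f.sylvesterDeriv = f.sylvesterDeriv.updateRow ⟨0, by omega⟩ (d • w) := by
    rw [show d • w = f.sylvesterDeriv ⟨0, by omega⟩ from funext fun j => (hw j).symm,
      Matrix.updateRow_eq_self]
  rw [this, Matrix.det_updateRow_smul]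
  exact dvd_mul_right _ _

/-- For a primitive polynomial, a common divisor of a value and of the corresponding value of the
derivative divides the discriminant. -/
theorem dvd_discr_of_dvd_eval (f : ℤ[X]) (hdeg : 1 ≤ f.natDegree) (hprim : f.IsPrimitive)
    (d x : ℤ) (h0 : d ∣ f.eval x) (h1 : d ∣ f.derivative.eval x) : d ∣ f.discr := by
  rcases hdeg.eq_or_lt with h | h
  · rw [eq_X_add_C_of_natDegree_le_one h.symm.le] at h0 h1
    simp at h0 h1
    refine (hprim d ?_).dvd
    rw [C_dvd_iff_dvd_coeff]
    intro i
    match i with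
    | 0 => exact (dvd_add_right (h1.mul_right x)).mp h0
    | 1 => exact h1
    | k + 2 => rw [coeff_eq_zero_of_natDegree_lt (by omega)]; exact dvd_zero d
  · rw [← discr_taylor f x]
    exact dvd_discr_of_dvd_coeff _ (by rwa [natDegree_taylor]) d
      (by rwa [taylor_coeff_zero]) (by rwa [taylor_coeff_one])

/-- The distance from the approximate root to the root in Hensel's lemma. -/
theorem PadicInt.norm_deriv_mul_norm_sub_root {p : ℕ} [Fact p.Prime] (F : ℤ[X]) (y z : ℤ_[p])
    (hz : aeval z F = 0) (h : ‖z - y‖ < ‖aeval y F.derivative‖) :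
    ‖aeval y F.derivative‖ * ‖z - y‖ = ‖aeval y F‖ := by
  obtain ⟨k, hk⟩ := (F.map (algebraMap ℤ ℤ_[p])).binomExpansion y (z - y)
  rw [add_sub_cancel, derivative_map] at hk
  simp only [eval_map_algebraMap, hz] at hk
  have hlt : ‖k * (z - y)‖ < ‖aeval y F.derivative‖ := by
    rw [norm_mul]
    exact (mul_le_of_le_one_left (norm_nonneg _) (PadicInt.norm_le_one k)).trans_lt h
  have hsum : ‖aeval y F.derivative + k * (z - y)‖ = ‖aeval y F.derivative‖ := by
    rw [PadicInt.norm_add_eq_max_of_ne hlt.ne', max_eq_left hlt.le]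
  rw [← hsum, ← norm_mul, ← norm_neg]
  congr 1
  linear_combination hk

/-- Hensel lifting of a root modulo `p ^ a` when `p ^ (k + 1)` does not divide the derivative. -/
theorem PadicInt.exists_root_near {p : ℕ} [hp : Fact p.Prime] (F : ℤ[X]) (a k : ℕ)
    (hak : 2 * k < a) (x : ℤ) (hx : (p : ℤ) ^ a ∣ F.eval x)
    (hx' : ¬ (p : ℤ) ^ (k + 1) ∣ F.derivative.eval x) :
    ∃ z : ℤ_[p], aeval z F = 0 ∧ z - x ∈ Ideal.span {(p : ℤ_[p]) ^ (a - k)} := by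
  have hp1 : (1 : ℝ) < p := by exact_mod_cast hp.out.one_lt
  have hp0 : (0 : ℝ) < p := by linarith
  have e : ∀ G : ℤ[X], aeval (x : ℤ_[p]) G = ((G.eval x : ℤ) : ℤ_[p]) := fun G => by
    simpa using aeval_algebraMap_apply_eq_algebraMap_eval (A := ℤ_[p]) x G
  have h1 : ‖aeval (x : ℤ_[p]) F‖ ≤ (p : ℝ) ^ (-a : ℤ) := by
    rw [e]; exact PadicInt.norm_int_le_pow_iff_dvd.mpr hx
  have h2 : (p : ℝ) ^ (-k : ℤ) ≤ ‖aeval (x : ℤ_[p]) F.derivative‖ := by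
    by_contra! hlt
    rw [e] at hlt
    refine hx' (PadicInt.norm_int_le_pow_iff_dvd.mp ?_)
    rw [PadicInt.norm_le_pow_iff_norm_lt_pow_add_one]
    rwa [show -((k + 1 : ℕ) : ℤ) + 1 = -k by push_cast; ring]
  have hpk : (0 : ℝ) < (p : ℝ) ^ (-k : ℤ) := zpow_pos hp0 _
  have hlt : ‖aeval (x : ℤ_[p]) F‖ < ‖aeval (x : ℤ_[p]) F.derivative‖ ^ 2 := by
    calc _ ≤ (p : ℝ) ^ (-a : ℤ) := h1
      _ < (p : ℝ) ^ (-k + -k : ℤ) := zpow_lt_zpow_right₀ hp1 (by omega)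
      _ = ((p : ℝ) ^ (-k : ℤ)) ^ 2 := by rw [zpow_add₀ hp0.ne', sq]
      _ ≤ _ := by gcongr
  obtain ⟨z, hz, hzx, -, -⟩ := hensels_lemma hlt
  refine ⟨z, hz, (PadicInt.norm_le_pow_iff_mem_span_pow _ _).mp ?_⟩
  have h3 := PadicInt.norm_deriv_mul_norm_sub_root F _ z hz hzx
  refine le_of_mul_le_mul_left ?_ hpk
  calc _ ≤ ‖aeval (x : ℤ_[p]) F.derivative‖ * ‖z - x‖ := by gcongr
    _ ≤ (p : ℝ) ^ (-a : ℤ) := h3.le.trans h1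
    _ = _ := by rw [← zpow_add₀ hp0.ne']; congr 1; omega

theorem card_roots_mod_prime_pow_le (F : ℤ[X]) (hF : F ≠ 0) (p : ℕ) [Fact p.Prime] (a k : ℕ)
    (hak : 2 * k < a)
    (h : ∀ x : ℤ, (p : ℤ) ^ a ∣ F.eval x → ¬ (p : ℤ) ^ (k + 1) ∣ F.derivative.eval x) :
    ((range (p ^ a)).filter fun n : ℕ => (p : ℤ) ^ a ∣ F.eval (n : ℤ)).card ≤ F.natDegree * p ^ k := by
  classical
  have hinj : Function.Injective (algebraMap ℤ ℤ_[p]) := Int.cast_injective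
  have hF' : F.map (algebraMap ℤ ℤ_[p]) ≠ 0 := (Polynomial.map_ne_zero_iff hinj).mpr hF
  let R := (F.map (algebraMap ℤ ℤ_[p])).roots.toFinset
  have hR : #R ≤ F.natDegree :=
    (Multiset.toFinset_card_le _).trans ((card_roots' _).trans natDegree_map_le)
  calc _ ≤ #(R.biUnion fun z => (range (p ^ k)).image
        fun t => z.appr (a - k) + p ^ (a - k) * t) := by
        refine card_le_card fun n hn => ?_
        rw [mem_filter, mem_range] at hn
        obtain ⟨z, hz, hzn⟩ := PadicInt.exists_root_near F a k hak n hn.2 (h n hn.2)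
        simp only [mem_biUnion, mem_image, mem_range]
        refine ⟨z, ?_, n / p ^ (a - k), ?_, ?_⟩
        · rw [Multiset.mem_toFinset, mem_roots hF', IsRoot.def, eval_map_algebraMap, hz]
        · apply Nat.div_lt_of_lt_mul
          rw [← pow_add, show a - k + k = a by omega]
          exact hn.1
        · have hmod := PadicInt.zmod_congr_of_sub_mem_span (a - k) z _ n
            (PadicInt.appr_spec (a - k) z) (by simpa using hzn)
          rw [ZMod.natCast_eq_natCast_iff, Nat.ModEq, Nat.mod_eq_of_lt (PadicInt.appr_lt _ _)]
            at hmod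
          rw [hmod, Nat.mod_add_div]
    _ ≤ #R * p ^ k := card_biUnion_le_card_mul _ _ _ fun z _ =>
        card_image_le.trans (card_range _).le
    _ ≤ _ := Nat.mul_le_mul_right _ hR

theorem stmt4 (f : Polynomial ℤ) (m : ℕ) (hm : 1 ≤ m) (hdeg : f.natDegree = m)
    (hprim : f.IsPrimitive)
    -- `r` enumerates the complex roots of `f` (with multiplicity)
    (r : Fin m → ℂ)
    (hroots : f.map (Int.castRingHom ℂ) =
      Polynomial.C ((f.leadingCoeff : ℤ) : ℂ) * ∏ i, (Polynomial.X - Polynomial.C (r i)))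
    -- `D` is the discriminant of `f`
    (D : ℤ)
    (hD : (D : ℂ) = ((f.leadingCoeff : ℤ) : ℂ) ^ (2 * m - 2) *
      ∏ i, ∏ j ∈ Finset.univ.filter (fun j => i < j), (r i - r j) ^ 2)
    (hD0 : D ≠ 0) (p : ℕ) (hp : p.Prime) (a : ℕ) (ha : 0 < a) :
    (((p : ℤ) ∣ D →
      (((Finset.range (p ^ a)).filter (fun n : ℕ => ((p : ℤ) ^ a ∣ f.eval (n : ℤ)))).card : ℤ)
        ≤ (m : ℤ) * D ^ 2) ∧
    (¬ (p : ℤ) ∣ D →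
      (((Finset.range (p ^ a)).filter (fun n : ℕ => ((p : ℤ) ^ a ∣ f.eval (n : ℤ)))).card : ℤ)
        ≤ (m : ℤ))) := by
  have := Fact.mk hp
  have hf0 : f ≠ 0 := hprim.ne_zero
  have hdvd := discr_dvd_of_eq_prod_roots f m hm hdeg r hroots D hD
  obtain ⟨k, hk⟩ : ∃ k, k = padicValInt p D := ⟨_, rfl⟩
  have hkD : (p : ℤ) ^ k ∣ D := hk ▸ padicValInt_dvd D
  have hkD' : ¬ (p : ℤ) ^ (k + 1) ∣ D := by
    rw [padicValInt_dvd_iff]; omega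
  have hlarge (ha' : 2 * k < a) := card_roots_mod_prime_pow_le f hf0 p a k ha' fun x hx hx' =>
    hkD' <| (dvd_discr_of_dvd_eval f (by omega) hprim _ x
      ((pow_dvd_pow _ (by omega)).trans hx) hx').trans hdvd
  rw [hdeg] at hlarge
  have hp1 : (1 : ℤ) ≤ p := by exact_mod_cast hp.one_le
  have hm' : (1 : ℤ) ≤ m := by exact_mod_cast hm
  refine ⟨fun _ => ?_, fun hpD => ?_⟩
  · have hpk : ((p : ℤ) ^ k) ^ 2 ≤ D ^ 2 :=
      Int.le_of_dvd (by positivity) (pow_dvd_pow_of_dvd hkD 2)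
    rcases lt_or_ge (2 * k) a with ha' | ha'
    · calc _ ≤ (m : ℤ) * (p : ℤ) ^ k := by exact_mod_cast hlarge ha'
        _ ≤ m * ((p : ℤ) ^ k) ^ 2 := by
          gcongr; exact le_self_pow₀ (one_le_pow₀ hp1) two_ne_zero
        _ ≤ _ := by gcongr
    · calc _ ≤ (p : ℤ) ^ a := by
            exact_mod_cast (card_filter_le _ _).trans (card_range _).le
        _ ≤ ((p : ℤ) ^ k) ^ 2 := by
          rw [← pow_mul]; exact pow_le_pow_right₀ hp1 (by omega)
        _ ≤ D ^ 2 := hpk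
        _ ≤ _ := le_mul_of_one_le_left (sq_nonneg D) hm'
  · have hk0 : k = 0 := by
      by_contra h
      exact hpD ((dvd_pow_self _ h).trans hkD)
    subst hk0
    have := hlarge (by omega)
    rw [pow_zero, mul_one] at this
    exact_mod_cast this
end

section
/- Let h and k be integers with h k (h + k) ≠ 0, and let a be a positive integer. Then the number of residue classes n modulo a satisfying n (n + h)(n − k) ≡ 0 (mod a) is at most 3^{ω(a)} (hk)^4 (h + k)^4, where ω(a) denotes the number of distinct prime divisors of a. -/
theorem pow_dvd_mul_sub_mul_sub {p : ℤ} {e i j l : ℕ} {x y z : ℤ} (hx : p ^ i ∣ x)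
    (hy : p ^ j ∣ y) (hz : p ^ l ∣ z) (hj : j ≤ i) (hl : l ≤ i) (he : e ≤ i + j + l) :
    p ^ e ∣ x * ((x - y) * (x - z)) := by
  have h1 : p ^ j ∣ x - y := dvd_sub ((pow_dvd_pow p hj).trans hx) hy
  have h2 : p ^ l ∣ x - z := dvd_sub ((pow_dvd_pow p hl).trans hx) hz
  refine (pow_dvd_pow p he).trans ?_
  rw [add_assoc, pow_add, pow_add]
  exact mul_dvd_mul hx (mul_dvd_mul h1 h2)

/-- If a prime power divides a product of three integers, then it divides one of the factors
multiplied by the product of the differences. -/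
theorem pow_dvd_mul_differences {p : ℤ} (hp : Prime p) {e : ℕ} {x y z : ℤ}
    (h : p ^ e ∣ x * y * z) :
    p ^ e ∣ x * ((x - y) * (y - z) * (z - x)) ∨ p ^ e ∣ y * ((x - y) * (y - z) * (z - x)) ∨
      p ^ e ∣ z * ((x - y) * (y - z) * (z - x)) := by
  rcases eq_or_ne x 0 with rfl | hx
  · simp
  rcases eq_or_ne y 0 with rfl | hy
  · simp
  rcases eq_or_ne z 0 with rfl | hz
  · simp
  have hfin {w : ℤ} (hw : w ≠ 0) : FiniteMultiplicity p w :=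
    FiniteMultiplicity.of_prime_left hp hw
  have he : e ≤ multiplicity p x + multiplicity p y + multiplicity p z := by
    have hxyz := hfin (mul_ne_zero (mul_ne_zero hx hy) hz)
    rw [← multiplicity_mul hp (hfin (mul_ne_zero hx hy)), ← multiplicity_mul hp hxyz]
    exact hxyz.le_multiplicity_of_pow_dvd h
  have hX := pow_multiplicity_dvd p x
  have hY := pow_multiplicity_dvd p y
  have hZ := pow_multiplicity_dvd p z
  generalize multiplicity p x = i at *
  generalize multiplicity p y = j at *
  generalize multiplicity p z = l at *
  rcases (by omega : (j ≤ i ∧ l ≤ i) ∨ (i ≤ j ∧ l ≤ j) ∨ (i ≤ l ∧ j ≤ l)) with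
    ⟨h1, h2⟩ | ⟨h1, h2⟩ | ⟨h1, h2⟩
  · refine Or.inl ((pow_dvd_mul_sub_mul_sub hX hY hZ h1 h2 (by omega)).trans ⟨z - y, ?_⟩)
    ring
  · refine Or.inr (Or.inl
      ((pow_dvd_mul_sub_mul_sub hY hX hZ h1 h2 (by omega)).trans ⟨x - z, ?_⟩))
    ring
  · refine Or.inr (Or.inr
      ((pow_dvd_mul_sub_mul_sub hZ hX hY h1 h2 (by omega)).trans ⟨y - x, ?_⟩))
    ring

/-- A set of residues modulo `a` whose pairwise differences are all killed by `D ≠ 0` modulo `a`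
has at most `D ^ 4` elements: for fixed `m`, the integer `(n - m) * D / a` determines `n` and is
smaller than `|D|` in absolute value. -/
theorem card_le_of_dvd_sub_mul {a : ℕ} {D : ℤ} (hD : D ≠ 0) (s : Finset ℕ)
    (hs : ∀ n ∈ s, n < a) (h : ∀ n ∈ s, ∀ m ∈ s, (a : ℤ) ∣ ((n : ℤ) - m) * D) :
    s.card ≤ D.natAbs ^ 4 := by
  have hD1 : 1 ≤ |D| := Int.one_le_abs hD
  rcases s.eq_empty_or_nonempty with rfl | ⟨m, hm⟩
  · simp
  have ha : (0 : ℤ) < a := by have := hs m hm; omega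
  have hcard : s.card ≤ (Finset.Ioo (-|D|) |D|).card := by
    refine Finset.card_le_card_of_injOn (fun n : ℕ => ((n : ℤ) - m) * D / a) ?_ ?_
    · intro n hn
      obtain ⟨q, hq⟩ := h n hn m hm
      have hnm : |(n : ℤ) - m| < a := by
        have := hs n hn
        have := hs m hm
        rw [abs_lt]
        constructor <;> omega
      have habs : |(n : ℤ) - m| * |D| = a * |q| := by
        rw [← abs_mul, hq, abs_mul, abs_of_pos ha]
      have hlt : |q| < |D| := by nlinarith
      simp only [hq, Int.mul_ediv_cancel_left _ ha.ne', Finset.coe_Ioo, Set.mem_Ioo]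
      exact abs_lt.mp hlt
    · intro n hn n' hn' hnn
      have := (Int.ediv_left_inj (h n hn m hm) (h n' hn' m hm)).mp hnn
      have := mul_right_cancel₀ hD this
      omega
  rw [Int.card_Ioo] at hcard
  have hbound : (s.card : ℤ) ≤ 2 * |D| - 1 := by omega
  zify
  nlinarith [sq_nonneg (|D| - 1), sq_nonneg (|D| ^ 2 - 1)]

/-- Two integers that agree, for each prime `p ∣ a`, with a common `r` up to the factor `D` modulo
the full power of `p` in `a`, agree up to the factor `D` modulo `a`. -/
theorem dvd_sub_mul_of_forall_primeFactors {a : ℕ} (ha : a ≠ 0) {D n m : ℤ}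
    (r : a.primeFactors → ℤ)
    (hn : ∀ p : a.primeFactors, ((p : ℕ) : ℤ) ^ a.factorization p ∣ (n - r p) * D)
    (hm : ∀ p : a.primeFactors, ((p : ℕ) : ℤ) ^ a.factorization p ∣ (m - r p) * D) :
    (a : ℤ) ∣ (n - m) * D := by
  rw [Int.natCast_dvd, Nat.dvd_iff_prime_pow_dvd_dvd]
  intro p k hp hk
  rcases Nat.eq_zero_or_pos k with rfl | hk0
  · simp
  have hpa : p ∈ a.primeFactors :=
    Nat.mem_primeFactors.mpr ⟨hp, (dvd_pow_self p hk0.ne').trans hk, ha⟩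
  have hle : k ≤ a.factorization p := (hp.pow_dvd_iff_le_factorization ha).mp hk
  rw [← Int.natCast_dvd, Nat.cast_pow]
  refine (pow_dvd_pow (p : ℤ) hle).trans ?_
  convert dvd_sub (hn ⟨p, hpa⟩) (hm ⟨p, hpa⟩) using 1
  ring

theorem stmt5 (h k : ℤ) (hhk : h * k * (h + k) ≠ 0) (a : ℕ) (ha : 0 < a) :
    (((Finset.range a).filter
        (fun n : ℕ => (a : ℤ) ∣ (n : ℤ) * ((n : ℤ) + h) * ((n : ℤ) - k))).card : ℤ)
      ≤ 3 ^ a.primeFactors.card * (h * k) ^ 4 * (h + k) ^ 4 := by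
  classical
  set S := (Finset.range a).filter
    (fun n : ℕ => (a : ℤ) ∣ (n : ℤ) * ((n : ℤ) + h) * ((n : ℤ) - k))
  set D := h * k * (h + k) with hD
  let r : Fin 3 → ℤ := ![0, -h, k]
  have hlocal : ∀ n ∈ S, ∀ p : a.primeFactors, ∃ i : Fin 3,
      ((p : ℕ) : ℤ) ^ a.factorization p ∣ ((n : ℤ) - r i) * D := by
    intro n hn p
    have hp : Prime ((p : ℕ) : ℤ) :=
      Nat.prime_iff_prime_int.mp (Nat.prime_of_mem_primeFactors p.2)
    have hpa : ((p : ℕ) : ℤ) ^ a.factorization p ∣ (a : ℤ) := by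
      exact_mod_cast Nat.ordProj_dvd a p
    have hdiff : ((n : ℤ) - (n + h)) * (n + h - (n - k)) * (n - k - n) = D := by
      rw [hD]; ring
    have := pow_dvd_mul_differences hp (hpa.trans (Finset.mem_filter.mp hn).2)
    rw [hdiff] at this
    rcases this with h0 | h1 | h2
    · exact ⟨0, by simpa [r] using h0⟩
    · exact ⟨1, by simpa [r] using h1⟩
    · exact ⟨2, by simpa [r] using h2⟩
  choose! c hc using hlocal
  have hcard : S.card ≤ D.natAbs ^ 4 * (Finset.univ : Finset (a.primeFactors → Fin 3)).card := by
    refine Finset.card_le_mul_card_image_of_maps_to (f := c) (fun _ _ => Finset.mem_univ _) _ ?_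
    intro f _
    refine card_le_of_dvd_sub_mul (a := a) hhk _ ?_ ?_
    · intro n hn
      exact Finset.mem_range.mp (Finset.mem_filter.mp (Finset.mem_filter.mp hn).1).1
    · intro n hn m hm
      obtain ⟨hnS, rfl⟩ := Finset.mem_filter.mp hn
      obtain ⟨hmS, hmn⟩ := Finset.mem_filter.mp hm
      exact dvd_sub_mul_of_forall_primeFactors ha.ne' (fun p => r (c n p)) (hc n hnS)
        (fun p => hmn ▸ hc m hmS p)
  have hcard' : S.card ≤ D.natAbs ^ 4 * 3 ^ a.primeFactors.card := by simpa using hcard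
  calc (S.card : ℤ) ≤ |D| ^ 4 * 3 ^ a.primeFactors.card := by
        zify at hcard'
        exact hcard'
    _ = 3 ^ a.primeFactors.card * (h * k) ^ 4 * (h + k) ^ 4 := by
        rw [Even.pow_abs (by decide), hD]
        ring
end

section
/- Let h and k be integers with h k (h + k) ≠ 0, and let n be a positive integer with n > k so that n, n + h, n − k are positive. Then d(n) d(n + h) d(n − k) ≤ d(|h|) d(|k|) d(|h + k|) d(n (n + h)(n − k)). -/
theorem numDiv_eq_prod_of_primeFactors_subset {n : ℕ} (hn : n ≠ 0) {S : Finset ℕ}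
    (hS : n.primeFactors ⊆ S) : numDiv n = ∏ p ∈ S, (n.factorization p + 1) := by
  rw [numDiv, Nat.card_divisors hn]
  refine Finset.prod_subset hS fun p _ hp => ?_
  rw [← Nat.support_factorization, Finsupp.notMem_support_iff] at hp
  rw [hp, zero_add]

theorem succ_mul_succ_mul_succ_le {a b c x y z : ℕ} (hx : min a b ≤ x) (hy : min a c ≤ y)
    (hz : min b c ≤ z) :
    (a + 1) * (b + 1) * (c + 1) ≤ (x + 1) * (y + 1) * (z + 1) * (a + b + c + 1) := by
  have hmax : (a ≤ c ∧ b ≤ c) ∨ (a ≤ b ∧ c ≤ b) ∨ (b ≤ a ∧ c ≤ a) := by omega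
  rcases hmax with ⟨hac, hbc⟩ | ⟨hab, hcb⟩ | ⟨hba, hca⟩
  · calc (a + 1) * (b + 1) * (c + 1) = (0 + 1) * (a + 1) * (b + 1) * (c + 1) := by ring
      _ ≤ _ := by gcongr <;> omega
  · calc (a + 1) * (b + 1) * (c + 1) = (a + 1) * (0 + 1) * (c + 1) * (b + 1) := by ring
      _ ≤ _ := by gcongr <;> omega
  · calc (a + 1) * (b + 1) * (c + 1) = (b + 1) * (c + 1) * (0 + 1) * (a + 1) := by ring
      _ ≤ _ := by gcongr <;> omega

theorem numDiv_mul_mul_le {a b c x y z : ℕ} (ha : a ≠ 0) (hb : b ≠ 0) (hc : c ≠ 0)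
    (hx₀ : x ≠ 0) (hy₀ : y ≠ 0) (hz₀ : z ≠ 0)
    (hx : a.gcd b ∣ x) (hy : a.gcd c ∣ y) (hz : b.gcd c ∣ z) :
    numDiv a * numDiv b * numDiv c ≤
      numDiv x * numDiv y * numDiv z * numDiv (a * b * c) := by
  have min_le : ∀ {u v w : ℕ}, u ≠ 0 → v ≠ 0 → w ≠ 0 → u.gcd v ∣ w → ∀ p,
      min (u.factorization p) (v.factorization p) ≤ w.factorization p := by
    intro u v w hu hv hw h p
    have := (Nat.factorization_le_iff_dvd (Nat.gcd_ne_zero_left hu) hw).2 h p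
    rwa [Nat.factorization_gcd hu hv, Finsupp.inf_apply] at this
  have hprod : a * b * c * (x * y * z) ≠ 0 := by simp [*]
  have eq_prod : ∀ {m : ℕ}, m ∣ a * b * c * (x * y * z) → numDiv m =
      ∏ p ∈ (a * b * c * (x * y * z)).primeFactors, (m.factorization p + 1) := fun hm =>
    numDiv_eq_prod_of_primeFactors_subset (ne_zero_of_dvd_ne_zero hprod hm)
      (Nat.primeFactors_mono hm hprod)
  rw [eq_prod (m := a) ⟨b * c * (x * y * z), by ring⟩,
    eq_prod (m := b) ⟨a * c * (x * y * z), by ring⟩,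
    eq_prod (m := c) ⟨a * b * (x * y * z), by ring⟩,
    eq_prod (m := x) ⟨a * b * c * (y * z), by ring⟩,
    eq_prod (m := y) ⟨a * b * c * (x * z), by ring⟩,
    eq_prod (m := z) ⟨a * b * c * (x * y), by ring⟩,
    eq_prod (m := a * b * c) (Dvd.intro _ rfl)]
  simp only [← Finset.prod_mul_distrib]
  refine Finset.prod_le_prod' fun p _ => ?_
  rw [Nat.factorization_mul (mul_ne_zero ha hb) hc, Nat.factorization_mul ha hb,
    Finsupp.add_apply, Finsupp.add_apply]
  exact succ_mul_succ_mul_succ_le (min_le ha hb hx₀ hx p) (min_le ha hc hy₀ hy p)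
    (min_le hb hc hz₀ hz p)

theorem stmt9 (h k n : ℤ) (hhk : h * k * (h + k) ≠ 0)
    (hn : 0 < n) (hnh : 0 < n + h) (hnk : 0 < n - k) :
    numDiv n.toNat * numDiv (n + h).toNat * numDiv (n - k).toNat ≤
      numDiv h.natAbs * numDiv k.natAbs * numDiv (h + k).natAbs *
        numDiv (n * (n + h) * (n - k)).toNat := by
  have gcd_dvd : ∀ {u v w : ℤ}, 0 < u → 0 < v → w = u - v ∨ w = v - u →
      u.toNat.gcd v.toNat ∣ w.natAbs := by
    intro u v w hu hv hw
    have hl : ((u.toNat.gcd v.toNat : ℕ) : ℤ) ∣ u := by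
      simpa [hu.le] using Int.natCast_dvd_natCast.2 (Nat.gcd_dvd_left u.toNat v.toNat)
    have hr : ((u.toNat.gcd v.toNat : ℕ) : ℤ) ∣ v := by
      simpa [hv.le] using Int.natCast_dvd_natCast.2 (Nat.gcd_dvd_right u.toNat v.toNat)
    rw [← Int.natCast_dvd]
    rcases hw with rfl | rfl
    · exact dvd_sub hl hr
    · exact dvd_sub hr hl
  obtain ⟨⟨hh, hk⟩, hs⟩ : (h ≠ 0 ∧ k ≠ 0) ∧ h + k ≠ 0 := by
    simpa only [mul_ne_zero_iff] using hhk
  rw [Int.toNat_mul (by positivity) hnk.le, Int.toNat_mul hn.le hnh.le]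
  exact numDiv_mul_mul_le (by omega) (by omega) (by omega)
    (Int.natAbs_ne_zero.2 hh) (Int.natAbs_ne_zero.2 hk) (Int.natAbs_ne_zero.2 hs)
    (gcd_dvd hn hnh (by omega)) (gcd_dvd hn hnk (by omega)) (gcd_dvd hnh hnk (by omega))
end
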